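/- Let f = ∇φ : ℝ² → ℝ² be a generic proper gradient map such that the set A_f of sources and sinks and the set B_f of saddles are both nonempty. Then there is a generic proper gradient map f' : ℝ² → ℝ² which is proper gradient homotopic to f and satisfies |A_{f'}| < |A_f| and |B_{f'}| < |B_f|. -/

import Mathlib

open Set Metric Filter

noncomputable section

/-- Euclidean space `ℝⁿ`. -/
abbrev Euc (n : ℕ) := EuclideanSpace ℝ (Fin n)

/-- A map `f : ℝⁿ → ℝⁿ` is gradient if it is the gradient of a `C¹` function `φ : ℝⁿ → ℝ`. -/
def IsGradient {n : ℕ} (f : Euc n → Euc n) : Prop :=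
  ∃ φ : Euc n → ℝ, ContDiff ℝ 1 φ ∧ ∀ x, gradient φ x = f x

/-- A map is proper if preimages of compact sets are compact (our maps are continuous anyway). -/
def IsProper {n : ℕ} (f : Euc n → Euc n) : Prop :=
  ∀ K : Set (Euc n), IsCompact K → IsCompact (f ⁻¹' K)

/-- `h : [0,1] × ℝⁿ → ℝⁿ` is a gradient homotopy: it is continuous, each `h t` is a
gradient map, and the zero set `h⁻¹(0)` (within `[0,1] × ℝⁿ`) is compact. -/
def IsGradientHomotopy {n : ℕ} (h : ℝ → Euc n → Euc n) : Prop :=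
  ContinuousOn (fun p : ℝ × Euc n => h p.1 p.2) (Icc 0 1 ×ˢ univ) ∧
  (∀ t ∈ Icc (0:ℝ) 1, IsGradient (h t)) ∧
  IsCompact {p : ℝ × Euc n | p.1 ∈ Icc (0:ℝ) 1 ∧ h p.1 p.2 = 0}

/-- Two maps are gradient homotopic if some gradient homotopy connects them. -/
def GradientHomotopic {n : ℕ} (f g : Euc n → Euc n) : Prop :=
  ∃ h : ℝ → Euc n → Euc n, IsGradientHomotopy h ∧ h 0 = f ∧ h 1 = g

/-- `h : [0,1] × ℝⁿ → ℝⁿ` is a proper gradient homotopy: it is continuous, each `h t` is a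
gradient map, and `h` is proper as a map on `[0,1] × ℝⁿ`. -/
def IsProperGradientHomotopy {n : ℕ} (h : ℝ → Euc n → Euc n) : Prop :=
  ContinuousOn (fun p : ℝ × Euc n => h p.1 p.2) (Icc 0 1 ×ˢ univ) ∧
  (∀ t ∈ Icc (0:ℝ) 1, IsGradient (h t)) ∧
  (∀ K : Set (Euc n), IsCompact K →
    IsCompact {p : ℝ × Euc n | p.1 ∈ Icc (0:ℝ) 1 ∧ h p.1 p.2 ∈ K})

/-- Two maps are proper gradient homotopic if some proper gradient homotopy connects them. -/
def ProperGradientHomotopic {n : ℕ} (f g : Euc n → Euc n) : Prop :=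
  ∃ h : ℝ → Euc n → Euc n, IsProperGradientHomotopy h ∧ h 0 = f ∧ h 1 = g

open scoped RealInnerProductSpace

/-- `p` is a source of the gradient map `f = ∇φ`: a zero of `f` at which the Hessian of `φ`,
i.e. the derivative of `f`, is positive definite. -/
def IsSourceAt (f : Euc 2 → Euc 2) (p : Euc 2) : Prop :=
  f p = 0 ∧ ∀ v : Euc 2, v ≠ 0 → 0 < ⟪fderiv ℝ f p v, v⟫

/-- `p` is a sink of the gradient map `f = ∇φ`: a zero of `f` at which the Hessian of `φ`
is negative definite. -/
def IsSinkAt (f : Euc 2 → Euc 2) (p : Euc 2) : Prop :=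
  f p = 0 ∧ ∀ v : Euc 2, v ≠ 0 → ⟪fderiv ℝ f p v, v⟫ < 0

/-- `p` is a saddle of `f`: a zero of `f` which is neither a source nor a sink. -/
def IsSaddleAt (f : Euc 2 → Euc 2) (p : Euc 2) : Prop :=
  f p = 0 ∧ ¬ IsSourceAt f p ∧ ¬ IsSinkAt f p

/-- `γ : ℝ → ℝ²` is a (full) trajectory of the local flow of `ẋ = f(x)`. -/
def IsTrajectory (f : Euc 2 → Euc 2) (γ : ℝ → Euc 2) : Prop :=
  ∀ t : ℝ, HasDerivAt γ (f (γ t)) t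

/-- No trajectory of the local flow of `ẋ = f(x)` connects two (distinct) saddle points. -/
def NoSaddleConnection (f : Euc 2 → Euc 2) : Prop :=
  ¬ ∃ (γ : ℝ → Euc 2) (p q : Euc 2), IsTrajectory f γ ∧
      IsSaddleAt f p ∧ IsSaddleAt f q ∧ p ≠ q ∧
      Filter.Tendsto γ Filter.atBot (nhds p) ∧ Filter.Tendsto γ Filter.atTop (nhds q)

/-- `f` is a generic gradient map with potential `φ`: `φ` is `C²` with `∇φ = f`, all critical
points are nondegenerate, distinct critical points have distinct critical values, and no
trajectory of the local flow connects two saddle points. -/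
def IsGenericGradientPair (φ : Euc 2 → ℝ) (f : Euc 2 → Euc 2) : Prop :=
  ContDiff ℝ 2 φ ∧ (∀ x, gradient φ x = f x) ∧
  (∀ p : Euc 2, f p = 0 → Function.Bijective (fderiv ℝ f p)) ∧
  (∀ p q : Euc 2, f p = 0 → f q = 0 → φ p = φ q → p = q) ∧
  NoSaddleConnection f

/-- `f` is a generic gradient map. -/
def IsGenericGradient (f : Euc 2 → Euc 2) : Prop :=
  ∃ φ : Euc 2 → ℝ, IsGenericGradientPair φ f

/-- The set `A_f` of sources and sinks of `f`. -/
def sourceSinkSet (f : Euc 2 → Euc 2) : Set (Euc 2) :=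
  {p | IsSourceAt f p ∨ IsSinkAt f p}

/-- The set `B_f` of saddles of `f`. -/
def saddleSet (f : Euc 2 → Euc 2) : Set (Euc 2) :=
  {p | IsSaddleAt f p}

/-- `z ∈ E_x⁻`: the trajectory through `z` tends to `x` as `t → -∞`. -/
def InBackwardBasin (f : Euc 2 → Euc 2) (x z : Euc 2) : Prop :=
  ∃ γ : ℝ → Euc 2, γ 0 = z ∧ (∀ t ∈ Set.Iic (0:ℝ), HasDerivAt γ (f (γ t)) t) ∧
    Filter.Tendsto γ Filter.atBot (nhds x)

/-- `z ∈ E_y⁺` for a stationary point `y`: the trajectory through `z` tends to `y` in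
forward time.  (A forward trajectory converging to a stationary point exists for all
`t ≥ 0`.) -/
def InForwardBasin (f : Euc 2 → Euc 2) (y z : Euc 2) : Prop :=
  ∃ γ : ℝ → Euc 2, γ 0 = z ∧ (∀ t ∈ Set.Ici (0:ℝ), HasDerivAt γ (f (γ t)) t) ∧
    Filter.Tendsto γ Filter.atTop (nhds y)

/-- `z ∈ E_∞⁺`: the trajectory through `z` escapes to infinity as `t → ω_z`, where
`ω_z ∈ (0, ∞]` is the endpoint of the maximal forward interval of existence. -/
def EscapesToInfinity (f : Euc 2 → Euc 2) (z : Euc 2) : Prop :=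
  ∃ γ : ℝ → Euc 2, γ 0 = z ∧
    (((∀ t ∈ Set.Ici (0:ℝ), HasDerivAt γ (f (γ t)) t) ∧
        Filter.Tendsto (fun t => ‖γ t‖) Filter.atTop Filter.atTop) ∨
      (∃ ω : ℝ, 0 < ω ∧ (∀ t ∈ Set.Ico (0:ℝ) ω, HasDerivAt γ (f (γ t)) t) ∧
        Filter.Tendsto (fun t => ‖γ t‖) (nhdsWithin ω (Set.Iio ω)) Filter.atTop))

/-- The set of asymptotic backward directions `V_x^P ⊆ S¹`: unit vectors
`v_z = lim_{t → -∞} f(η^t z)/|f(η^t z)|` over points `z ∈ E_x⁻` satisfying `P`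
(membership in `E_y⁺` or `E_∞⁺`). -/
def dirSet (f : Euc 2 → Euc 2) (x : Euc 2) (P : Euc 2 → Prop) : Set (Euc 2) :=
  {v | ∃ (z : Euc 2) (γ : ℝ → Euc 2), γ 0 = z ∧
    (∀ t ∈ Set.Iic (0:ℝ), HasDerivAt γ (f (γ t)) t) ∧
    Filter.Tendsto γ Filter.atBot (nhds x) ∧ P z ∧
    Filter.Tendsto (fun t => (‖f (γ t)‖)⁻¹ • f (γ t)) Filter.atBot (nhds v)}

/-- `V_x^y` for a stationary point `y`. -/
def dirSetTo (f : Euc 2 → Euc 2) (x y : Euc 2) : Set (Euc 2) :=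
  dirSet f x (InForwardBasin f y)

/-- `V_x^∞`. -/
def dirSetInf (f : Euc 2 → Euc 2) (x : Euc 2) : Set (Euc 2) :=
  dirSet f x (EscapesToInfinity f)

section
open Set Metric Filter
open scoped RealInnerProductSpace
open scoped Topology

/-- `φ` is a `C²` potential of `f`. -/
structure Pot (φ : Euc 2 → ℝ) (f : Euc 2 → Euc 2) : Prop where
  smooth : ContDiff ℝ 2 φ
  grad : ∀ x, HasGradientAt φ (f x) x

namespace Pot
variable {φ ψ : Euc 2 → ℝ} {f g : Euc 2 → Euc 2}

theorem mk' (h : ContDiff ℝ 2 φ) (hg : ∀ x, gradient φ x = f x) : Pot φ f :=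
  ⟨h, fun x => by
    rw [← hg x]
    exact ((h.differentiable (by norm_num)) x).hasGradientAt⟩

theorem of_smooth (h : ContDiff ℝ 2 φ) : Pot φ (gradient φ) := mk' h fun _ => rfl

theorem gradient_eq (h : Pot φ f) (x) : gradient φ x = f x := (h.grad x).gradient

theorem fderiv_apply (h : Pot φ f) (x v) : fderiv ℝ φ x v = ⟪f x, v⟫ := (h.grad x).fderiv_apply

theorem hasFDerivAt (h : Pot φ f) (x) : HasFDerivAt φ (innerSL ℝ (f x)) x := by
  exact (h.grad x).hasFDerivAt

theorem cont (h : Pot φ f) : Continuous φ := h.smooth.continuous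

theorem contDiff (h : Pot φ f) : ContDiff ℝ 1 f := by
  have h1 : ContDiff ℝ 1 (fderiv ℝ φ) := h.smooth.fderiv_right (by norm_num)
  have h2 : f = fun x => (InnerProductSpace.toDual ℝ (Euc 2)).symm (fderiv ℝ φ x) := by
    funext x
    rw [← h.gradient_eq x]; rfl
  rw [h2]
  exact (InnerProductSpace.toDual ℝ (Euc 2)).symm.contDiff.comp h1

theorem contf (h : Pot φ f) : Continuous f := h.contDiff.continuous

theorem difff (h : Pot φ f) (x) : HasFDerivAt f (fderiv ℝ f x) x :=
  ((h.contDiff.differentiable (by norm_num)) x).hasFDerivAt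

theorem cont_fderiv (h : Pot φ f) : Continuous (fderiv ℝ f) :=
  h.contDiff.continuous_fderiv (by norm_num)

theorem symm (h : Pot φ f) (x v w) : ⟪fderiv ℝ f x v, w⟫ = ⟪fderiv ℝ f x w, v⟫ := by
  have h1 : ∀ y, HasFDerivAt φ ((innerSL ℝ) (f y)) y := h.hasFDerivAt
  have h2 : HasFDerivAt (fun y => (innerSL ℝ) (f y)) ((innerSL ℝ).comp (fderiv ℝ f x)) x :=
    (innerSL ℝ).hasFDerivAt.comp x (h.difff x)
  have := second_derivative_symmetric h1 h2 v w
  simpa using this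

theorem comp_deriv (h : Pot φ f) {γ : ℝ → Euc 2} {w t} (hγ : HasDerivAt γ w t) :
    HasDerivAt (fun s => φ (γ s)) ⟪f (γ t), w⟫ t := by
  have := (h.hasFDerivAt (γ t)).comp_hasDerivAt t hγ
  rw [innerSL_apply_apply] at this
  exact this

theorem line_deriv (h : Pot φ f) (o e : Euc 2) (u : ℝ) :
    HasDerivAt (fun s : ℝ => φ (o + s • e)) ⟪f (o + u • e), e⟫ u := by
  apply h.comp_deriv
  simpa using ((hasDerivAt_id u).smul_const e).const_add o

theorem neg (h : Pot φ f) : Pot (fun x => - φ x) (fun x => - f x) := by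
  refine ⟨h.smooth.neg, fun x => ?_⟩
  rw [hasGradientAt_iff_hasFDerivAt]
  have := (h.hasFDerivAt x).neg
  have e : -(innerSL ℝ (f x)) = InnerProductSpace.toDual ℝ (Euc 2) (-f x) := by
    ext v; simp
  rw [e] at this
  exact this

theorem eq_of_eventuallyEq (h : Pot φ f) (h' : Pot ψ g) {x} (he : ψ =ᶠ[𝓝 x] φ) : g x = f x := by
  rw [← h.gradient_eq, ← h'.gradient_eq]; exact he.gradient_eq

theorem eventuallyEq (h : Pot φ f) (h' : Pot ψ g) {x} (he : ψ =ᶠ[𝓝 x] φ) : g =ᶠ[𝓝 x] f := by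
  filter_upwards [eventually_eventually_nhds.2 he] with y hy
  exact h.eq_of_eventuallyEq h' hy

theorem fderiv_eq_of_eventuallyEq (h : Pot φ f) (h' : Pot ψ g) {x} (he : ψ =ᶠ[𝓝 x] φ) :
    fderiv ℝ g x = fderiv ℝ f x := (h.eventuallyEq h' he).fderiv_eq

end Pot

/-- coordinates with respect to an orthonormal pair -/
structure ON (e n : Euc 2) : Prop where
  he : ‖e‖ = 1
  hn : ‖n‖ = 1
  hen : ⟪e, n⟫ = 0

namespace ON
variable {e n : Euc 2}

theorem ee (h : ON e n) : ⟪e, e⟫ = 1 := by rw [real_inner_self_eq_norm_sq, h.he]; norm_num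
theorem nn (h : ON e n) : ⟪n, n⟫ = 1 := by rw [real_inner_self_eq_norm_sq, h.hn]; norm_num
theorem ne (h : ON e n) : ⟪n, e⟫ = 0 := by rw [real_inner_comm]; exact h.hen

theorem symm (h : ON e n) : ON n e := ⟨h.hn, h.he, h.ne⟩
theorem neg (h : ON e n) : ON (-e) n := ⟨by simp [h.he], h.hn, by simp [h.hen]⟩

theorem expand (h : ON e n) (x : Euc 2) : x = ⟪e, x⟫ • e + ⟪n, x⟫ • n := by
  have h1 := h.ee
  have h2 := h.nn
  have h3 := h.hen
  simp only [PiLp.inner_apply, Fin.sum_univ_two, RCLike.inner_apply, conj_trivial] at h1 h2 h3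
  have d2 : (e 0 * n 1 - e 1 * n 0)^2 = 1 := by nlinarith
  have k1 : n 0 = -(e 0 * n 1 - e 1 * n 0) * e 1 := by
    linear_combination (-n 0) * h1 + e 0 * h3
  have k2 : n 1 = (e 0 * n 1 - e 1 * n 0) * e 0 := by
    linear_combination (-n 1) * h1 + e 1 * h3
  set d := e 0 * n 1 - e 1 * n 0
  ext i
  fin_cases i
  · simp only [PiLp.inner_apply, Fin.sum_univ_two, RCLike.inner_apply, conj_trivial,
      PiLp.add_apply, PiLp.smul_apply, smul_eq_mul, Fin.zero_eta, Fin.isValue]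
    rw [k1, k2]
    linear_combination (-x 0) * h1 + (x 1 * e 0 * e 1 - x 0 * e 1 ^ 2) * d2
  · simp only [PiLp.inner_apply, Fin.sum_univ_two, RCLike.inner_apply, conj_trivial,
      PiLp.add_apply, PiLp.smul_apply, smul_eq_mul, Fin.mk_one, Fin.isValue]
    rw [k1, k2]
    linear_combination (-x 1) * h1 + (x 0 * e 0 * e 1 - x 1 * e 0 ^ 2) * d2

theorem exists_of_unit (he : ‖e‖ = 1) : ∃ n, ON e n := by
  have h1 : ⟪e, e⟫ = 1 := by rw [real_inner_self_eq_norm_sq, he]; norm_num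
  simp only [PiLp.inner_apply, Fin.sum_univ_two, RCLike.inner_apply, conj_trivial] at h1
  refine ⟨!₂[-e 1, e 0], he, ?_, ?_⟩
  · rw [EuclideanSpace.norm_eq, Real.sqrt_eq_one]
    simp [Fin.sum_univ_two]; nlinarith
  · simp [PiLp.inner_apply, Fin.sum_univ_two]; ring

theorem inner_eq (h : ON e n) (x y : Euc 2) : ⟪x, y⟫ = ⟪e, x⟫ * ⟪e, y⟫ + ⟪n, x⟫ * ⟪n, y⟫ := by
  conv_lhs => rw [h.expand x]
  rw [inner_add_left, real_inner_smul_left, real_inner_smul_left]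

theorem norm_sq (h : ON e n) (x : Euc 2) : ‖x‖ ^ 2 = ⟪e, x⟫ ^ 2 + ⟪n, x⟫ ^ 2 := by
  rw [← real_inner_self_eq_norm_sq, h.inner_eq]; ring

theorem eq_zero (h : ON e n) {x : Euc 2} (h1 : ⟪e, x⟫ = 0) (h2 : ⟪n, x⟫ = 0) : x = 0 := by
  rw [h.expand x, h1, h2]; simp

end ON

/-- the integral of the smooth transition -/
def thetaFn (s : ℝ) : ℝ := ∫ t in (0:ℝ)..s, Real.smoothTransition t

theorem theta_hasDerivAt (s : ℝ) : HasDerivAt thetaFn (Real.smoothTransition s) s :=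
  Real.smoothTransition.continuous.integral_hasStrictDerivAt 0 s |>.hasDerivAt

theorem theta_contDiff : ContDiff ℝ 2 thetaFn := by
  have : deriv thetaFn = Real.smoothTransition := funext fun s => (theta_hasDerivAt s).deriv
  rw [show (2 : WithTop ℕ∞) = 1 + 1 by norm_num, contDiff_succ_iff_deriv]
  refine ⟨fun s => (theta_hasDerivAt s).differentiableAt, by simp, ?_⟩
  rw [this]; exact Real.smoothTransition.contDiff

theorem theta_nonpos {s : ℝ} (hs : s ≤ 0) : thetaFn s = 0 := by
  unfold thetaFn
  rw [intervalIntegral.integral_congr (g := fun _ => (0:ℝ))]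
  · simp
  · intro t ht
    rw [uIcc_of_ge hs] at ht
    exact Real.smoothTransition.zero_of_nonpos ht.2

theorem theta_mono : Monotone thetaFn :=
  monotone_of_deriv_nonneg (fun s => (theta_hasDerivAt s).differentiableAt) fun s => by
    rw [(theta_hasDerivAt s).deriv]; exact Real.smoothTransition.nonneg s

theorem theta_nonneg (s : ℝ) : 0 ≤ thetaFn s := by
  rcases le_total s 0 with h | h
  · rw [theta_nonpos h]
  · rw [← theta_nonpos le_rfl]; exact theta_mono h

theorem theta_sub_mono : Monotone fun s => s - thetaFn s :=
  monotone_of_deriv_nonneg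
    (fun s => ((hasDerivAt_id s).sub (theta_hasDerivAt s)).differentiableAt) fun s => by
    have := ((hasDerivAt_id s).sub (theta_hasDerivAt s)).deriv
    change 0 ≤ deriv (fun s => s - thetaFn s) s
    have h2 : deriv (fun s => s - thetaFn s) s = 1 - Real.smoothTransition s := this
    rw [h2]; linarith [Real.smoothTransition.le_one s]

theorem theta_le {s : ℝ} (hs : 0 ≤ s) : thetaFn s ≤ s := by
  have := theta_sub_mono hs
  simp [theta_nonpos le_rfl] at this
  exact this

/-- on `[1,∞)` theta is a translation -/
theorem theta_ge_one {s : ℝ} (hs : 1 ≤ s) : thetaFn s = thetaFn 1 + (s - 1) := by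
  unfold thetaFn
  rw [← intervalIntegral.integral_add_adjacent_intervals (b := 1)
    (Real.smoothTransition.continuous.intervalIntegrable _ _)
    (Real.smoothTransition.continuous.intervalIntegrable _ _)]
  congr 1
  rw [intervalIntegral.integral_congr (g := fun _ => (1:ℝ))]
  · simp
  · intro t ht
    rw [uIcc_of_le hs] at ht
    exact Real.smoothTransition.one_of_one_le ht.1

theorem theta_ge (s : ℝ) : s - 1 ≤ thetaFn s := by
  rcases le_total s 1 with h | h
  · linarith [theta_nonneg s]
  · rw [theta_ge_one h]; linarith [theta_nonneg 1]

end

section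
open Set Metric Filter
set_option linter.unusedSimpArgs false
open scoped RealInnerProductSpace
open scoped Topology

/-- the trough potential -/
def psiFn (o e n : Euc 2) (g : ℝ → ℝ) (K : ℝ) (x : Euc 2) : ℝ :=
  g ⟪e, x - o⟫ + K * ⟪n, x - o⟫ ^ 2

/-- gradient of the trough potential -/
def psiGrad (o e n : Euc 2) (g : ℝ → ℝ) (K : ℝ) (x : Euc 2) : Euc 2 :=
  deriv g ⟪e, x - o⟫ • e + (2 * K * ⟪n, x - o⟫) • n

theorem pot_of_deriv {φ : Euc 2 → ℝ} {f : Euc 2 → Euc 2} (h : ContDiff ℝ 2 φ)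
    (h' : ∀ x, HasFDerivAt φ (innerSL ℝ (f x)) x) : Pot φ f :=
  ⟨h, fun x => by
    rw [hasGradientAt_iff_hasFDerivAt]
    exact h' x⟩

theorem psi_pot (o e n : Euc 2) {g : ℝ → ℝ} (hg : ContDiff ℝ 2 g) (K : ℝ) :
    Pot (psiFn o e n g K) (psiGrad o e n g K) := by
  have hu : ContDiff ℝ 2 (fun x : Euc 2 => ⟪e, x - o⟫) :=
    contDiff_const.inner ℝ (contDiff_id.sub contDiff_const)
  have hv : ContDiff ℝ 2 (fun x : Euc 2 => ⟪n, x - o⟫) :=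
    contDiff_const.inner ℝ (contDiff_id.sub contDiff_const)
  have du : ∀ (e x : Euc 2), HasFDerivAt (fun x : Euc 2 => ⟪e, x - o⟫) (innerSL ℝ e) x := by
    intro e x
    exact (innerSL ℝ e).hasFDerivAt.comp x ((hasFDerivAt_id x).sub_const o)
  refine pot_of_deriv ?_ ?_
  · unfold psiFn
    exact (hg.comp hu).add (contDiff_const.mul (hv.pow 2))
  · intro x
    have h1 : HasFDerivAt (fun x => g ⟪e, x - o⟫) (deriv g ⟪e, x - o⟫ • innerSL ℝ e) x :=
      ((hg.differentiable (by norm_num)) _).hasDerivAt.comp_hasFDerivAt x (du e x)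
    have h2 := ((du n x).pow 2).const_mul K
    have h3 := h1.add h2
    refine h3.congr_fderiv ?_
    refine ContinuousLinearMap.ext fun w => ?_
    simp [psiGrad, inner_add_left, real_inner_smul_left]
    ring

/-- carved potential, ungated -/
def coreFn (φ ψ : Euc 2 → ℝ) (K : ℝ) (x : Euc 2) : ℝ := φ x - thetaFn (K * (φ x - ψ x)) / K

theorem core_pot {φ ψ : Euc 2 → ℝ} {f p : Euc 2 → Euc 2} (h : Pot φ f) (h' : Pot ψ p)
    {K : ℝ} (hK : 0 < K) :
    Pot (coreFn φ ψ K) (fun x => (1 - Real.smoothTransition (K * (φ x - ψ x))) • f x +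
      Real.smoothTransition (K * (φ x - ψ x)) • p x) := by
  refine pot_of_deriv ?_ ?_
  · unfold coreFn
    exact h.smooth.sub ((theta_contDiff.comp (contDiff_const.mul (h.smooth.sub h'.smooth))).div_const K)
  · intro x
    have h1 : HasFDerivAt (fun x => K * (φ x - ψ x)) _ x :=
      ((h.hasFDerivAt x).sub (h'.hasFDerivAt x)).const_mul K
    have h2 := (theta_hasDerivAt (K * (φ x - ψ x))).comp_hasFDerivAt x h1
    have h3 := (h.hasFDerivAt x).sub (h2.mul_const K⁻¹)
    refine h3.congr_fderiv ?_
    refine ContinuousLinearMap.ext fun w => ?_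
    simp [inner_add_left, real_inner_smul_left]
    field_simp
    ring

theorem psi_axis {o e n : Euc 2} (h : ON e n) (g : ℝ → ℝ) (K u : ℝ) :
    psiFn o e n g K (o + u • e) = g u := by
  simp [psiFn, real_inner_smul_right, h.ne, h.ee, h.he]

set_option maxHeartbeats 1000000 in
theorem canal_quant {φ : Euc 2 → ℝ} {f : Euc 2 → Euc 2} (hP : Pot φ f) {e n : Euc 2} (h : ON e n)
    (o : Euc 2) (a b : ℝ) {g : ℝ → ℝ} (hg : ContDiff ℝ 2 g)
    (ha : φ (o + a • e) < g a) (hb : φ (o + b • e) < g b) (u0 : ℝ)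
    (hu : φ (o + u0 • e) < g u0 ∨ 0 < ⟪f (o + u0 • e), e⟫ * deriv g u0 ∨
      (g u0 < φ (o + u0 • e) ∧ ∃ C, ∀ᶠ x in 𝓝 (o + u0 • e), ⟪f x, n⟫ * ⟪n, x - o⟫ < 0 →
        |⟪f x, n⟫| ≤ C * |⟪f x, e⟫|)) :
    ∀ᶠ p : ℝ × Euc 2 in atTop ×ˢ 𝓝 (o + u0 • e),
      ((⟪e, p.2 - o⟫ = a ∨ ⟪e, p.2 - o⟫ = b) → φ p.2 < g ⟪e, p.2 - o⟫) ∧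
      (psiFn o e n g p.1 p.2 < φ p.2 → p.1 * (φ p.2 - psiFn o e n g p.1 p.2) < 1 →
        ∀ τ : ℝ, 0 < τ → τ < 1 → (1 - τ) • f p.2 + τ • psiGrad o e n g p.1 p.2 ≠ 0) := by
  have cu : Continuous (fun x : Euc 2 => ⟪e, x - o⟫) := by fun_prop
  have hu0 : ⟪e, (o + u0 • e) - o⟫ = u0 := by simp [real_inner_smul_right, h.ee, h.he]
  have edge : ∀ c, φ (o + c • e) < g c →
      ∀ᶠ x in 𝓝 (o + u0 • e), ⟪e, x - o⟫ = c → φ x < g ⟪e, x - o⟫ := by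
    intro c hc
    by_cases hcu : u0 = c
    · subst hcu
      have : ∀ᶠ x in 𝓝 (o + u0 • e), φ x < g ⟪e, x - o⟫ := by
        apply hP.cont.continuousAt.eventually_lt (hg.continuous.comp cu).continuousAt
        simpa only [Function.comp, hu0] using hc
      filter_upwards [this] with x hx _ using hx
    · have : ∀ᶠ x in 𝓝 (o + u0 • e), ⟪e, x - o⟫ ≠ c :=
        cu.continuousAt.eventually_ne (by rwa [hu0])
      filter_upwards [this] with x hx h2 using absurd h2 hx
  have cdg : Continuous (deriv g) := hg.continuous_deriv (by norm_num)
  -- consequences of vanishing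
  have key : ∀ (K : ℝ) (x : Euc 2) (τ : ℝ), (1 - τ) • f x + τ • psiGrad o e n g K x = 0 →
      (1 - τ) * ⟪f x, e⟫ + τ * deriv g ⟪e, x - o⟫ = 0 ∧
      (1 - τ) * ⟪f x, n⟫ + τ * (2 * K * ⟪n, x - o⟫) = 0 := by
    intro K x τ h0
    constructor
    · have := congrArg (fun z => ⟪z, e⟫) h0
      simpa [psiGrad, inner_add_left, real_inner_smul_left, h.ee, h.ne, h.he] using this
    · have := congrArg (fun z => ⟪z, n⟫) h0
      simpa [psiGrad, inner_add_left, real_inner_smul_left, h.hen, h.nn, h.hn] using this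
  have main : ∀ᶠ p : ℝ × Euc 2 in atTop ×ˢ 𝓝 (o + u0 • e),
      (psiFn o e n g p.1 p.2 < φ p.2 → p.1 * (φ p.2 - psiFn o e n g p.1 p.2) < 1 →
        ∀ τ : ℝ, 0 < τ → τ < 1 → (1 - τ) • f p.2 + τ • psiGrad o e n g p.1 p.2 ≠ 0) := by
    rcases hu with hu | hu | ⟨hu, C, hC⟩
    · have h1 : ∀ᶠ x in 𝓝 (o + u0 • e), φ x < g ⟪e, x - o⟫ := by
        apply hP.cont.continuousAt.eventually_lt (hg.continuous.comp cu).continuousAt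
        simpa only [Function.comp, hu0] using hu
      filter_upwards [(eventually_ge_atTop (0:ℝ)).prod_mk h1] with p hp h2
      exfalso
      have : 0 ≤ p.1 * ⟪n, p.2 - o⟫ ^ 2 := mul_nonneg hp.1 (sq_nonneg _)
      unfold psiFn at h2; linarith [hp.2]
    · have h1 : ∀ᶠ x in 𝓝 (o + u0 • e), 0 < ⟪f x, e⟫ * deriv g ⟪e, x - o⟫ := by
        have c1 : Continuous fun x => ⟪f x, e⟫ * deriv g ⟪e, x - o⟫ :=
          (hP.contf.inner continuous_const).mul (cdg.comp cu)
        apply c1.continuousAt.eventually_const_lt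
        simpa only [hu0] using hu
      filter_upwards [(eventually_ge_atTop (0:ℝ)).prod_mk h1] with p hp _ _ τ t0 t1 h0
      have := (key _ _ _ h0).1
      have h3 : (1 - τ) * (⟪f p.2, e⟫ * deriv g ⟪e, p.2 - o⟫) = - τ * (deriv g ⟪e, p.2 - o⟫)^2 := by
        linear_combination (deriv g ⟪e, p.2 - o⟫) * this
      have h4 : 0 < (1 - τ) * (⟪f p.2, e⟫ * deriv g ⟪e, p.2 - o⟫) := mul_pos (by linarith) hp.2
      nlinarith [sq_nonneg (deriv g ⟪e, p.2 - o⟫)]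
    · obtain ⟨ε, hε, hε2⟩ : ∃ ε > 0, ε < φ (o + u0 • e) - g u0 :=
        ⟨(φ (o + u0 • e) - g u0) / 2, by linarith, by linarith⟩
      have h1 : ∀ᶠ x in 𝓝 (o + u0 • e), ε < φ x - g ⟪e, x - o⟫ := by
        have c1 : Continuous fun x => φ x - g ⟪e, x - o⟫ := hP.cont.sub (hg.continuous.comp cu)
        apply c1.continuousAt.eventually_const_lt
        simpa only [hu0] using hε2
      set M := |deriv g u0| + 1 with hM
      have h2 : ∀ᶠ x in 𝓝 (o + u0 • e), |deriv g ⟪e, x - o⟫| < M := by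
        have c1 : Continuous fun x => |deriv g ⟪e, x - o⟫| := (cdg.comp cu).abs
        apply c1.continuousAt.eventually_lt_const
        simp only [hu0]; linarith
      have hK : ∀ᶠ K : ℝ in atTop, 1 ≤ K ∧ 2 < K * ε ∧ C ^ 2 * M ^ 2 < K * ε := by
        have t : Tendsto (fun K : ℝ => K * ε) atTop atTop := tendsto_id.atTop_mul_const hε
        exact (eventually_ge_atTop 1).and ((t.eventually_gt_atTop 2).and (t.eventually_gt_atTop _))
      filter_upwards [hK.prod_mk (h1.and (h2.and hC))] with p hp h3 h4 τ t0 t1 h0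
      obtain ⟨⟨k1, k2, k3⟩, e1, e2, e3⟩ := hp
      obtain ⟨q1, q2⟩ := key _ _ _ h0
      set K := p.1
      set v := ⟪n, p.2 - o⟫ with hv
      set G := deriv g ⟪e, p.2 - o⟫
      set A := ⟪f p.2, e⟫
      set B := ⟪f p.2, n⟫
      have hψ : psiFn o e n g K p.2 = g ⟪e, p.2 - o⟫ + K * v ^ 2 := rfl
      rw [hψ] at h3 h4
      have kv : K * ε < 2 * (K * (K * v ^ 2)) := by nlinarith
      have kv0 : 0 < K * v ^ 2 := by nlinarith
      have hBv : (1 - τ) * (B * v) = - (2 * τ * (K * v ^2)) := by linear_combination v * q2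
      have hBv' : B * v < 0 := by
        have : (1 - τ) * (B * v) < 0 := by rw [hBv]; nlinarith [mul_pos t0 kv0]
        by_contra hc
        push Not at hc
        nlinarith [mul_nonneg (by linarith : (0:ℝ) ≤ 1 - τ) hc]
      have hBC := e3 hBv'
      have s1 : |B| ^ 2 ≤ (C * |A|) ^ 2 := pow_le_pow_left₀ (abs_nonneg _) hBC 2
      rw [mul_pow, sq_abs, sq_abs] at s1
      have hA2 : ((1 - τ) * A) ^ 2 = τ ^ 2 * G ^ 2 := by
        have : (1 - τ) * A = - τ * G := by linarith
        rw [this]; ring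
      have hB2 : ((1 - τ) * B) ^ 2 = τ ^ 2 * (4 * (K * (K * v ^ 2))) := by
        have : (1 - τ) * B = - τ * (2 * K * v) := by linarith
        rw [this]; ring
      have s2 : τ ^ 2 * (4 * (K * (K * v ^ 2))) ≤ τ ^ 2 * (C ^ 2 * G ^ 2) := by
        have := mul_le_mul_of_nonneg_left s1 (sq_nonneg (1 - τ))
        linear_combination this + C ^ 2 * hA2 - hB2
      have s3 := le_of_mul_le_mul_left s2 (by positivity)
      have s4 : G ^ 2 ≤ M ^ 2 := by
        rw [← sq_abs G]; exact pow_le_pow_left₀ (abs_nonneg _) e2.le 2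
      have s5 : C ^ 2 * G ^ 2 ≤ C ^ 2 * M ^ 2 := mul_le_mul_of_nonneg_left s4 (sq_nonneg _)
      linarith
  filter_upwards [main, ((edge a ha).and (edge b hb)).prod_inr atTop] with p h1 h2
  exact ⟨fun hh => hh.elim h2.1 h2.2, h1⟩

theorem canal {φ : Euc 2 → ℝ} {f : Euc 2 → Euc 2} (hP : Pot φ f) {e n : Euc 2} (h : ON e n)
    (o : Euc 2) (a b : ℝ) {g : ℝ → ℝ} (hg : ContDiff ℝ 2 g)
    (ha : φ (o + a • e) < g a) (hb : φ (o + b • e) < g b)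
    (hu : ∀ u0 ∈ Icc a b, φ (o + u0 • e) < g u0 ∨ 0 < ⟪f (o + u0 • e), e⟫ * deriv g u0 ∨
      (g u0 < φ (o + u0 • e) ∧ ∃ C, ∀ᶠ x in 𝓝 (o + u0 • e), ⟪f x, n⟫ * ⟪n, x - o⟫ < 0 →
        |⟪f x, n⟫| ≤ C * |⟪f x, e⟫|))
    {N : Set (Euc 2)} (hN : IsOpen N) (hseg : ∀ u ∈ Icc a b, o + u • e ∈ N) :
    ∀ᶠ K : ℝ in atTop, ∃ φ' f', Pot φ' f' ∧ (∀ x ∉ N, φ' =ᶠ[𝓝 x] φ) ∧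
      (∀ x, ∃ τ : ℝ, 0 ≤ τ ∧ τ ≤ 1 ∧ f' x = (1 - τ) • f x + τ • psiGrad o e n g K x ∧
        (τ ≠ 0 → a < ⟪e, x - o⟫ ∧ ⟪e, x - o⟫ < b)) ∧
      (∀ x, f' x = 0 → (f x = 0 ∧ ∀ u, a < u → u < b → x = o + u • e → φ x ≤ g u) ∨
        (∃ u, a < u ∧ u < b ∧ x = o + u • e ∧ deriv g u = 0)) ∧
      (∀ u, a < u → u < b → φ' (o + u • e) ≤ g u + 1 / K ∧
        min (φ (o + u • e)) (g u) ≤ φ' (o + u • e)) ∧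
      (∀ u, a < u → u < b → 1 < K * (φ (o + u • e) - g u) →
        f' =ᶠ[𝓝 (o + u • e)] psiGrad o e n g K) := by
  classical
  have cu : Continuous (fun x : Euc 2 => ⟪e, x - o⟫) := by fun_prop
  have cv : Continuous (fun x : Euc 2 => ⟪n, x - o⟫) := by fun_prop
  set S := (fun u : ℝ => o + u • e) '' Icc a b with hS
  have cS : IsCompact S := isCompact_Icc.image (by fun_prop)
  have Q : {p : ℝ × Euc 2 | ((⟪e, p.2 - o⟫ = a ∨ ⟪e, p.2 - o⟫ = b) → φ p.2 < g ⟪e, p.2 - o⟫) ∧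
      (psiFn o e n g p.1 p.2 < φ p.2 → p.1 * (φ p.2 - psiFn o e n g p.1 p.2) < 1 →
        ∀ τ : ℝ, 0 < τ → τ < 1 → (1 - τ) • f p.2 + τ • psiGrad o e n g p.1 p.2 ≠ 0)} ∈
      (atTop : Filter ℝ) ×ˢ 𝓝ˢ S := by
    apply cS.mem_prod_nhdsSet_of_forall
    rintro _ ⟨u0, hu0, rfl⟩
    exact canal_quant hP h o a b hg ha hb u0 (hu u0 hu0)
  obtain ⟨pa, hpa, pb, hpb, hQ⟩ := eventually_prod_iff.1 Q
  obtain ⟨U, hUo, hSU, hU⟩ := eventually_nhdsSet_iff_exists.1 hpb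
  have hSN : S ⊆ U ∩ N := by
    rintro _ ⟨u, hu, rfl⟩
    exact ⟨hSU ⟨u, hu, rfl⟩, hseg u hu⟩
  obtain ⟨r, hr, hrU⟩ := cS.exists_cthickening_subset_open (hUo.inter hN) hSN
  have hbox : ∀ x, a ≤ ⟪e, x - o⟫ → ⟪e, x - o⟫ ≤ b → |⟪n, x - o⟫| ≤ r → x ∈ U ∩ N := by
    intro x h1 h2 h3
    apply hrU
    apply mem_cthickening_of_dist_le x (o + ⟪e, x - o⟫ • e) r S ⟨_, ⟨h1, h2⟩, rfl⟩
    rw [dist_eq_norm]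
    have : x - (o + ⟪e, x - o⟫ • e) = ⟪n, x - o⟫ • n := by
      rw [← sub_sub]
      conv_lhs => rw [h.expand (x - o)]
      simp [inner_add_right, real_inner_smul_right, h.hen, h.ee, h.he]
    rw [this, norm_smul, h.hn]; simpa using h3
  -- bound of `φ - g` on the box
  have cB : IsCompact (cthickening r S) := cS.cthickening
  obtain ⟨M, hM⟩ := cB.bddAbove_image (f := fun x => φ x - g ⟪e, x - o⟫)
    (hP.cont.sub (hg.continuous.comp cu)).continuousOn
  have hM' : ∀ x, a ≤ ⟪e, x - o⟫ → ⟪e, x - o⟫ ≤ b → |⟪n, x - o⟫| ≤ r →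
      φ x - g ⟪e, x - o⟫ ≤ M := by
    intro x h1 h2 h3
    apply hM
    refine ⟨x, ?_, rfl⟩
    apply mem_cthickening_of_dist_le x (o + ⟪e, x - o⟫ • e) r S ⟨_, ⟨h1, h2⟩, rfl⟩
    rw [dist_eq_norm]
    have : x - (o + ⟪e, x - o⟫ • e) = ⟪n, x - o⟫ • n := by
      rw [← sub_sub]
      conv_lhs => rw [h.expand (x - o)]
      simp [inner_add_right, real_inner_smul_right, h.hen, h.ee, h.he]
    rw [this, norm_smul, h.hn]; simpa using h3
  have hKr : ∀ᶠ K : ℝ in atTop, M < K * r ^ 2 :=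
    (tendsto_id.atTop_mul_const (by positivity : 0 < r ^ 2)).eventually_gt_atTop M
  filter_upwards [hpa, hKr, eventually_gt_atTop 0] with K hK1 hK2 hK0
  set ψ := psiFn o e n g K with hψ
  set p := psiGrad o e n g K with hp
  have hψP : Pot ψ p := psi_pot o e n hg K
  have hcore := core_pot hP hψP hK0
  set Box : Set (Euc 2) := {x | a < ⟪e, x - o⟫ ∧ ⟪e, x - o⟫ < b ∧ |⟪n, x - o⟫| < r} with hBox
  have oBox : IsOpen Box :=
    (isOpen_lt continuous_const cu).inter ((isOpen_lt cu continuous_const).inter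
      (isOpen_lt cv.abs continuous_const))
  set cBox : Set (Euc 2) := {x | a ≤ ⟪e, x - o⟫ ∧ ⟪e, x - o⟫ ≤ b ∧ |⟪n, x - o⟫| ≤ r} with hcBox
  have clBox : IsClosed cBox :=
    (isClosed_le continuous_const cu).inter ((isClosed_le cu continuous_const).inter
      (isClosed_le cv.abs continuous_const))
  have hsub : Box ⊆ cBox := fun x hx => ⟨hx.1.le, hx.2.1.le, hx.2.2.le⟩
  have hψg : ∀ x, g ⟪e, x - o⟫ ≤ ψ x := by
    intro x
    have : 0 ≤ K * ⟪n, x - o⟫ ^ 2 := by positivity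
    simp only [hψ, psiFn]; linarith
  have hedge : ∀ x ∈ cBox, x ∉ Box → φ x < ψ x := by
    intro x hx hx'
    by_cases hc : ⟪e, x - o⟫ = a ∨ ⟪e, x - o⟫ = b
    · exact lt_of_lt_of_le ((hQ hK1 (hU x (hbox x hx.1 hx.2.1 hx.2.2).1)).1 hc) (hψg x)
    · push Not at hc
      have hv : |⟪n, x - o⟫| = r := by
        by_contra hne
        exact hx' ⟨lt_of_le_of_ne hx.1 (Ne.symm hc.1), lt_of_le_of_ne hx.2.1 hc.2,
          lt_of_le_of_ne hx.2.2 hne⟩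
      have h2 := hM' x hx.1 hx.2.1 hx.2.2
      simp only [hψ, psiFn]
      rw [← sq_abs ⟪n, x - o⟫, hv]; linarith
  set φ' : Euc 2 → ℝ := fun x => if x ∈ Box then coreFn φ ψ K x else φ x with hφ'
  have hcoreφ : ∀ x, φ x ≤ ψ x → coreFn φ ψ K x = φ x := by
    intro x hx
    simp [coreFn, theta_nonpos (mul_nonpos_of_nonneg_of_nonpos hK0.le (sub_nonpos.2 hx))]
  have hin : ∀ x ∈ Box, φ' =ᶠ[𝓝 x] coreFn φ ψ K := by
    intro x hx
    filter_upwards [oBox.mem_nhds hx] with y hy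
    simp [hφ', hy]
  have hout : ∀ x ∉ Box, φ' =ᶠ[𝓝 x] φ := by
    intro x hx
    by_cases hc : x ∈ cBox
    · filter_upwards [hP.cont.continuousAt.eventually_lt hψP.cont.continuousAt (hedge x hc hx)]
        with y hy
      by_cases hy2 : y ∈ Box
      · simp [hφ', hy2, hcoreφ y hy.le]
      · simp [hφ', hy2]
    · filter_upwards [clBox.isOpen_compl.mem_nhds hc] with y hy
      have : y ∉ Box := fun h => hy (hsub h)
      simp [hφ', this]
  have hsm : ContDiff ℝ 2 φ' := by
    rw [contDiff_iff_contDiffAt]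
    intro x
    by_cases hx : x ∈ Box
    · exact hcore.smooth.contDiffAt.congr_of_eventuallyEq (hin x hx)
    · exact hP.smooth.contDiffAt.congr_of_eventuallyEq (hout x hx)
  have hP' : Pot φ' (gradient φ') := Pot.of_smooth hsm
  have gin : ∀ x ∈ Box, gradient φ' x = (1 - Real.smoothTransition (K * (φ x - ψ x))) • f x +
      Real.smoothTransition (K * (φ x - ψ x)) • p x := fun x hx =>
    hcore.eq_of_eventuallyEq hP' (hin x hx)
  have gout : ∀ x ∉ Box, gradient φ' x = f x := fun x hx =>
    hP.eq_of_eventuallyEq hP' (hout x hx)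
  have hax : ∀ u, a < u → u < b → o + u • e ∈ Box := by
    intro u h1 h2
    simp [hBox, real_inner_smul_right, h.ee, h.ne, h.he, h1, h2, hr]
  have hψax : ∀ u, ψ (o + u • e) = g u := fun u => psi_axis h g K u
  refine ⟨φ', gradient φ', hP', ?_, ?_, ?_, ?_, ?_⟩
  · intro x hx
    exact hout x fun hx2 => hx (hbox x hx2.1.le hx2.2.1.le hx2.2.2.le).2
  · intro x
    by_cases hx : x ∈ Box
    · exact ⟨_, Real.smoothTransition.nonneg _, Real.smoothTransition.le_one _, gin x hx,
        fun _ => ⟨hx.1, hx.2.1⟩⟩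
    · exact ⟨0, le_rfl, zero_le_one, by simp [gout x hx], fun h => absurd rfl h⟩
  · intro x hx0
    by_cases hx : x ∈ Box
    · rw [gin x hx] at hx0
      rcases le_or_gt (φ x) (ψ x) with h1 | h1
      · left
        rw [Real.smoothTransition.zero_of_nonpos
          (mul_nonpos_of_nonneg_of_nonpos hK0.le (sub_nonpos.2 h1))] at hx0
        refine ⟨by simpa using hx0, ?_⟩
        rintro u _ _ rfl
        rwa [hψax] at h1
      · right
        rcases lt_or_ge (K * (φ x - ψ x)) 1 with h2 | h2
        · exact absurd hx0 ((hQ hK1 (hU x (hbox x hx.1.le hx.2.1.le hx.2.2.le).1)).2 h1 h2 _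
            (Real.smoothTransition.pos_of_pos (mul_pos hK0 (sub_pos.2 h1)))
            (Real.smoothTransition.lt_one_of_lt_one h2))
        · rw [Real.smoothTransition.one_of_one_le h2] at hx0
          have h3 : p x = 0 := by simpa using hx0
          have h4 : deriv g ⟪e, x - o⟫ = 0 := by
            have := congrArg (fun z => ⟪z, e⟫) h3
            simpa [hp, psiGrad, inner_add_left, real_inner_smul_left, h.ee, h.ne, h.he] using this
          have h5 : ⟪n, x - o⟫ = 0 := by
            have := congrArg (fun z => ⟪z, n⟫) h3
            simpa [hp, psiGrad, inner_add_left, real_inner_smul_left, h.hen, h.nn, h.hn,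
              hK0.ne'] using this
          refine ⟨⟪e, x - o⟫, hx.1, hx.2.1, ?_, h4⟩
          have := h.expand (x - o)
          rw [h5] at this
          simp only [zero_smul, add_zero] at this
          rw [← this]; abel
    · left
      rw [gout x hx] at hx0
      refine ⟨hx0, ?_⟩
      rintro u h1 h2 rfl
      exact absurd (hax u h1 h2) hx
  · intro u h1 h2
    have e1 : φ' (o + u • e) = coreFn φ ψ K (o + u • e) := by simp [hφ', hax u h1 h2]
    rw [e1]
    have e2 := hψax u
    have hK' : K * (1 / K) = 1 := by field_simp
    set X := φ (o + u • e)
    have e3 : K * coreFn φ ψ K (o + u • e) = K * X - thetaFn (K * (X - g u)) := by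
      simp only [coreFn, e2]; field_simp; rfl
    constructor
    · have := theta_ge (K * (X - g u))
      apply le_of_mul_le_mul_left _ hK0
      rw [e3, mul_add, hK']; nlinarith
    · apply le_of_mul_le_mul_left _ hK0
      rw [e3]
      rcases le_total X (g u) with hc | hc
      · rw [min_eq_left hc, theta_nonpos (by nlinarith)]; simp
      · rw [min_eq_right hc]
        have := theta_le (s := K * (X - g u)) (mul_nonneg hK0.le (by linarith))
        nlinarith
  · intro u h1 h2 h3
    have c1 : Continuous fun x => K * (φ x - ψ x) := continuous_const.mul (hP.cont.sub hψP.cont)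
    have h4 : ∀ᶠ x in 𝓝 (o + u • e), 1 < K * (φ x - ψ x) := by
      apply c1.continuousAt.eventually_const_lt
      simpa only [hψax] using h3
    filter_upwards [h4, oBox.mem_nhds (hax u h1 h2)] with x hx hxB
    rw [gin x hxB, Real.smoothTransition.one_of_one_le hx.le]; simp

end

section
open Set Metric Filter
set_option linter.unusedSimpArgs false
open scoped RealInnerProductSpace
open scoped Topology

theorem W_diff : Differentiable ℝ expNegInvGlue :=
  (expNegInvGlue.contDiff (n := 1)).differentiable (by norm_num)

theorem W_deriv_nonneg (u : ℝ) : 0 ≤ deriv expNegInvGlue u := expNegInvGlue.monotone.deriv_nonneg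

theorem W_deriv_zero {u : ℝ} (hu : u ≤ 0) : deriv expNegInvGlue u = 0 := by
  apply IsLocalMin.deriv_eq_zero
  refine Filter.Eventually.of_forall fun y => ?_
  change expNegInvGlue u ≤ expNegInvGlue y
  rw [expNegInvGlue.zero_of_nonpos hu]; exact expNegInvGlue.nonneg y

/-- profile functions -/
def gFn (c0 c1 c2 l C D u : ℝ) : ℝ :=
  c0 + c1 * u + c2 * (u - l) ^ 2 + C * expNegInvGlue (u - l) + D * expNegInvGlue (-u)

theorem gFn_contDiff (c0 c1 c2 l C D : ℝ) : ContDiff ℝ 2 (gFn c0 c1 c2 l C D) := by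
  have hW : ContDiff ℝ 2 expNegInvGlue := expNegInvGlue.contDiff (n := 2)
  have h1 : ContDiff ℝ 2 (fun u : ℝ => expNegInvGlue (u - l)) :=
    hW.comp (contDiff_id.sub contDiff_const)
  have h2 : ContDiff ℝ 2 (fun u : ℝ => expNegInvGlue (-u)) := hW.comp contDiff_id.neg
  unfold gFn
  exact ((((contDiff_const.add (contDiff_const.mul contDiff_id)).add
    (contDiff_const.mul ((contDiff_id.sub contDiff_const).pow 2))).add
    (contDiff_const.mul h1)).add (contDiff_const.mul h2))

theorem gFn_deriv (c0 c1 c2 l C D u : ℝ) : deriv (gFn c0 c1 c2 l C D) u =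
    c1 + 2 * c2 * (u - l) + C * deriv expNegInvGlue (u - l) - D * deriv expNegInvGlue (-u) := by
  have h1 : HasDerivAt (fun u => expNegInvGlue (u - l)) (deriv expNegInvGlue (u - l)) u := by
    have := (W_diff (u - l)).hasDerivAt.comp u ((hasDerivAt_id u).sub_const l)
    rw [mul_one] at this
    exact this
  have h2 : HasDerivAt (fun u => expNegInvGlue (-u)) (-deriv expNegInvGlue (-u)) u := by
    have := (W_diff (-u)).hasDerivAt.comp u (hasDerivAt_neg u)
    rw [mul_neg, mul_one] at this
    exact this
  have h3 : HasDerivAt (gFn c0 c1 c2 l C D) _ u :=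
    (((((hasDerivAt_id u).const_mul c1).const_add c0).add
      ((((hasDerivAt_id u).sub_const l).pow 2).const_mul c2)).add
      (h1.const_mul C)).add (h2.const_mul D)
  rw [h3.deriv]
  simp; ring

/-- coercive zero -/
def Coer (f : Euc 2 → Euc 2) (x : Euc 2) : Prop :=
  f x = 0 ∧ ∃ κ > 0, ∀ᶠ z in 𝓝 x, κ * ‖z - x‖ ^ 2 ≤ ⟪f z, z - x⟫

/-- saddle estimate -/
def SadCoer (f : Euc 2 → Euc 2) (e n x : Euc 2) : Prop :=
  f x = 0 ∧ ∃ κ > 0, ∀ᶠ z in 𝓝 x, κ * ‖z - x‖ ^ 2 ≤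
    - (⟪f z, e⟫ * ⟪e, z - x⟫) + ⟪f z, n⟫ * ⟪n, z - x⟫

theorem third_of_ne {φ : Euc 2 → ℝ} {f : Euc 2 → Euc 2} (hP : Pot φ f) {e : Euc 2} (n o x0 : Euc 2)
    (h0 : ⟪f x0, e⟫ ≠ 0) : ∃ C, ∀ᶠ x in 𝓝 x0, ⟪f x, n⟫ * ⟪n, x - o⟫ < 0 →
        |⟪f x, n⟫| ≤ C * |⟪f x, e⟫| := by
  have h1 : 0 < |⟪f x0, e⟫| := abs_pos.2 h0
  refine ⟨(|⟪f x0, n⟫| + 1) / |⟪f x0, e⟫| , ?_⟩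
  have c : Continuous fun x => (|⟪f x0, n⟫| + 1) / |⟪f x0, e⟫| * |⟪f x, e⟫| - |⟪f x, n⟫| :=
    (continuous_const.mul (hP.contf.inner continuous_const).abs).sub
      (hP.contf.inner continuous_const).abs
  have : ∀ᶠ x in 𝓝 x0, 0 < (|⟪f x0, n⟫| + 1) / |⟪f x0, e⟫| * |⟪f x, e⟫| - |⟪f x, n⟫| := by
    refine c.continuousAt.eventually_const_lt ?_
    beta_reduce
    rw [div_mul_cancel₀ _ h1.ne']
    linarith
  filter_upwards [this] with x hx _
  linarith

theorem third_of_crit {φ : Euc 2 → ℝ} {f : Euc 2 → Euc 2} (hP : Pot φ f) {e n : Euc 2} (h : ON e n)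
    (o x0 : Euc 2) (hx0 : f x0 = 0) (hn : ⟪n, x0 - o⟫ = 0) (s : ℝ) (hs : |s| ≤ 1) {κ : ℝ} (hκ : 0 < κ)
    (hq : ∀ᶠ z in 𝓝 x0, κ * ‖z - x0‖ ^ 2 ≤
      s * (⟪f z, e⟫ * ⟪e, z - x0⟫) + ⟪f z, n⟫ * ⟪n, z - x0⟫) :
    ∃ C, ∀ᶠ x in 𝓝 x0, ⟪f x, n⟫ * ⟪n, x - o⟫ < 0 → |⟪f x, n⟫| ≤ C * |⟪f x, e⟫| := by
  obtain ⟨M, hM⟩ := ((hP.difff x0).isBigO_sub).bound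
  refine ⟨M / κ, ?_⟩
  filter_upwards [hq, hM] with x h1 h2 h3
  rw [hx0, sub_zero] at h2
  have e1 : ⟪n, x - x0⟫ = ⟪n, x - o⟫ := by
    have : x - x0 = (x - o) - (x0 - o) := by abel
    rw [this, inner_sub_right, hn, sub_zero]
  rw [e1] at h1
  have hB : |⟪f x, n⟫| ≤ ‖f x‖ := by
    have := abs_real_inner_le_norm (f x) n
    rwa [h.hn, mul_one] at this
  have hE : |⟪e, x - x0⟫| ≤ ‖x - x0‖ := by
    have := abs_real_inner_le_norm e (x - x0)
    rwa [h.he, one_mul] at this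
  have hne : 0 < ‖x - x0‖ := by
    rw [norm_pos_iff]
    intro h0
    rw [← e1, h0] at h3; simp at h3
  have h4 : s * (⟪f x, e⟫ * ⟪e, x - x0⟫) ≤ |⟪f x, e⟫| * ‖x - x0‖ := by
    refine (le_abs_self _).trans ?_
    rw [abs_mul, abs_mul]
    calc |s| * (|⟪f x, e⟫| * |⟪e, x - x0⟫|) ≤ 1 * (|⟪f x, e⟫| * ‖x - x0‖) := by gcongr
      _ = _ := one_mul _
  have h5 : κ * ‖x - x0‖ ≤ |⟪f x, e⟫| := by
    have : κ * ‖x - x0‖ * ‖x - x0‖ ≤ |⟪f x, e⟫| * ‖x - x0‖ := by nlinarith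
    exact le_of_mul_le_mul_right this hne
  have hM0 : 0 ≤ M := by
    by_contra hc
    push Not at hc
    nlinarith [norm_nonneg (f x)]
  calc |⟪f x, n⟫| ≤ M * ‖x - x0‖ := hB.trans h2
    _ = M / κ * (κ * ‖x - x0‖) := by field_simp
    _ ≤ _ := by gcongr

theorem coer_third {φ : Euc 2 → ℝ} {f : Euc 2 → Euc 2} (hP : Pot φ f) {e n : Euc 2} (h : ON e n)
    (o x0 : Euc 2) (hc : Coer f x0) (hn : ⟪n, x0 - o⟫ = 0) :
    ∃ C, ∀ᶠ x in 𝓝 x0, ⟪f x, n⟫ * ⟪n, x - o⟫ < 0 → |⟪f x, n⟫| ≤ C * |⟪f x, e⟫| := by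
  obtain ⟨h0, κ, hκ, hq⟩ := hc
  refine third_of_crit hP h o x0 h0 hn 1 (by simp) hκ ?_
  filter_upwards [hq] with z hz
  rw [h.inner_eq] at hz
  rw [one_mul, real_inner_comm e, real_inner_comm n]; exact hz

theorem sad_third {φ : Euc 2 → ℝ} {f : Euc 2 → Euc 2} (hP : Pot φ f) {e n : Euc 2} (h : ON e n)
    (o x0 : Euc 2) (hc : SadCoer f e n x0) (hn : ⟪n, x0 - o⟫ = 0) :
    ∃ C, ∀ᶠ x in 𝓝 x0, ⟪f x, n⟫ * ⟪n, x - o⟫ < 0 → |⟪f x, n⟫| ≤ C * |⟪f x, e⟫| := by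
  obtain ⟨h0, κ, hκ, hq⟩ := hc
  refine third_of_crit hP h o x0 h0 hn (-1) (by simp) hκ ?_
  filter_upwards [hq] with z hz
  linarith

theorem Icc_enlarge {O : Set ℝ} (hO : IsOpen O) {l : ℝ} (hl : 0 ≤ l) (h : Icc 0 l ⊆ O) :
    ∃ η > 0, Icc (-η) (l + η) ⊆ O := by
  obtain ⟨δ, hδ, hs⟩ := (isCompact_Icc (a := (0:ℝ)) (b := l)).exists_thickening_subset_open hO h
  refine ⟨δ / 2, by linarith, fun u hu => hs ?_⟩
  rw [mem_thickening_iff]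
  rcases lt_or_ge u 0 with h1 | h1
  · exact ⟨0, ⟨le_rfl, hl⟩, by rw [Real.dist_eq, sub_zero, abs_of_neg h1]; linarith [hu.1]⟩
  rcases le_or_gt u l with h2 | h2
  · exact ⟨u, ⟨h1, h2⟩, by simpa using hδ⟩
  · exact ⟨l, ⟨hl, le_rfl⟩, by rw [Real.dist_eq, abs_of_pos (by linarith)]; linarith [hu.2]⟩

/-- zero-allowed positivity along a direction -/
def Posi (f : Euc 2 → Euc 2) (y w : Euc 2) (t : ℝ) : Prop :=
  0 < ⟪f (y + t • w), w⟫ ∨ (t = 0 ∧ f y = 0)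

theorem pres {f f' : Euc 2 → Euc 2} {e n : Euc 2} (h : ON e n) {x w' : Euc 2} {l t K τ : ℝ}
    {g : ℝ → ℝ} (hK : 0 ≤ K) (ht : 0 ≤ t) (hw : 0 < ⟪e, w'⟫) (h0 : 0 ≤ τ) (h1 : τ ≤ 1)
    (hf' : f' (x + l • e + t • w') = (1 - τ) • f (x + l • e + t • w') +
      τ • psiGrad x e n g K (x + l • e + t • w'))
    (hf : 0 < ⟪f (x + l • e + t • w'), w'⟫) (hg : 0 < deriv g (l + t * ⟪e, w'⟫)) :
    0 < ⟪f' (x + l • e + t • w'), w'⟫ := by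
  have e1 : x + l • e + t • w' - x = l • e + t • w' := by abel
  have e2 : ⟪psiGrad x e n g K (x + l • e + t • w'), w'⟫ =
      deriv g (l + t * ⟪e, w'⟫) * ⟪e, w'⟫ + 2 * K * t * ⟪n, w'⟫ ^ 2 := by
    unfold psiGrad
    rw [e1]
    simp only [inner_add_left, inner_add_right, real_inner_smul_left, real_inner_smul_right, h.ee,
      h.ne, mul_one, mul_zero, zero_add]
    ring
  have e3 : 0 < ⟪psiGrad x e n g K (x + l • e + t • w'), w'⟫ := by
    rw [e2]
    have : 0 ≤ 2 * K * t * ⟪n, w'⟫ ^ 2 := by positivity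
    have := mul_pos hg hw
    linarith
  rw [hf', inner_add_left, real_inner_smul_left, real_inner_smul_left]
  rcases h0.eq_or_lt with hτ | hτ
  · rw [← hτ]; simpa using hf
  · have := mul_pos hτ e3
    have := mul_nonneg (sub_nonneg.2 h1) hf.le
    linarith

theorem alpha_mono {φ : Euc 2 → ℝ} {f : Euc 2 → Euc 2} (hP : Pot φ f) (x e : Euc 2) {a b : ℝ}
    (h : ∀ u ∈ Ioo a b, 0 < ⟪f (x + u • e), e⟫) :
    StrictMonoOn (fun u : ℝ => φ (x + u • e)) (Icc a b) := by
  apply strictMonoOn_of_deriv_pos (convex_Icc a b)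
  · exact (hP.cont.comp (by fun_prop)).continuousOn
  · intro u hu
    rw [interior_Icc] at hu
    rw [(hP.line_deriv x e u).deriv]; exact h u hu

/-- existence of a large wall constant -/
theorem wall {η : ℝ} (hη : 0 < η) (A : ℝ) : ∃ C, 0 ≤ C ∧ A < C * expNegInvGlue η := by
  have hW := expNegInvGlue.pos_of_pos hη
  refine ⟨(|A| + 1) / expNegInvGlue η, by positivity, ?_⟩
  rw [div_mul_cancel₀ _ hW.ne']
  linarith [le_abs_self A]

set_option maxHeartbeats 1000000 in
theorem stepL_unit {φ : Euc 2 → ℝ} {f : Euc 2 → Euc 2} (hP : Pot φ f) {e n : Euc 2} (h : ON e n)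
    {x : Euc 2} {l lev : ℝ} (hl : 0 < l) (hpos : ∀ u ∈ Icc 0 l, 0 < ⟪f (x + u • e), e⟫)
    (hlev : φ x < lev) {N : Set (Euc 2)} (hN : IsOpen N) (hseg : ∀ u ∈ Icc 0 l, x + u • e ∈ N) :
    ∃ φ' f', Pot φ' f' ∧ (∀ z ∉ N, φ' =ᶠ[𝓝 z] φ) ∧ (∀ z, f' z = 0 → f z = 0) ∧
      φ' (x + l • e) < lev ∧
      ∀ w', 0 < ⟪e, w'⟫ → ∀ t : ℝ, 0 ≤ t → 0 < ⟪f (x + l • e + t • w'), w'⟫ →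
        0 < ⟪f' (x + l • e + t • w'), w'⟫ := by
  have cl : Continuous (fun u : ℝ => x + u • e) := by fun_prop
  have o1 : IsOpen {u : ℝ | 0 < ⟪f (x + u • e), e⟫} :=
    isOpen_lt continuous_const ((hP.contf.comp cl).inner continuous_const)
  have o2 : IsOpen {u : ℝ | x + u • e ∈ N} := hN.preimage cl
  obtain ⟨η, hη, hsub⟩ := Icc_enlarge
    (O := {u : ℝ | 0 < ⟪f (x + u • e), e⟫} ∩ {u : ℝ | x + u • e ∈ N})
    (o1.inter o2) hl.le (fun u hu => ⟨hpos u hu, hseg u hu⟩)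
  have hmono := alpha_mono hP x e (a := -η) (b := l + η)
    (fun u hu => (hsub (Ioo_subset_Icc_self hu)).1)
  have ha0 : φ (x + (-η) • e) < φ x := by
    have := hmono (a := -η) (b := 0) ⟨le_rfl, by linarith⟩ ⟨by linarith, by linarith⟩ (by linarith)
    simpa using this
  obtain ⟨g0, hg0, hg1⟩ := exists_between (ha0.trans hlev)
  set σ := (lev - g0) / (2 * (l + η)) with hσ
  have hσ0 : 0 < σ := div_pos (by linarith) (by linarith)
  have hσ1 : g0 + σ * (l + η) < lev := by
    have : σ * (l + η) = (lev - g0) / 2 := by rw [hσ]; field_simp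
    rw [this]; linarith
  obtain ⟨C, hC, hC2⟩ := wall hη (φ (x + (l + η) • e) - g0)
  obtain ⟨g, hg⟩ : ∃ g, g = gFn (g0 + σ * η) σ 0 l C 0 := ⟨_, rfl⟩
  have hgc : ContDiff ℝ 2 g := hg ▸ gFn_contDiff _ _ _ _ _ _
  have hgd : ∀ u, 0 < deriv g u := by
    intro u
    rw [hg, gFn_deriv]
    have := mul_nonneg hC (W_deriv_nonneg (u - l))
    linarith
  have gl : g l = g0 + σ * (l + η) := by
    simp [hg, gFn, expNegInvGlue.zero_of_nonpos]; ring
  have ga : g (-η) = g0 := by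
    simp [hg, gFn, expNegInvGlue.zero_of_nonpos (show -η - l ≤ 0 by linarith)]
  have gb : φ (x + (l + η) • e) < g (l + η) := by
    have h1 : l + η - l = η := by ring
    simp only [hg, gFn, h1]
    nlinarith
  have hcan := canal hP h x (-η) (l + η) hgc
    (by rw [ga]; exact hg0) gb (fun u hu => Or.inr (Or.inl (mul_pos (hsub hu).1 (hgd u)))) hN
    (fun u hu => (hsub hu).2)
  have hKl : ∀ᶠ K : ℝ in atTop, g l + 1 / K < lev := by
    have : Tendsto (fun K : ℝ => g l + 1 / K) atTop (𝓝 (g l + 0)) := by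
      apply Tendsto.const_add
      exact tendsto_const_nhds.div_atTop tendsto_id
    apply this.eventually_lt_const
    rw [gl]; linarith
  obtain ⟨K, ⟨φ', f', hP', h1, h2, h3, h4, h5⟩, hK2, hK0⟩ :=
    (hcan.and (hKl.and (eventually_gt_atTop 0))).exists
  refine ⟨φ', f', hP', h1, ?_, ?_, ?_⟩
  · intro z hz
    rcases h3 z hz with h | ⟨u, _, _, _, hu⟩
    · exact h.1
    · exact absurd hu (hgd u).ne'
  · exact ((h4 l (by linarith) (by linarith)).1).trans_lt hK2
  · intro w' hw t ht hf
    obtain ⟨τ, t0, t1, hf', _⟩ := h2 (x + l • e + t • w')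
    exact pres (f := f) (f' := f') (x := x) (w' := w') (l := l) (t := t) (K := K) (τ := τ) (g := g) h hK0.le ht hw t0 t1 hf' hf (hgd _)

set_option maxHeartbeats 1000000 in
theorem stepM_unit {φ : Euc 2 → ℝ} {f : Euc 2 → Euc 2} (hP : Pot φ f) {e n : Euc 2} (h : ON e n)
    {x : Euc 2} {l lev : ℝ} (hl : 0 < l) (hx : Coer f x)
    (hpos : ∀ u ∈ Ioc 0 l, 0 < ⟪f (x + u • e), e⟫)
    (hlev : lev < φ x) {N : Set (Euc 2)} (hN : IsOpen N) (hseg : ∀ u ∈ Icc 0 l, x + u • e ∈ N) :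
    ∃ φ' f', Pot φ' f' ∧ (∀ z ∉ N, φ' =ᶠ[𝓝 z] φ) ∧
      (∀ z, f' z = 0 → (f z = 0 ∧ z ≠ x) ∨ z = x + l • e) ∧
      lev < φ' (x + l • e) ∧ Coer f' (x + l • e) ∧
      ∀ w', 0 < ⟪e, w'⟫ → ∀ t : ℝ, 0 < t → 0 < ⟪f (x + l • e + t • w'), w'⟫ →
        0 < ⟪f' (x + l • e + t • w'), w'⟫ := by
  obtain ⟨hx0, κ, hκ, hq⟩ := id hx
  -- near `x`
  have hq' : ∀ᶠ u : ℝ in 𝓝 0, κ * u ^ 2 ≤ u * ⟪f (x + u • e), e⟫ := by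
    have ht : Tendsto (fun u : ℝ => x + u • e) (𝓝 0) (𝓝 x) := by
      have : Continuous (fun u : ℝ => x + u • e) := by fun_prop
      simpa using this.tendsto 0
    filter_upwards [ht.eventually hq] with u hu
    simpa [norm_smul, h.he, real_inner_smul_right] using hu
  obtain ⟨δ, hδ, hball⟩ := Metric.eventually_nhds_iff.1 hq'
  obtain ⟨η1, hη1, hsub1⟩ := Icc_enlarge (O := {u : ℝ | x + u • e ∈ N})
    (hN.preimage (by fun_prop)) hl.le (fun u hu => hseg u hu)
  -- near the end
  obtain ⟨δ2, hδ2, hball2⟩ := Metric.isOpen_iff.1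
    (show IsOpen {u : ℝ | 0 < ⟪f (x + u • e), e⟫} from
      isOpen_lt continuous_const ((hP.contf.comp (by fun_prop)).inner continuous_const)) l
      (hpos l ⟨hl, le_rfl⟩)
  obtain ⟨η, hη, hηm⟩ : ∃ η > 0, η < min η1 (min δ δ2) :=
    exists_between (lt_min hη1 (lt_min hδ hδ2))
  obtain ⟨m1, m2, m3⟩ : η < η1 ∧ η < δ ∧ η < δ2 := by simpa using hηm
  have hneg : ∀ u ∈ Ico (-η) 0, ⟪f (x + u • e), e⟫ < 0 := by
    intro u hu
    have := hball (y := u) (by rw [Real.dist_eq, sub_zero, abs_of_neg hu.2]; linarith [hu.1])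
    have hu2 : 0 < κ * u ^ 2 := by have := hu.2.ne; positivity
    by_contra hc
    push Not at hc
    nlinarith [mul_nonpos_of_nonpos_of_nonneg hu.2.le hc]
  have hpos' : ∀ u ∈ Ioc 0 (l + η), 0 < ⟪f (x + u • e), e⟫ := by
    intro u hu
    rcases le_or_gt u l with h1 | h1
    · exact hpos u ⟨hu.1, h1⟩
    · apply hball2
      rw [mem_ball, Real.dist_eq, abs_of_pos (by linarith)]; linarith [hu.2]
  have hmono := alpha_mono hP x e (a := 0) (b := l + η)
    (fun u hu => hpos' u (Ioo_subset_Ioc_self hu))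
  have hge : ∀ u ∈ Icc 0 (l + η), φ x ≤ φ (x + u • e) := by
    intro u hu
    have := hmono.monotoneOn (a := 0) (b := u) ⟨le_rfl, by linarith⟩ hu hu.1
    simpa using this
  obtain ⟨lev1, hlev1, hlev2⟩ := exists_between hlev
  set σ := (φ x - lev1) / (2 * l ^ 2) with hσ
  have hσ0 : 0 < σ := div_pos (by linarith) (by positivity)
  have hσ1 : lev1 + σ * l ^ 2 < φ x := by
    have : σ * l ^ 2 = (φ x - lev1) / 2 := by rw [hσ]; field_simp
    rw [this]; linarith
  obtain ⟨C, hC, hC2⟩ := wall hη (φ (x + (l + η) • e) - lev1)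
  obtain ⟨D, hD, hD2⟩ := wall hη (φ (x + (-η) • e) - lev1)
  obtain ⟨g, hg⟩ : ∃ g, g = gFn lev1 0 σ l C D := ⟨_, rfl⟩
  have hgc : ContDiff ℝ 2 g := hg ▸ gFn_contDiff _ _ _ _ _ _
  have hgpos : ∀ u, l < u → 2 * σ * (u - l) ≤ deriv g u := by
    intro u hu
    rw [hg, gFn_deriv, W_deriv_zero (u := -u) (by linarith)]
    have := mul_nonneg hC (W_deriv_nonneg (u - l))
    linarith
  have hgneg : ∀ u, u ≤ l → deriv g u ≤ 2 * σ * (u - l) := by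
    intro u hu
    rw [hg, gFn_deriv, W_deriv_zero (u := u - l) (by linarith)]
    have := mul_nonneg hD (W_deriv_nonneg (-u))
    linarith
  have hgl : deriv g l = 0 := by
    rw [hg, gFn_deriv, W_deriv_zero (u := l - l) (by linarith), W_deriv_zero (u := -l) (by linarith)]
    ring
  have hgz : ∀ u, deriv g u = 0 → u = l := by
    intro u hu
    rcases lt_trichotomy u l with h1 | h1 | h1
    · have := hgneg u h1.le
      nlinarith
    · exact h1
    · have := hgpos u h1
      nlinarith
  have gl : g l = lev1 := by
    simp [hg, gFn, expNegInvGlue.zero_of_nonpos (show -l ≤ 0 by linarith)]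
  have gmid : ∀ u ∈ Icc 0 l, g u < φ x := by
    intro u hu
    simp only [hg, gFn, expNegInvGlue.zero_of_nonpos (show -u ≤ 0 by linarith [hu.1]),
      expNegInvGlue.zero_of_nonpos (show u - l ≤ 0 by linarith [hu.2])]
    have : (u - l) ^ 2 ≤ l ^ 2 := by nlinarith [hu.1, hu.2]
    nlinarith
  have ga : φ (x + (-η) • e) < g (-η) := by
    simp only [hg, gFn, neg_neg, expNegInvGlue.zero_of_nonpos (show -η - l ≤ 0 by linarith)]
    have : 0 ≤ σ * (-η - l) ^ 2 := by positivity
    linarith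
  have gb : φ (x + (l + η) • e) < g (l + η) := by
    have h1 : l + η - l = η := by ring
    simp only [hg, gFn, h1, expNegInvGlue.zero_of_nonpos (show -(l + η) ≤ 0 by linarith)]
    have : 0 ≤ σ * η ^ 2 := by positivity
    linarith
  have hax : ∀ u : ℝ, ⟪n, x + u • e - x⟫ = 0 := by
    intro u; simp [real_inner_smul_right, h.ne]
  have hcan := canal hP h x (-η) (l + η) hgc ga gb (by
      intro u hu
      rcases lt_trichotomy u 0 with h1 | h1 | h1
      · right; left
        apply mul_pos_of_neg_of_neg (hneg u ⟨hu.1, h1⟩)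
        have := hgneg u (by linarith)
        nlinarith
      · right; right
        subst h1
        refine ⟨by simpa using gmid 0 ⟨le_rfl, hl.le⟩, ?_⟩
        have := coer_third hP h x x hx (by simp)
        simpa using this
      · rcases le_or_gt u l with h2 | h2
        · right; right
          exact ⟨(gmid u ⟨h1.le, h2⟩).trans_le (hge u ⟨h1.le, by linarith⟩),
            third_of_ne hP n x _ (hpos' u ⟨h1, by linarith⟩).ne'⟩
        · right; left
          apply mul_pos (hpos' u ⟨h1, hu.2⟩)
          have := hgpos u h2
          nlinarith) hN
    (fun u hu => hsub1 ⟨by linarith [hu.1], by linarith [hu.2]⟩)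
  have hlb : g l < φ (x + l • e) :=
    (gmid l ⟨hl.le, le_rfl⟩).trans_le (hge l ⟨hl.le, by linarith⟩)
  have hKl : ∀ᶠ K : ℝ in atTop, 1 < K * (φ (x + l • e) - g l) :=
    (tendsto_id.atTop_mul_const (sub_pos.2 hlb)).eventually_gt_atTop 1
  obtain ⟨K, ⟨φ', f', hP', h1, h2, h3, h4, h5⟩, hK2, hK0⟩ :=
    (hcan.and (hKl.and (eventually_gt_atTop 0))).exists
  have hloc := h5 l (by linarith) (by linarith) hK2
  have hgr : ∀ z, ⟪psiGrad x e n g K z, z - (x + l • e)⟫ =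
      deriv g ⟪e, z - x⟫ * (⟪e, z - x⟫ - l) + 2 * K * ⟪n, z - x⟫ ^ 2 := by
    intro z
    have : z - (x + l • e) = (z - x) - l • e := by abel
    rw [this]
    simp only [psiGrad, inner_add_left, inner_sub_right, real_inner_smul_left,
      real_inner_smul_right, h.ee, h.ne]
    ring
  refine ⟨φ', f', hP', h1, ?_, ?_, ⟨?_, min (2 * σ) (2 * K), ?_, ?_⟩, ?_⟩
  · intro z hz
    rcases h3 z hz with ⟨hz1, hz2⟩ | ⟨u, _, _, hzu, hu⟩
    · left
      refine ⟨hz1, ?_⟩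
      rintro rfl
      have := hz2 0 (by linarith) (by linarith) (by simp)
      exact absurd (gmid 0 ⟨le_rfl, hl.le⟩) (not_lt.2 this)
    · right; rw [hzu, hgz u hu]
  · have := (h4 l (by linarith) (by linarith)).2
    rw [min_eq_right hlb.le, gl] at this
    linarith
  · rw [hloc.self_of_nhds]
    simp [psiGrad, real_inner_smul_right, h.he, h.ne, hgl]
  · have : 0 < 2 * σ := by linarith
    have : 0 < 2 * K := by linarith
    positivity
  · filter_upwards [hloc] with z hz
    rw [hz, hgr, h.norm_sq]
    have e1 : ⟪e, z - (x + l • e)⟫ = ⟪e, z - x⟫ - l := by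
      rw [← sub_sub, inner_sub_right, real_inner_smul_right, h.ee, mul_one]
    have e2 : ⟪n, z - (x + l • e)⟫ = ⟪n, z - x⟫ := by
      rw [← sub_sub, inner_sub_right, real_inner_smul_right, h.ne, mul_zero, sub_zero]
    rw [e1, e2]
    set U := ⟪e, z - x⟫
    have i1 : 2 * σ * (U - l) ^ 2 ≤ deriv g U * (U - l) := by
      rcases le_or_gt U l with hc | hc
      · have := hgneg U hc
        nlinarith
      · have := hgpos U hc
        nlinarith
    have i2 := min_le_left (2 * σ) (2 * K)
    have i3 := min_le_right (2 * σ) (2 * K)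
    nlinarith [sq_nonneg (U - l), sq_nonneg ⟪n, z - x⟫]
  · intro w' hw t ht hf
    obtain ⟨τ, t0, t1, hf', _⟩ := h2 (x + l • e + t • w')
    refine pres (f := f) (f' := f') (x := x) (w' := w') (l := l) (t := t) (K := K) (τ := τ) (g := g) h hK0.le ht.le hw t0 t1 hf' hf ?_
    have hp := mul_pos ht hw
    have := hgpos (l + t * ⟪e, w'⟫) (by linarith)
    nlinarith [mul_pos hσ0 hp]

set_option maxHeartbeats 1000000 in
theorem stepC {φ : Euc 2 → ℝ} {f : Euc 2 → Euc 2} (hP : Pot φ f) {e n : Euc 2} (h : ON e n)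
    {x : Euc 2} {l b : ℝ} (hl : 0 < l) (hb : l < b) (hx : Coer f x) (hq : SadCoer f e n (x + l • e))
    (hpos : ∀ u ∈ Ioo 0 l, 0 < ⟪f (x + u • e), e⟫)
    (hneg : ∀ u ∈ Ioc l b, ⟪f (x + u • e), e⟫ < 0)
    (hlev : φ (x + b • e) < φ x) {N : Set (Euc 2)} (hN : IsOpen N)
    (hseg : ∀ u ∈ Icc 0 b, x + u • e ∈ N) :
    ∃ φ' f', Pot φ' f' ∧ (∀ z ∉ N, φ' =ᶠ[𝓝 z] φ) ∧
      (∀ z, f' z = 0 → f z = 0 ∧ z ≠ x ∧ z ≠ x + l • e) := by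
  obtain ⟨hx0, κ, hκ, hqx⟩ := id hx
  have hq' : ∀ᶠ u : ℝ in 𝓝 0, κ * u ^ 2 ≤ u * ⟪f (x + u • e), e⟫ := by
    have ht : Tendsto (fun u : ℝ => x + u • e) (𝓝 0) (𝓝 x) := by
      have : Continuous (fun u : ℝ => x + u • e) := by fun_prop
      simpa using this.tendsto 0
    filter_upwards [ht.eventually hqx] with u hu
    simpa [norm_smul, h.he, real_inner_smul_right] using hu
  obtain ⟨δ, hδ, hball⟩ := Metric.eventually_nhds_iff.1 hq'
  obtain ⟨η1, hη1, hsub1⟩ := Icc_enlarge (O := {u : ℝ | x + u • e ∈ N})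
    (hN.preimage (by fun_prop)) (hl.trans hb).le (fun u hu => hseg u hu)
  obtain ⟨η, hη, hηm⟩ : ∃ η > 0, η < min η1 δ :=
    exists_between (lt_min hη1 hδ)
  obtain ⟨m1, m2⟩ : η < η1 ∧ η < δ := by simpa using hηm
  have hneg0 : ∀ u ∈ Ico (-η) 0, ⟪f (x + u • e), e⟫ < 0 := by
    intro u hu
    have := hball (y := u) (by rw [Real.dist_eq, sub_zero, abs_of_neg hu.2]; linarith [hu.1])
    have hu2 : 0 < κ * u ^ 2 := by have := hu.2.ne; positivity
    by_contra hc
    push Not at hc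
    nlinarith [mul_nonpos_of_nonpos_of_nonneg hu.2.le hc]
  have hmono := alpha_mono hP x e (a := 0) (b := l) hpos
  have hge : ∀ u ∈ Icc 0 l, φ x ≤ φ (x + u • e) := by
    intro u hu
    have := hmono.monotoneOn (a := 0) (b := u) ⟨le_rfl, by linarith⟩ hu hu.1
    simpa using this
  obtain ⟨lev1, hlev1, hlev2⟩ := exists_between hlev
  have hb0 : 0 < b := hl.trans hb
  set σ := (lev1 - φ (x + b • e)) / (2 * b) with hσ
  have hσ0 : 0 < σ := div_pos (by linarith) (by positivity)
  have hσ1 : φ (x + b • e) < lev1 - σ * b := by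
    have : σ * b = (lev1 - φ (x + b • e)) / 2 := by rw [hσ]; field_simp
    rw [this]; linarith
  obtain ⟨D, hD, hD2⟩ := wall hη (φ (x + (-η) • e) - lev1)
  obtain ⟨g, hg⟩ : ∃ g, g = gFn lev1 (-σ) 0 l 0 D := ⟨_, rfl⟩
  have hgc : ContDiff ℝ 2 g := hg ▸ gFn_contDiff _ _ _ _ _ _
  have hgneg : ∀ u, deriv g u < 0 := by
    intro u
    rw [hg, gFn_deriv]
    have := mul_nonneg hD (W_deriv_nonneg (-u))
    linarith
  have gmid : ∀ u, 0 ≤ u → g u < φ x := by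
    intro u hu
    simp only [hg, gFn, expNegInvGlue.zero_of_nonpos (show -u ≤ 0 by linarith)]
    nlinarith
  have ga : φ (x + (-η) • e) < g (-η) := by
    simp only [hg, gFn, neg_neg]
    have : 0 < σ * η := by positivity
    linarith
  have gb : φ (x + b • e) < g b := by
    simp only [hg, gFn, expNegInvGlue.zero_of_nonpos (show -b ≤ 0 by linarith)]
    linarith
  have hcan := canal hP h x (-η) b hgc ga gb (by
      intro u hu
      rcases lt_trichotomy u 0 with h1 | h1 | h1
      · right; left
        exact mul_pos_of_neg_of_neg (hneg0 u ⟨hu.1, h1⟩) (hgneg u)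
      · right; right
        subst h1
        refine ⟨by simpa using gmid 0 le_rfl, ?_⟩
        have := coer_third hP h x x hx (by simp)
        simpa using this
      · rcases lt_trichotomy u l with h2 | h2 | h2
        · right; right
          exact ⟨(gmid u h1.le).trans_le (hge u ⟨h1.le, by linarith⟩),
            third_of_ne hP n x _ (hpos u ⟨h1, by linarith⟩).ne'⟩
        · right; right
          subst h2
          exact ⟨(gmid u h1.le).trans_le (hge u ⟨h1.le, by linarith⟩),
            sad_third hP h x _ hq (by simp [real_inner_smul_right, h.ne])⟩
        · right; left
          exact mul_pos_of_neg_of_neg (hneg u ⟨h2, hu.2⟩) (hgneg u)) hN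
    (fun u hu => hsub1 ⟨by linarith [hu.1], by linarith [hu.2]⟩)
  obtain ⟨K, φ', f', hP', h1, h2, h3, h4, h5⟩ := hcan.exists
  refine ⟨φ', f', hP', h1, ?_⟩
  intro z hz
  rcases h3 z hz with ⟨hz1, hz2⟩ | ⟨u, _, _, hzu, hu⟩
  · refine ⟨hz1, ?_, ?_⟩
    · rintro rfl
      have := hz2 0 (by linarith) (by linarith) (by simp)
      exact absurd (gmid 0 le_rfl) (not_lt.2 this)
    · rintro rfl
      have := hz2 l (by linarith) (by linarith) rfl
      exact absurd ((gmid l hl.le).trans_le (hge l ⟨hl.le, le_rfl⟩)) (not_lt.2 this)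
  · exact absurd hu (hgneg u).ne

end

section
open Set Metric Filter
set_option linter.unusedSimpArgs false
open scoped RealInnerProductSpace
open scoped Topology

def GoodL (lev : ℝ) (N0 : Set (Euc 2)) (φ : Euc 2 → ℝ) (f : Euc 2 → Euc 2) (x : Euc 2) : Prop :=
  Pot φ f ∧ (∀ z ∈ N0, f z ≠ 0) ∧ φ x < lev

def GoodM (lev : ℝ) (N0 : Set (Euc 2)) (φ : Euc 2 → ℝ) (f : Euc 2 → Euc 2) (x : Euc 2) : Prop :=
  Pot φ f ∧ (∀ z ∈ N0, f z = 0 → z = x) ∧ Coer f x ∧ lev < φ x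

/-- the abstract step -/
def StepProp (N0 : Set (Euc 2)) (Good : (Euc 2 → ℝ) → (Euc 2 → Euc 2) → Euc 2 → Prop) : Prop :=
  ∀ φ f x w N, w ≠ 0 → Good φ f x → (∀ t ∈ Icc (0:ℝ) 1, Posi f x w t) → IsOpen N → N ⊆ N0 →
    (∀ t ∈ Icc (0:ℝ) 1, x + t • w ∈ N) →
    ∃ φ' f', Good φ' f' (x + w) ∧ (∀ z ∉ N, φ' =ᶠ[𝓝 z] φ) ∧
      ∀ w', 0 < ⟪w, w'⟫ → ∀ t : ℝ, 0 ≤ t → 0 < ⟪f (x + w + t • w'), w'⟫ → Posi f' (x + w) w' t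

theorem unit_aux {w : Euc 2} (hw : w ≠ 0) : ‖(‖w‖⁻¹ • w)‖ = 1 ∧ ‖w‖ • (‖w‖⁻¹ • w) = w := by
  have h : ‖w‖ ≠ 0 := norm_ne_zero_iff.2 hw
  constructor
  · rw [norm_smul, norm_inv, norm_norm, inv_mul_cancel₀ h]
  · rw [smul_smul, mul_inv_cancel₀ h, one_smul]

theorem stepL (lev : ℝ) (N0 : Set (Euc 2)) : StepProp N0 (GoodL lev N0) := by
  rintro φ f x w N hw ⟨hP, hz, hlev⟩ hpos hN hNN hseg
  have hl : 0 < ‖w‖ := norm_pos_iff.2 hw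
  obtain ⟨h1, h2⟩ := unit_aux hw
  obtain ⟨n, hON⟩ := ON.exists_of_unit h1
  set e := ‖w‖⁻¹ • w with he
  have hr : ∀ u : ℝ, u • e = (u / ‖w‖) • w := by
    intro u; rw [he, smul_smul, div_eq_mul_inv]
  have hI : ∀ u ∈ Icc 0 ‖w‖, u / ‖w‖ ∈ Icc (0:ℝ) 1 := by
    intro u hu
    exact ⟨div_nonneg hu.1 hl.le, (div_le_one hl).2 hu.2⟩
  have hx : f x ≠ 0 := by
    apply hz x (hNN _)
    simpa using hseg 0 (by simp)
  obtain ⟨φ', f', hP', a1, a2, a3, a4⟩ := stepL_unit hP hON hl (x := x) (lev := lev) (N := N)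
    (by
      intro u hu
      rw [hr, he, real_inner_smul_right]
      rcases hpos _ (hI u hu) with h | h
      · positivity
      · exact absurd h.2 hx) hlev hN (fun u hu => by rw [hr]; exact hseg _ (hI u hu))
  rw [h2] at a3 a4
  refine ⟨φ', f', ⟨hP', fun z hz0 h0 => hz z hz0 (a2 z h0), a3⟩, a1, ?_⟩
  intro w' hw' t ht hf
  left
  refine a4 w' ?_ t ht hf
  rw [he, real_inner_smul_left]; positivity

theorem stepM (lev : ℝ) (N0 : Set (Euc 2)) : StepProp N0 (GoodM lev N0) := by
  rintro φ f x w N hw ⟨hP, hz, hc, hlev⟩ hpos hN hNN hseg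
  have hl : 0 < ‖w‖ := norm_pos_iff.2 hw
  obtain ⟨h1, h2⟩ := unit_aux hw
  obtain ⟨n, hON⟩ := ON.exists_of_unit h1
  set e := ‖w‖⁻¹ • w with he
  have hr : ∀ u : ℝ, u • e = (u / ‖w‖) • w := by
    intro u; rw [he, smul_smul, div_eq_mul_inv]
  have hI : ∀ u ∈ Icc 0 ‖w‖, u / ‖w‖ ∈ Icc (0:ℝ) 1 := by
    intro u hu
    exact ⟨div_nonneg hu.1 hl.le, (div_le_one hl).2 hu.2⟩
  obtain ⟨φ', f', hP', a1, a2, a3, a4, a5⟩ := stepM_unit hP hON hl (x := x) (lev := lev) (N := N) hc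
    (by
      intro u hu
      rw [hr, he, real_inner_smul_right]
      rcases hpos _ (hI u ⟨hu.1.le, hu.2⟩) with h | h
      · positivity
      · have : 0 < u / ‖w‖ := div_pos hu.1 hl
        exact absurd h.1 this.ne') hlev hN (fun u hu => by rw [hr]; exact hseg _ (hI u hu))
  rw [h2] at a2 a3 a4 a5
  refine ⟨φ', f', ⟨hP', ?_, a4, a3⟩, a1, ?_⟩
  · intro z hz0 h0
    rcases a2 z h0 with h | h
    · exact absurd (hz z hz0 h.1) h.2
    · exact h
  intro w' hw' t ht hf
  rcases ht.eq_or_lt with h | h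
  · right; exact ⟨h.symm, a4.1⟩
  left
  refine a5 w' ?_ t h hf
  rw [he, real_inner_smul_left]; positivity

theorem chain {N0 : Set (Euc 2)} (hN0 : IsOpen N0)
    {Good : (Euc 2 → ℝ) → (Euc 2 → Euc 2) → Euc 2 → Prop}
    (hgood : ∀ φ f x, Good φ f x → Pot φ f) (hstep : StepProp N0 Good) (n : ℕ) :
    ∀ (φ : Euc 2 → ℝ) (f : Euc 2 → Euc 2) (x : ℕ → Euc 2), Good φ f (x 0) →
    (∀ i < n, ∀ t ∈ Icc (0:ℝ) 1, x i + t • (x (i + 1) - x i) ∈ N0) →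
    (∀ t ∈ Icc (0:ℝ) 1, (t < 1 ∨ 0 < n) → Posi f (x 0) (x 1 - x 0) t) →
    (∀ i, 1 ≤ i → i ≤ n → ∀ t ∈ Icc (0:ℝ) 1, (t < 1 ∨ i < n) →
      0 < ⟪f (x i + t • (x (i + 1) - x i)), x (i + 1) - x i⟫) →
    (∀ i < n, 0 < ⟪x (i + 1) - x i, x (i + 2) - x (i + 1)⟫) →
    ∃ φ' f', Good φ' f' (x n) ∧ (∀ z ∉ N0, φ' =ᶠ[𝓝 z] φ) ∧
      ∀ t ∈ Ico (0:ℝ) 1, Posi f' (x n) (x (n + 1) - x n) t := by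
  induction n with
  | zero =>
    intro φ f x hg _ h0 _ _
    exact ⟨φ, f, hg, fun _ _ => EventuallyEq.rfl, fun t ht => h0 t ⟨ht.1, ht.2.le⟩ (Or.inl ht.2)⟩
  | succ n ih =>
    intro φ f x hg hN h0 hp hd
    have hP := hgood _ _ _ hg
    set S : ℕ → Set (Euc 2) := fun j => (fun t : ℝ => x j + t • (x (j + 1) - x j)) '' Icc 0 1 with hS
    have hSc : ∀ j, IsCompact (S j) := fun j => isCompact_Icc.image (by fun_prop)
    -- values on segments
    have hmono : ∀ i ≤ n + 1, StrictMonoOn (fun t : ℝ => φ (x i + t • (x (i + 1) - x i))) (Icc 0 1) := by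
      intro i hi
      apply alpha_mono hP
      intro u hu
      rcases Nat.eq_zero_or_pos i with h | h
      · subst h
        rcases h0 u (Ioo_subset_Icc_self hu) (Or.inl hu.2) with h | h
        · exact h
        · exact absurd h.1 hu.1.ne'
      · exact hp i h hi u (Ioo_subset_Icc_self hu) (Or.inl hu.2)
    have hval : ∀ i ≤ n + 1, φ (x i) < φ (x (i + 1)) := by
      intro i hi
      have := hmono i hi (a := 0) (b := 1) (by simp) (by simp) one_pos
      simpa using this
    have hlo : ∀ i ≤ n + 1, ∀ z ∈ S i, φ (x i) ≤ φ z := by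
      rintro i hi _ ⟨t, ht, rfl⟩
      have := (hmono i hi).monotoneOn (a := 0) (b := t) (by simp) ht ht.1
      simpa using this
    have hhi : ∀ i ≤ n + 1, ∀ z ∈ S i, φ z ≤ φ (x (i + 1)) := by
      rintro i hi _ ⟨t, ht, rfl⟩
      have := (hmono i hi).monotoneOn (a := t) (b := 1) ht (by simp) ht.2
      simpa using this
    have hle : ∀ j, 2 ≤ j → j ≤ n + 1 → φ (x 2) ≤ φ (x j) := by
      intro j hj
      induction j, hj using Nat.le_induction with
      | base => intro _; exact le_rfl
      | succ j hj ihj => intro h; exact (ihj (by omega)).trans (hval j (by omega)).le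
    set N : Set (Euc 2) := N0 ∩ (⋃ j ∈ Finset.Icc 2 (n + 1), S j)ᶜ with hNdef
    have hNo : IsOpen N := by
      apply hN0.inter
      rw [isOpen_compl_iff]
      exact ((Finset.Icc 2 (n + 1)).isCompact_biUnion fun j _ => hSc j).isClosed
    have hNj : ∀ j, 2 ≤ j → j ≤ n + 1 → ∀ z ∈ S j, z ∉ N := by
      intro j h1 h2 z hz hzN
      exact hzN.2 (mem_biUnion (Finset.mem_coe.2 (Finset.mem_Icc.2 ⟨h1, h2⟩)) hz)
    have hw : x 1 - x 0 ≠ 0 := by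
      intro hc
      rcases h0 (1/2) (by norm_num) (Or.inr (Nat.succ_pos n)) with h | h
      · rw [hc, inner_zero_right] at h; exact lt_irrefl _ h
      · norm_num at h
    obtain ⟨φ1, f1, g1, a1, a2⟩ := hstep φ f (x 0) (x 1 - x 0) N hw hg
      (fun t ht => h0 t ht (Or.inr (Nat.succ_pos n))) hNo inter_subset_left (by
        intro t ht
        refine ⟨hN 0 (Nat.succ_pos n) t ht, ?_⟩
        intro hmem
        simp only [mem_iUnion, Finset.mem_Icc] at hmem
        obtain ⟨j, ⟨hj1, hj2⟩, hj⟩ := hmem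
        have b1 := hhi 0 (by omega) (x 0 + t • (x 1 - x 0)) ⟨t, ht, rfl⟩
        have b2 := hlo j hj2 _ hj
        have b3 := hle j hj1 hj2
        have b4 := hval 1 (by omega)
        simp only [zero_add] at b1
        norm_num at b4
        linarith)
    rw [add_sub_cancel] at g1 a2
    have hP1 := hgood _ _ _ g1
    obtain ⟨φ', f', g', b1, b2⟩ := ih φ1 f1 (fun i => x (i + 1)) g1
      (fun i hi => hN (i + 1) (by omega))
      (by
        intro t ht htn
        refine a2 _ (hd 0 (by omega)) t ht.1 ?_
        refine hp 1 le_rfl (by omega) t ht ?_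
        rcases htn with h | h
        · exact Or.inl h
        · right; omega)
      (by
        intro i hi1 hi2 t ht htn
        have := hp (i + 1) (by omega) (by omega) t ht (by
          rcases htn with h | h
          · exact Or.inl h
          · right; omega)
        have e := hP.eq_of_eventuallyEq hP1
          (a1 _ (hNj (i + 1) (by omega) (by omega) (x (i + 1) + t • (x (i + 1 + 1) - x (i + 1)))
            ⟨t, ht, rfl⟩))
        show 0 < ⟪f1 (x (i + 1) + t • (x (i + 1 + 1) - x (i + 1))), _⟫
        rw [e]; exact this)
      (fun i hi => hd (i + 1) (by omega))
    refine ⟨φ', f', g', ?_, b2⟩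
    intro z hz
    exact (b1 z hz).trans (a1 z fun h => hz h.1)

end

section
open Set Metric Filter
set_option linter.unusedSimpArgs false
open scoped RealInnerProductSpace
open scoped Topology
open scoped NNReal

/-- normalized field -/
def nf (f : Euc 2 → Euc 2) (x : Euc 2) : Euc 2 := (1 + ‖f x‖ ^ 2)⁻¹ • f x

theorem nf_norm_le (f : Euc 2 → Euc 2) (x : Euc 2) : ‖nf f x‖ ≤ 1 := by
  have h : 0 < 1 + ‖f x‖ ^ 2 := by positivity
  rw [nf, norm_smul, norm_inv, Real.norm_of_nonneg h.le, inv_mul_le_iff₀ h]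
  nlinarith [sq_nonneg (‖f x‖ - 1)]

theorem nf_contDiff {f : Euc 2 → Euc 2} (hf : ContDiff ℝ 1 f) : ContDiff ℝ 1 (nf f) := by
  unfold nf
  refine ContDiff.smul (ContDiff.inv (contDiff_const.add (hf.norm_sq ℝ)) ?_) hf
  intro x
  positivity

theorem sol_lip {f : Euc 2 → Euc 2} {γ : ℝ → Euc 2} {s : Set ℝ} (hs : Convex ℝ s)
    (h : ∀ t ∈ s, HasDerivAt γ (nf f (γ t)) t) {t t' : ℝ} (ht : t ∈ s) (ht' : t' ∈ s) :
    ‖γ t' - γ t‖ ≤ |t' - t| := by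
  have := hs.norm_image_sub_le_of_norm_hasDerivWithin_le (f := γ) (f' := fun t => nf f (γ t))
    (C := 1) (fun x hx => (h x hx).hasDerivWithinAt) (fun x _ => nf_norm_le f _) ht ht'
  simpa using this

theorem nf_lip {f : Euc 2 → Euc 2} (hf : ContDiff ℝ 1 f) (x : Euc 2) (R : ℝ) :
    ∃ K, LipschitzOnWith K (nf f) (closedBall x R) :=
  ((nf_contDiff hf).locallyLipschitz.locallyLipschitzOn).exists_lipschitzOnWith_of_compact
    (isCompact_closedBall x R)

theorem sol_unique {f : Euc 2 → Euc 2} (hf : ContDiff ℝ 1 f) {γ γ' : ℝ → Euc 2} {a b t0 : ℝ}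
    (ht0 : t0 ∈ Ioo a b) (h : ∀ t ∈ Ioo a b, HasDerivAt γ (nf f (γ t)) t)
    (h' : ∀ t ∈ Ioo a b, HasDerivAt γ' (nf f (γ' t)) t) (h0 : γ t0 = γ' t0) :
    EqOn γ γ' (Ioo a b) := by
  obtain ⟨K, hK⟩ := nf_lip hf (γ t0) (b - a)
  have hb : ∀ t ∈ Ioo a b, |t - t0| ≤ b - a := by
    intro t ht
    rw [abs_le]; constructor <;> linarith [ht.1, ht.2, ht0.1, ht0.2]
  refine ODE_solution_unique_of_mem_Ioo (v := fun _ => nf f) (s := fun _ => closedBall (γ t0) (b - a))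
    (K := K) (t₀ := t0) (fun _ _ => hK) ht0 (fun t ht => ⟨h t ht, ?_⟩) (fun t ht => ⟨h' t ht, ?_⟩) h0
  · rw [mem_closedBall, dist_eq_norm]
    exact (sol_lip (convex_Ioo a b) h ht0 ht).trans (hb t ht)
  · rw [mem_closedBall, dist_eq_norm, h0]
    exact (sol_lip (convex_Ioo a b) h' ht0 ht).trans (hb t ht)

theorem sol_unique_left {f : Euc 2 → Euc 2} (hf : ContDiff ℝ 1 f) {γ γ' : ℝ → Euc 2} {b : ℝ}
    (h : ∀ t ≤ b, HasDerivAt γ (nf f (γ t)) t)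
    (h' : ∀ t ≤ b, HasDerivAt γ' (nf f (γ' t)) t) (h0 : γ b = γ' b) :
    ∀ t ≤ b, γ t = γ' t := by
  intro t ht
  obtain ⟨K, hK⟩ := nf_lip hf (γ b) (b - t)
  have hb : ∀ s ∈ Ioc t b, |s - b| ≤ b - t := by
    intro s hs
    rw [abs_le]; constructor <;> linarith [hs.1, hs.2]
  refine ODE_solution_unique_of_mem_Icc_left (v := fun _ => nf f)
    (s := fun _ => closedBall (γ b) (b - t)) (a := t) (b := b)
    (K := K) (fun _ _ => hK) ?_ (fun s hs => (h s hs.2).hasDerivWithinAt) ?_ ?_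
    (fun s hs => (h' s hs.2).hasDerivWithinAt) ?_ h0 ⟨le_rfl, ht⟩
  · exact fun s hs => (h s hs.2).continuousAt.continuousWithinAt
  · intro s hs
    rw [mem_closedBall, dist_eq_norm]
    exact (sol_lip (convex_Iic b) h (mem_Iic.2 le_rfl) (mem_Iic.2 hs.2)).trans (hb s hs)
  · exact fun s hs => (h' s hs.2).continuousAt.continuousWithinAt
  · intro s hs
    rw [mem_closedBall, dist_eq_norm, h0]
    exact (sol_lip (convex_Iic b) h' (mem_Iic.2 le_rfl) (mem_Iic.2 hs.2)).trans (hb s hs)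

theorem local_flow {f : Euc 2 → Euc 2} (hf : ContDiff ℝ 1 f) (x0 : Euc 2) (T : ℝ) (hT : 0 < T) :
    ∃ α : Euc 2 × ℝ → Euc 2, (∀ x ∈ closedBall x0 1, α (x, 0) = x ∧
      ∀ t ∈ Ioo (-T) T, HasDerivAt (fun t => α (x, t)) (nf f (α (x, t))) t) ∧
      ContinuousOn α (closedBall x0 1 ×ˢ Icc (-T) T) := by
  obtain ⟨K, hK⟩ := nf_lip hf x0 (T + 1)
  have hpl : IsPicardLindelof (fun _ => nf f) (tmin := -T) (tmax := T)
      ⟨0, by constructor <;> linarith⟩ x0 ⟨T + 1, by linarith⟩ 1 1 K := by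
    refine ⟨fun _ _ => hK, fun _ _ => continuousOn_const, fun _ _ x _ => nf_norm_le f x, ?_⟩
    simp only [NNReal.coe_one, sub_zero, zero_sub, neg_neg, max_self, one_mul]
    show T ≤ (T + 1) - 1
    linarith
  obtain ⟨α, h1, h2⟩ := hpl.exists_forall_mem_closedBall_eq_hasDerivWithinAt_continuousOn
  refine ⟨α, fun x hx => ⟨(h1 x hx).1, fun t ht => ?_⟩, h2⟩
  exact ((h1 x hx).2 t (Ioo_subset_Icc_self ht)).hasDerivAt (Icc_mem_nhds ht.1 ht.2)

/-- complete flow of the normalized field -/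
structure FlowOf (f : Euc 2 → Euc 2) (F : ℝ → Euc 2 → Euc 2) : Prop where
  cd : ContDiff ℝ 1 f
  zero : ∀ x, F 0 x = x
  deriv : ∀ x t, HasDerivAt (fun s => F s x) (nf f (F t x)) t
  cont : Continuous (fun p : ℝ × Euc 2 => F p.1 p.2)

theorem exists_flow {f : Euc 2 → Euc 2} (hf : ContDiff ℝ 1 f) : ∃ F, FlowOf f F := by
  have H := fun (x0 : Euc 2) (T : ℝ) (hT : 0 < T) => local_flow hf x0 T hT
  choose α h1 h2 using H
  have hp : ∀ t : ℝ, 0 < |t| + 1 := fun t => by positivity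
  set F : ℝ → Euc 2 → Euc 2 := fun t x => α x (|t| + 1) (hp t) (x, t) with hF
  -- consistency
  have key : ∀ x0 x T (hT : 0 < T), x ∈ closedBall x0 1 → ∀ t ∈ Ioo (-T) T,
      F t x = α x0 T hT (x, t) := by
    intro x0 x T hT hx t ht
    have hx' : x ∈ closedBall x 1 := mem_closedBall_self (by norm_num)
    have e1 := (h1 x (|t| + 1) (hp t) x hx')
    have e2 := (h1 x0 T hT x hx)
    have hm : 0 < min T (|t| + 1) := lt_min hT (hp t)
    refine sol_unique hf (a := -min T (|t| + 1)) (b := min T (|t| + 1)) (t0 := 0)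
      (γ := fun s => α x (|t| + 1) (hp t) (x, s)) (γ' := fun s => α x0 T hT (x, s))
      ⟨by linarith, hm⟩ ?_ ?_ ?_ ?_
    · intro s hs
      refine e1.2 s ⟨?_, ?_⟩
      · linarith [hs.1, min_le_right T (|t| + 1)]
      · linarith [hs.2, min_le_right T (|t| + 1)]
    · intro s hs
      refine e2.2 s ⟨?_, ?_⟩
      · linarith [hs.1, min_le_left T (|t| + 1)]
      · linarith [hs.2, min_le_left T (|t| + 1)]
    · exact e1.1.trans e2.1.symm
    · have : |t| < min T (|t| + 1) := lt_min (abs_lt.2 ⟨ht.1, ht.2⟩) (by linarith)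
      exact ⟨(abs_lt.1 this).1, (abs_lt.1 this).2⟩
  have hx' : ∀ x : Euc 2, x ∈ closedBall x 1 := fun x => mem_closedBall_self (by norm_num)
  have hmem : ∀ t : ℝ, t ∈ Ioo (-(|t| + 1)) (|t| + 1) := fun t =>
    abs_lt.1 (by linarith)
  refine ⟨F, hf, fun x => (h1 x _ (hp 0) x (hx' x)).1, ?_, ?_⟩
  · intro x t
    have e := (h1 x (|t| + 1) (hp t) x (hx' x)).2 t (hmem t)
    rw [← key x x (|t| + 1) (hp t) (hx' x) t (hmem t)] at e
    refine e.congr_of_eventuallyEq ?_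
    filter_upwards [Ioo_mem_nhds (hmem t).1 (hmem t).2] with s hs
    exact key x x _ (hp t) (hx' x) s hs
  · rw [continuous_iff_continuousAt]
    rintro ⟨t, x⟩
    have e := h2 x (|t| + 1) (hp t)
    have e2 : ContinuousAt (α x (|t| + 1) (hp t)) (x, t) := by
      apply e.continuousAt
      exact prod_mem_nhds (closedBall_mem_nhds x one_pos) (Icc_mem_nhds (hmem t).1 (hmem t).2)
    have e3 : ContinuousAt (fun p : ℝ × Euc 2 => α x (|t| + 1) (hp t) (p.2, p.1)) (t, x) :=
      ContinuousAt.comp (f := fun p : ℝ × Euc 2 => (p.2, p.1)) (x := (t, x)) e2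
        (by fun_prop)
    refine e3.congr ?_
    have : Ioo (-(|t| + 1)) (|t| + 1) ×ˢ closedBall x 1 ∈ 𝓝 (t, x) :=
      prod_mem_nhds (Ioo_mem_nhds (hmem t).1 (hmem t).2) (closedBall_mem_nhds x one_pos)
    filter_upwards [this] with p hp'
    exact (key x p.2 _ (hp t) hp'.2 p.1 hp'.1).symm

namespace FlowOf
variable {f : Euc 2 → Euc 2} {F : ℝ → Euc 2 → Euc 2}

theorem uniq (hF : FlowOf f F) {γ : ℝ → Euc 2} (h : ∀ t, HasDerivAt γ (nf f (γ t)) t) (t : ℝ) :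
    γ t = F t (γ 0) := by
  refine sol_unique hF.cd (a := -(|t| + 1)) (b := |t| + 1) (t0 := 0) (γ := γ)
    (γ' := fun s => F s (γ 0)) ⟨by linarith [abs_nonneg t], by linarith [abs_nonneg t]⟩
    (fun s _ => h s) (fun s _ => hF.deriv _ s) (hF.zero _).symm (abs_lt.1 (by linarith))

theorem uniq_left (hF : FlowOf f F) {γ : ℝ → Euc 2} (h : ∀ t ≤ 0, HasDerivAt γ (nf f (γ t)) t)
    (t : ℝ) (ht : t ≤ 0) : γ t = F t (γ 0) :=
  sol_unique_left hF.cd (γ' := fun s => F s (γ 0)) h (fun s _ => hF.deriv _ s) (hF.zero _).symm t ht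

theorem add (hF : FlowOf f F) (s t : ℝ) (x : Euc 2) : F (s + t) x = F s (F t x) := by
  have := hF.uniq (γ := fun s => F (s + t) x) (fun u => by
    have := (hF.deriv x (u + t)).scomp u ((hasDerivAt_id u).add_const t)
    rw [one_smul] at this
    exact this) s
  simpa using this

theorem cont_t (hF : FlowOf f F) (x : Euc 2) : Continuous (fun t => F t x) :=
  hF.cont.comp (by fun_prop : Continuous fun t : ℝ => (t, x))

theorem cont_x (hF : FlowOf f F) (t : ℝ) : Continuous (F t) :=
  hF.cont.comp (by fun_prop : Continuous fun x : Euc 2 => (t, x))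

theorem neg_cancel (hF : FlowOf f F) (t : ℝ) (x : Euc 2) : F (-t) (F t x) = x := by
  rw [← hF.add]; simp [hF.zero]

theorem cancel_neg (hF : FlowOf f F) (t : ℝ) (x : Euc 2) : F t (F (-t) x) = x := by
  rw [← hF.add]; simp [hF.zero]

theorem fixed (hF : FlowOf f F) {x : Euc 2} (hx : f x = 0) (t : ℝ) : F t x = x := by
  refine (hF.uniq (γ := fun _ => x) (fun t => ?_) t).symm
  simp only [nf, hx, smul_zero]
  exact hasDerivAt_const _ _

theorem phi_deriv (hF : FlowOf f F) {φ : Euc 2 → ℝ} (hP : Pot φ f) (x : Euc 2) (t : ℝ) :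
    HasDerivAt (fun s => φ (F s x)) (⟪f (F t x), nf f (F t x)⟫) t :=
  hP.comp_deriv (hF.deriv x t)

theorem inner_nf (f : Euc 2 → Euc 2) (x : Euc 2) : ⟪f x, nf f x⟫ = ‖f x‖ ^ 2 / (1 + ‖f x‖ ^ 2) := by
  rw [nf, real_inner_smul_right, real_inner_self_eq_norm_sq]; field_simp

theorem phi_mono (hF : FlowOf f F) {φ : Euc 2 → ℝ} (hP : Pot φ f) (x : Euc 2) :
    Monotone (fun s => φ (F s x)) := by
  apply monotone_of_hasDerivAt_nonneg (f' := fun t => ⟪f (F t x), nf f (F t x)⟫)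
    (fun t => hF.phi_deriv hP x t)
  intro t
  show 0 ≤ ⟪f (F t x), nf f (F t x)⟫
  rw [inner_nf]; positivity

theorem ne_zero (hF : FlowOf f F) {x : Euc 2} (hx : f x ≠ 0) (t : ℝ) : f (F t x) ≠ 0 := by
  intro h
  have := hF.fixed h (-t)
  rw [hF.neg_cancel] at this
  rw [← this] at h
  exact hx h

theorem phi_strictMono (hF : FlowOf f F) {φ : Euc 2 → ℝ} (hP : Pot φ f) {x : Euc 2} (hx : f x ≠ 0) :
    StrictMono (fun s => φ (F s x)) := by
  apply strictMono_of_hasDerivAt_pos (f' := fun t => ⟪f (F t x), nf f (F t x)⟫)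
    (fun t => hF.phi_deriv hP x t)
  intro t
  have := norm_pos_iff.2 (hF.ne_zero hx t)
  rw [inner_nf]; positivity

/-- the flow of `-f` -/
theorem neg (hF : FlowOf f F) : FlowOf (fun x => -f x) (fun t x => F (-t) x) where
  cd := hF.cd.neg
  zero x := by simp [hF.zero]
  deriv x t := by
    have := (hF.deriv x (-t)).scomp t (hasDerivAt_neg t)
    have e : nf (fun x => -f x) (F (-t) x) = (-1 : ℝ) • nf f (F (-t) x) := by
      simp [nf]
    rw [e]; exact this
  cont := hF.cont.comp (by fun_prop : Continuous fun p : ℝ × Euc 2 => (-p.1, p.2))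

end FlowOf

theorem time_change {κ : ℝ → ℝ} (hκ : Continuous κ) {c : ℝ} (hc : 0 < c) (h : ∀ t, c ≤ κ t) :
    ∃ s : ℝ ≃o ℝ, s 0 = 0 ∧ ∀ t, HasDerivAt s (κ (s t))⁻¹ t := by
  set K : ℝ → ℝ := fun t => ∫ u in (0:ℝ)..t, κ u with hK
  have hd : ∀ t, HasDerivAt K (κ t) t := fun t =>
    intervalIntegral.integral_hasDerivAt_right (hκ.intervalIntegrable _ _)
      (hκ.stronglyMeasurableAtFilter _ _) hκ.continuousAt
  have hm : StrictMono K := strictMono_of_hasDerivAt_pos hd fun t => hc.trans_le (h t)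
  have hKc : Continuous K := continuous_iff_continuousAt.2 fun t => (hd t).continuousAt
  have hmono2 : Monotone (fun t => K t - c * t) := by
    apply monotone_of_hasDerivAt_nonneg (f' := fun t => κ t - c * 1)
      (fun t => (hd t).sub ((hasDerivAt_id t).const_mul c))
    intro t
    show 0 ≤ κ t - c * 1
    linarith [h t]
  have hK0 : K 0 = 0 := by simp [hK]
  have ht : Tendsto K atTop atTop := by
    refine tendsto_atTop_mono' atTop (f₁ := fun t => c * t) ?_ (tendsto_id.const_mul_atTop hc)
    filter_upwards [eventually_ge_atTop 0] with t ht
    have := hmono2 ht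
    simp only [hK0, mul_zero, sub_zero] at this
    linarith
  have hb : Tendsto K atBot atBot := by
    refine tendsto_atBot_mono' atBot (f₁ := fun t => c * t) ?_ (tendsto_id.const_mul_atBot hc)
    filter_upwards [eventually_le_atBot 0] with t ht
    have := hmono2 ht
    simp only [hK0, mul_zero, sub_zero] at this
    linarith
  have hsurj : Function.Surjective K := hKc.surjective ht hb
  set s : ℝ ≃o ℝ := (StrictMono.orderIsoOfSurjective K hm hsurj).symm with hs
  have hsK : ∀ t, K (s t) = t := fun t =>
    (StrictMono.orderIsoOfSurjective K hm hsurj).apply_symm_apply t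
  refine ⟨s, ?_, fun t => ?_⟩
  · apply hm.injective; rw [hsK, hK0]
  · exact HasDerivAt.of_local_left_inverse s.continuous.continuousAt (hd (s t))
      (hc.trans_le (h _)).ne' (Eventually.of_forall hsK)

end

section
open Set Metric Filter
set_option linter.unusedSimpArgs false
open scoped RealInnerProductSpace
open scoped Topology

theorem exists_last {d : ℝ → ℝ} (hd : Continuous d) {a b c : ℝ} (hab : a ≤ b) (ha : c ≤ d a) :
    ∃ s ∈ Icc a b, c ≤ d s ∧ ∀ t ∈ Ioc s b, d t < c := by
  set A := Icc a b ∩ {t | c ≤ d t} with hA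
  have hAc : IsCompact A := isCompact_Icc.inter_right (isClosed_le continuous_const hd)
  obtain ⟨s, hs, hmax⟩ := hAc.exists_isGreatest ⟨a, ⟨le_rfl, hab⟩, ha⟩
  refine ⟨s, hs.1, hs.2, fun t ht => ?_⟩
  by_contra hc
  push Not at hc
  exact absurd (hmax ⟨⟨hs.1.1.trans ht.1.le, ht.2⟩, hc⟩) (not_le.2 ht.1)

theorem exists_first {d : ℝ → ℝ} (hd : Continuous d) {a b c : ℝ} (hab : a ≤ b) (hb : c ≤ d b) :
    ∃ s ∈ Icc a b, c ≤ d s ∧ ∀ t ∈ Ico a s, d t < c := by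
  set A := Icc a b ∩ {t | c ≤ d t} with hA
  have hAc : IsCompact A := isCompact_Icc.inter_right (isClosed_le continuous_const hd)
  obtain ⟨s, hs, hmin⟩ := hAc.exists_isLeast ⟨b, ⟨hab, le_rfl⟩, hb⟩
  refine ⟨s, hs.1, hs.2, fun t ht => ?_⟩
  by_contra hc
  push Not at hc
  exact absurd (hmin ⟨⟨ht.1, ht.2.le.trans hs.1.2⟩, hc⟩) (not_le.2 ht.2)

theorem crossing {d : ℝ → ℝ} (hd : Continuous d) {a b α β : ℝ} (hab : a ≤ b) (ha : d a ≤ α)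
    (hαβ : α < β) (hb : β ≤ d b) :
    ∃ s s', s ∈ Icc a b ∧ s' ∈ Icc a b ∧ s ≤ s' ∧ d s ≤ α ∧ β ≤ d s' ∧
      ∀ t ∈ Ioo s s', α < d t ∧ d t < β := by
  obtain ⟨s', hs', h1, h2⟩ := exists_first hd hab hb
  obtain ⟨s, hs, h3, h4⟩ := exists_last (d := fun t => -d t) hd.neg (c := -α) hs'.1 (by linarith)
  refine ⟨s, s', ⟨hs.1, hs.2.trans hs'.2⟩, hs', hs.2, by linarith, h1, fun t ht => ⟨?_, ?_⟩⟩
  · have := h4 t ⟨ht.1, ht.2.le⟩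
    linarith
  · exact h2 t ⟨hs.1.trans ht.1.le, ht.2⟩

namespace FlowOf
variable {φ : Euc 2 → ℝ} {f : Euc 2 → Euc 2} {F : ℝ → Euc 2 → Euc 2}

theorem len (hF : FlowOf f F) (hP : Pot φ f) {x : Euc 2} {c s s' : ℝ} (hc : 0 < c) (hss : s ≤ s')
    (h : ∀ t ∈ Ioo s s', c ≤ ‖f (F t x)‖) : c * ‖F s' x - F s x‖ ≤ φ (F s' x) - φ (F s x) := by
  have h' : ∀ t ∈ Icc s s', s < s' → c ≤ ‖f (F t x)‖ := by
    intro t ht hlt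
    have hcl : IsClosed {t | c ≤ ‖f (F t x)‖} :=
      isClosed_le continuous_const ((hF.cd.continuous.comp (hF.cont_t x)).norm)
    have : closure (Ioo s s') ⊆ {t | c ≤ ‖f (F t x)‖} := closure_minimal h hcl
    rw [closure_Ioo hlt.ne] at this
    exact this ht
  have := image_norm_le_of_norm_deriv_right_le_deriv_boundary
    (f := fun t => F t x - F s x) (f' := fun t => nf f (F t x)) (a := s) (b := s')
    (B := fun t => c⁻¹ * (φ (F t x) - φ (F s x)))
    (B' := fun t => c⁻¹ * ⟪f (F t x), nf f (F t x)⟫)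
    ((hF.cont_t x).sub continuous_const).continuousOn
    (fun t _ => ((hF.deriv x t).sub_const _).hasDerivWithinAt)
    (by simp)
    (fun t => ((hF.phi_deriv hP x t).sub_const _).const_mul _)
    (by
      intro t ht
      have hct := h' t ⟨ht.1, ht.2.le⟩ (ht.1.trans_lt ht.2)
      rw [inner_nf, nf, norm_smul, norm_inv, Real.norm_of_nonneg (by positivity), inv_mul_eq_div,
        inv_mul_eq_div, le_div_iff₀ hc]
      rw [div_mul_eq_mul_div]
      gcongr
      nlinarith [norm_nonneg (f (F t x))])
    (right_mem_Icc.2 hss)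
  rw [inv_mul_eq_div, le_div_iff₀ hc] at this
  linarith

end FlowOf

/-- all the data of a generic system -/
structure Sys (φ : Euc 2 → ℝ) (f : Euc 2 → Euc 2) (F : ℝ → Euc 2 → Euc 2) : Prop where
  pot : Pot φ f
  flow : FlowOf f F
  proper : IsProper f
  nondeg : ∀ p : Euc 2, f p = 0 → Function.Bijective (fderiv ℝ f p)
  inj : ∀ p q : Euc 2, f p = 0 → f q = 0 → φ p = φ q → p = q
  nsc : NoSaddleConnection f

/-- backward limit -/
def BL (F : ℝ → Euc 2 → Euc 2) (x b : Euc 2) : Prop := Tendsto (fun t => F t x) atBot (𝓝 b)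

namespace Sys
variable {φ : Euc 2 → ℝ} {f : Euc 2 → Euc 2} {F : ℝ → Euc 2 → Euc 2}

theorem isolated (S : Sys φ f F) {p : Euc 2} (hp : f p = 0) : ∀ᶠ z in 𝓝[≠] p, f z ≠ 0 := by
  have h := (S.pot.difff p)
  refine h.eventually_ne ?_
  have hinj := (S.nondeg p hp).1
  obtain ⟨K, _, hK⟩ := (LinearMap.injective_iff_antilipschitz (fderiv ℝ f p).toLinearMap).1 hinj
  exact ⟨K, hK⟩

theorem isolated_ball (S : Sys φ f F) {p : Euc 2} (hp : f p = 0) :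
    ∃ r > 0, ∀ z ∈ closedBall p r, f z = 0 → z = p := by
  have h := eventually_nhdsWithin_iff.1 (S.isolated hp)
  obtain ⟨r, hr, hb⟩ := Metric.nhds_basis_closedBall.eventually_iff.1 h
  refine ⟨r, hr, fun z hz hz0 => ?_⟩
  by_contra hc
  exact hb hz hc hz0

theorem crit_compact (S : Sys φ f F) : IsCompact {z | f z = 0} := by
  have := S.proper {0} isCompact_singleton
  exact this

theorem crit_finite (S : Sys φ f F) : {z | f z = 0}.Finite := by
  by_contra hinf
  obtain ⟨p, hp, hacc⟩ := Set.Infinite.exists_accPt_of_subset_isCompact hinf S.crit_compact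
    Subset.rfl
  have := S.isolated hp
  rw [accPt_iff_frequently_nhdsNE] at hacc
  exact hacc (this.mono fun z hz h => hz h)

theorem bl_crit (S : Sys φ f F) {x b : Euc 2} (h : BL F x b) : f b = 0 := by
  by_contra hb
  -- the limit is a fixed point of the flow
  have h1 : ∀ s, F s b = b := by
    intro s
    have a1 : Tendsto (fun t => F s (F t x)) atBot (𝓝 (F s b)) :=
      ((S.flow.cont_x s).tendsto b).comp h
    have a2 : Tendsto (fun t => F (s + t) x) atBot (𝓝 b) :=
      h.comp (tendsto_atBot_add_const_left _ s tendsto_id)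
    simp only [S.flow.add] at a2
    exact tendsto_nhds_unique a1 a2
  have := S.flow.phi_strictMono S.pot hb zero_lt_one
  simp [h1] at this

theorem bl_le (S : Sys φ f F) {x b : Euc 2} (h : BL F x b) (t : ℝ) : φ b ≤ φ (F t x) := by
  have h1 : Tendsto (fun t => φ (F t x)) atBot (𝓝 (φ b)) := (S.pot.cont.tendsto b).comp h
  exact (S.flow.phi_mono S.pot x).le_of_tendsto h1 t

theorem bl_lt (S : Sys φ f F) {x b : Euc 2} (h : BL F x b) (hx : f x ≠ 0) : φ b < φ x := by
  have h1 := S.bl_le h (-1)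
  have h2 := S.flow.phi_strictMono S.pot hx (show (-1:ℝ) < 0 by norm_num)
  simp only [S.flow.zero] at h2
  exact h1.trans_lt h2

theorem bl_shift (S : Sys φ f F) {x b : Euc 2} (h : BL F x b) (s : ℝ) : BL F (F s x) b := by
  have a2 : Tendsto (fun t => F (t + s) x) atBot (𝓝 b) :=
    h.comp (tendsto_atBot_add_const_right _ s tendsto_id)
  simp only [S.flow.add] at a2
  exact a2

theorem bl_of_shift (S : Sys φ f F) {x b : Euc 2} {s : ℝ} (h : BL F (F s x) b) : BL F x b := by
  have := S.bl_shift h (-s)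
  rwa [S.flow.neg_cancel] at this

theorem bl_fixed (S : Sys φ f F) {x : Euc 2} (h : f x = 0) : BL F x x := by
  unfold BL
  simp only [S.flow.fixed h]
  exact tendsto_const_nhds

theorem small_times (S : Sys φ f F) {x : Euc 2} {m : ℝ} (hm : ∀ t ≤ 0, m ≤ φ (F t x)) (T ε : ℝ)
    (hε : 0 < ε) : ∃ t ≤ T, ‖f (F t x)‖ < ε := by
  by_contra hc
  push Not at hc
  set T0 := min T 0 with hT0
  set η := ε ^ 2 / (1 + ε ^ 2) with hη
  have hη0 : 0 < η := by positivity
  have hmono : MonotoneOn (fun t => φ (F t x) - η * t) (Iic T0) := by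
    apply monotoneOn_of_deriv_nonneg (convex_Iic T0)
    · exact ((S.pot.cont.comp (S.flow.cont_t x)).sub (by fun_prop)).continuousOn
    · intro t _
      exact ((S.flow.phi_deriv S.pot x t).sub
        ((hasDerivAt_id t).const_mul η)).differentiableAt.differentiableWithinAt
    · intro t ht
      rw [interior_Iic] at ht
      have e := ((S.flow.phi_deriv S.pot x t).sub ((hasDerivAt_id t).const_mul η)).deriv
      have e' : deriv (fun t => φ (F t x) - η * t) t = _ := e
      rw [e', FlowOf.inner_nf, mul_one, sub_nonneg, hη]
      have h1 := hc t (le_trans (le_of_lt ht) (min_le_left _ _))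
      rw [div_le_div_iff₀ (by positivity) (by positivity)]
      have : ε ^ 2 ≤ ‖f (F t x)‖ ^ 2 := by gcongr
      nlinarith
  have h0 : T0 ≤ 0 := min_le_right _ _
  set t1 := T0 - (φ (F T0 x) - m + 1) / η with ht1
  have hpos : 0 ≤ (φ (F T0 x) - m + 1) / η := by
    have := hm T0 h0
    apply div_nonneg _ hη0.le
    linarith
  have h1 := hmono (a := t1) (b := T0) (mem_Iic.2 (by linarith)) (mem_Iic.2 le_rfl) (by linarith)
  have h2 := hm t1 (by linarith)
  simp only at h1
  have : η * (T0 - t1) = φ (F T0 x) - m + 1 := by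
    rw [ht1]; field_simp; ring
  nlinarith

theorem conv_of_bdd (S : Sys φ f F) {x : Euc 2} {m : ℝ} (hm : ∀ t ≤ 0, m ≤ φ (F t x)) :
    ∃ b, f b = 0 ∧ BL F x b := by
  have H := fun n : ℕ => S.small_times hm (-(n:ℝ)) (1 / ((n:ℝ) + 1)) (by positivity)
  choose t ht hft using H
  have hcomp := S.proper (closedBall 0 1) (isCompact_closedBall 0 1)
  have hmem : ∀ n, F (t n) x ∈ f ⁻¹' (closedBall 0 1) := by
    intro n
    rw [mem_preimage, mem_closedBall_zero_iff]
    refine (hft n).le.trans ?_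
    rw [div_le_one (by positivity)]
    linarith [(Nat.cast_nonneg n : (0:ℝ) ≤ n)]
  obtain ⟨b, _, k, hk, hlim⟩ := hcomp.tendsto_subseq hmem
  have htb : Tendsto t atTop atBot := by
    apply tendsto_atBot_mono ht
    exact tendsto_neg_atTop_atBot.comp tendsto_natCast_atTop_atTop
  have hfb : f b = 0 := by
    have h1 : Tendsto (fun n => ‖f (F (t (k n)) x)‖) atTop (𝓝 ‖f b‖) :=
      ((S.pot.contf.norm).tendsto b).comp hlim
    have h2 : Tendsto (fun n => ‖f (F (t (k n)) x)‖) atTop (𝓝 0) := by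
      apply squeeze_zero (fun _ => norm_nonneg _) (fun n => (hft (k n)).le)
      exact (tendsto_one_div_add_atTop_nhds_zero_nat).comp hk.tendsto_atTop
    exact norm_eq_zero.1 (tendsto_nhds_unique h1 h2)
  refine ⟨b, hfb, ?_⟩
  obtain ⟨r, hr, hiso⟩ := S.isolated_ball hfb
  -- limit of the values
  have hlimφ : ∃ c, Tendsto (fun t => φ (F t x)) atBot (𝓝 c) := by
    refine ⟨_, tendsto_atBot_ciInf (S.flow.phi_mono S.pot x) ⟨m, ?_⟩⟩
    rintro _ ⟨s, rfl⟩
    rcases le_or_gt s 0 with h | h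
    · exact hm s h
    · exact (hm 0 le_rfl).trans (S.flow.phi_mono S.pot x h.le)
  obtain ⟨c, hc⟩ := hlimφ
  have hclt : ∀ t, c ≤ φ (F t x) := fun t => (S.flow.phi_mono S.pot x).le_of_tendsto hc t
  unfold BL
  rw [Metric.tendsto_nhds]
  intro ε hε
  set ρ := min ε r with hρ
  have hρ0 : 0 < ρ := lt_min hε hr
  -- lower bound on annulus
  have hann : IsCompact (closedBall b ρ ∩ {z | ρ / 2 ≤ dist z b}) :=
    (isCompact_closedBall b ρ).inter_right (isClosed_le continuous_const (by fun_prop))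
  obtain ⟨c', hc', hlow⟩ : ∃ c' > 0, ∀ z ∈ closedBall b ρ ∩ {z | ρ / 2 ≤ dist z b}, c' ≤ ‖f z‖ := by
    rcases (closedBall b ρ ∩ {z | ρ / 2 ≤ dist z b}).eq_empty_or_nonempty with he | hne
    · exact ⟨1, one_pos, fun z hz => by rw [he] at hz; exact absurd hz (notMem_empty _)⟩
    · obtain ⟨z0, hz0, hmin⟩ := hann.exists_isMinOn hne S.pot.contf.norm.continuousOn
      refine ⟨‖f z0‖, ?_, fun z hz => hmin hz⟩
      rw [gt_iff_lt, norm_pos_iff]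
      intro h0
      have := hiso z0 (closedBall_subset_closedBall (min_le_right _ _) hz0.1) h0
      have h3 : ρ / 2 ≤ dist z0 b := hz0.2
      rw [this, dist_self] at h3
      linarith
  obtain ⟨T1, hT1⟩ := (hc.eventually_lt_const (show c < c + c' * (ρ / 2) by nlinarith)).exists
  filter_upwards [eventually_le_atBot T1] with t1 ht1
  by_contra hcon
  push Not at hcon
  -- earlier time close to b
  have hclose : ∀ᶠ n in atTop, dist (F (t (k n)) x) b < ρ / 2 :=
    (Metric.tendsto_nhds.1 hlim) (ρ / 2) (by linarith)
  obtain ⟨n, hn1, hn2⟩ := (hclose.and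
    ((htb.comp hk.tendsto_atTop).eventually_le_atBot t1)).exists
  obtain ⟨s, s', hs, hs', hss, h1, h2, h3⟩ := crossing (d := fun t => dist (F t x) b)
    ((S.flow.cont_t x).dist continuous_const) hn2 hn1.le (show ρ / 2 < ρ by linarith)
    ((min_le_left _ _).trans hcon)
  have hl := S.flow.len S.pot (x := x) hc' hss (fun u hu => hlow _
    ⟨mem_closedBall.2 (h3 u hu).2.le, (h3 u hu).1.le⟩)
  have h4 : ρ / 2 ≤ ‖F s' x - F s x‖ := by
    rw [← dist_eq_norm]
    have := dist_triangle (F s' x) (F s x) b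
    linarith
  have h5 := hclt s
  have h6 := S.flow.phi_mono S.pot x (hs'.2.trans ht1)
  simp only at h6
  nlinarith

/-- points whose backward orbit has potential unbounded below -/
def Low (φ : Euc 2 → ℝ) (F : ℝ → Euc 2 → Euc 2) (x : Euc 2) : Prop := ∀ m, ∃ t ≤ 0, φ (F t x) < m

theorem dichotomy (S : Sys φ f F) (x : Euc 2) : Low φ F x ∨ ∃ b, f b = 0 ∧ BL F x b := by
  by_cases h : Low φ F x
  · exact Or.inl h
  · right
    unfold Low at h
    push Not at h
    obtain ⟨m, hm⟩ := h
    exact S.conv_of_bdd hm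

theorem bl_unique {x b b' : Euc 2} (h : BL F x b) (h' : BL F x b') : b = b' :=
  tendsto_nhds_unique h h'

theorem not_low_of_bl (S : Sys φ f F) {x b : Euc 2} (h : BL F x b) : ¬ Low φ F x := by
  intro hl
  obtain ⟨t, _, ht⟩ := hl (φ b)
  exact absurd (S.bl_le h t) (not_le.2 ht)

theorem low_shift (S : Sys φ f F) {x : Euc 2} (h : Low φ F x) (s : ℝ) : Low φ F (F s x) := by
  rcases S.dichotomy (F s x) with h1 | ⟨b, _, hb⟩
  · exact h1
  · exact absurd h (S.not_low_of_bl (S.bl_of_shift hb))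

end Sys

end

section
open Set Metric Filter
set_option linter.unusedSimpArgs false
set_option linter.unusedVariables false
open scoped RealInnerProductSpace
open scoped Topology

theorem fderiv_neg_fun (f : Euc 2 → Euc 2) (p : Euc 2) :
    fderiv ℝ (fun x => - f x) p = - fderiv ℝ f p := fderiv_fun_neg

theorem source_neg {f : Euc 2 → Euc 2} {p : Euc 2} :
    IsSourceAt (fun x => - f x) p ↔ IsSinkAt f p := by
  simp [IsSourceAt, IsSinkAt, fderiv_neg_fun]

theorem sink_neg {f : Euc 2 → Euc 2} {p : Euc 2} :
    IsSinkAt (fun x => - f x) p ↔ IsSourceAt f p := by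
  simp [IsSourceAt, IsSinkAt, fderiv_neg_fun]

theorem saddle_neg {f : Euc 2 → Euc 2} {p : Euc 2} :
    IsSaddleAt (fun x => - f x) p ↔ IsSaddleAt f p := by
  simp only [IsSaddleAt, source_neg, sink_neg, neg_eq_zero]
  tauto

theorem nsc_neg {f : Euc 2 → Euc 2} (h : NoSaddleConnection f) :
    NoSaddleConnection (fun x => - f x) := by
  rintro ⟨γ, p, q, hγ, hp, hq, hpq, h1, h2⟩
  refine h ⟨fun t => γ (-t), q, p, ?_, saddle_neg.1 hq, saddle_neg.1 hp, hpq.symm,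
    h2.comp tendsto_neg_atBot_atTop, h1.comp tendsto_neg_atTop_atBot⟩
  intro t
  have := (hγ (-t)).scomp t (hasDerivAt_neg t)
  rw [neg_one_smul, neg_neg] at this
  exact this

/-- time change turning bounded orbits of the normalized flow into trajectories -/
theorem FlowOf.traj {f : Euc 2 → Euc 2} {F : ℝ → Euc 2 → Euc 2} (hF : FlowOf f F) {x : Euc 2} {C : ℝ}
    (hC : ∀ t, ‖f (F t x)‖ ≤ C) : ∃ s : ℝ ≃o ℝ, s 0 = 0 ∧ IsTrajectory f (fun t => F (s t) x) := by
  have hcont : Continuous (fun t => (1 + ‖f (F t x)‖ ^ 2)⁻¹) := by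
    have := hF.cd.continuous.comp (hF.cont_t x)
    exact Continuous.inv₀ (continuous_const.add (this.norm.pow 2)) (fun t => by positivity)
  obtain ⟨s, hs0, hs⟩ := time_change hcont (c := (1 + C ^ 2)⁻¹) (by positivity) (by
    intro t
    have := hC t
    gcongr)
  refine ⟨s, hs0, fun t => ?_⟩
  have := (hF.deriv x (s t)).scomp t (hs t)
  have e : (1 + ‖f (F (s t) x)‖ ^ 2)⁻¹⁻¹ • nf f (F (s t) x) = f (F (s t) x) := by
    rw [nf, smul_smul, inv_inv, mul_inv_cancel₀ (by positivity), one_smul]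
  rw [e] at this
  exact this

theorem FlowOf.bl_of_basin {f : Euc 2 → Euc 2} {F : ℝ → Euc 2 → Euc 2} (hF : FlowOf f F)
    {s1 z : Euc 2} (h : InBackwardBasin f s1 z) : BL F z s1 := by
  obtain ⟨γ, h0, hd, hl⟩ := h
  have hγc : Continuous (fun t => γ (min t 0)) := by
    have : ContinuousOn γ (Iic 0) := fun t ht => (hd t ht).continuousAt.continuousWithinAt
    exact this.comp_continuous (by fun_prop) (fun t => mem_Iic.2 (min_le_right _ _))
  obtain ⟨s, hs0, hs⟩ := time_change (κ := fun t => 1 + ‖f (γ (min t 0))‖ ^ 2)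
    (by have := hF.cd.continuous.comp hγc; exact continuous_const.add ((this.norm).pow 2)) one_pos
    (fun t => by nlinarith [sq_nonneg ‖f (γ (min t 0))‖])
  have hsle : ∀ t ≤ 0, s t ≤ 0 := fun t ht => by rw [← hs0]; exact s.monotone ht
  have key : ∀ t ≤ 0, γ (s t) = F t z := by
    intro t ht
    have := hF.uniq_left (γ := fun t => γ (s t)) (by
      intro t ht
      have := (hd (s t) (hsle t ht)).scomp t (hs t)
      rw [min_eq_left (hsle t ht)] at this
      exact this) t ht
    simp only [hs0, h0] at this
    exact this
  have h1 : Tendsto (fun t => γ (s t)) atBot (𝓝 s1) := hl.comp s.tendsto_atBot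
  refine h1.congr' ?_
  filter_upwards [eventually_le_atBot 0] with t ht using key t ht

theorem source_coer {φ : Euc 2 → ℝ} {f : Euc 2 → Euc 2} (hP : Pot φ f) {p : Euc 2}
    (h : IsSourceAt f p) : Coer f p := by
  refine ⟨h.1, ?_⟩
  have hcs : IsCompact (sphere (0 : Euc 2) 1) := isCompact_sphere 0 1
  have hne : (sphere (0 : Euc 2) 1).Nonempty := NormedSpace.sphere_nonempty.2 zero_le_one
  obtain ⟨v0, hv0, hmin⟩ := hcs.exists_isMinOn hne
    (f := fun v => ⟪fderiv ℝ f p v, v⟫) (by fun_prop)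
  set m := ⟪fderiv ℝ f p v0, v0⟫ with hm
  have hm0 : 0 < m := h.2 v0 (by
    rintro rfl
    simp at hv0)
  have hq : ∀ v, m * ‖v‖ ^ 2 ≤ ⟪fderiv ℝ f p v, v⟫ := by
    intro v
    by_cases hv : v = 0
    · simp [hv]
    have hvn : 0 < ‖v‖ := norm_pos_iff.2 hv
    have := hmin (a := ‖v‖⁻¹ • v) (by simp [norm_smul, hvn.ne'])
    simp only [mem_ofPred_eq, map_smul, inner_smul_left, inner_smul_right] at this
    simp only [conj_trivial] at this
    rw [← mul_assoc, ← sq, inv_pow, inv_mul_eq_div, le_div_iff₀ (by positivity)] at this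
    exact this
  have hl := (hP.difff p).isLittleO.def (show 0 < m / 2 by linarith)
  refine ⟨m / 2, by linarith, ?_⟩
  filter_upwards [hl] with z hz
  rw [h.1, sub_zero] at hz
  have h1 := hq (z - p)
  have h2 : |⟪f z - fderiv ℝ f p (z - p), z - p⟫| ≤ (m / 2 * ‖z - p‖) * ‖z - p‖ :=
    (abs_real_inner_le_norm _ _).trans (by gcongr)
  rw [inner_sub_left] at h2
  nlinarith [(abs_le.1 h2).1]

namespace Sys
variable {φ : Euc 2 → ℝ} {f : Euc 2 → Euc 2} {F : ℝ → Euc 2 → Euc 2}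

theorem neg (S : Sys φ f F) : Sys (fun x => - φ x) (fun x => - f x) (fun t x => F (-t) x) where
  pot := S.pot.neg
  flow := S.flow.neg
  proper := by
    intro K hK
    have : (fun x => - f x) ⁻¹' K = f ⁻¹' (-K) := by ext; simp
    rw [this]
    exact S.proper _ hK.neg
  nondeg := by
    intro p hp
    have := S.nondeg p (by simpa using hp)
    rw [fderiv_neg_fun]
    have h2 : ⇑(-fderiv ℝ f p) = (fun x => -x) ∘ (fderiv ℝ f p) := by ext; simp
    rw [h2]
    exact (Equiv.neg (Euc 2)).bijective.comp this
  inj := by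
    intro p q hp hq h
    exact S.inj p q (by simpa using hp) (by simpa using hq) (by simpa using h)
  nsc := nsc_neg S.nsc

theorem nsc_orbit (S : Sys φ f F) {x s1 s2 : Euc 2} (h1 : BL F x s1)
    (h2 : Tendsto (fun t => F t x) atTop (𝓝 s2)) (hs1 : IsSaddleAt f s1) (hs2 : IsSaddleAt f s2)
    (hne : s1 ≠ s2) : False := by
  have hb : ∃ C, ∀ t, ‖f (F t x)‖ ≤ C := by
    have hc : Continuous (fun t => ‖f (F t x)‖) := (S.pot.contf.comp (S.flow.cont_t x)).norm
    have a1 : Tendsto (fun t => ‖f (F t x)‖) atBot (𝓝 ‖f s1‖) :=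
      ((S.pot.contf.norm).tendsto _).comp h1
    have a2 : Tendsto (fun t => ‖f (F t x)‖) atTop (𝓝 ‖f s2‖) :=
      ((S.pot.contf.norm).tendsto _).comp h2
    rw [hs1.1, norm_zero] at a1
    rw [hs2.1, norm_zero] at a2
    obtain ⟨T1, hT1⟩ := eventually_atBot.1 (a1.eventually_lt_const zero_lt_one)
    obtain ⟨T2, hT2⟩ := eventually_atTop.1 (a2.eventually_lt_const zero_lt_one)
    obtain ⟨C, hC⟩ := (isCompact_Icc (a := T1) (b := T2)).bddAbove_image hc.continuousOn
    refine ⟨max C 1, fun t => ?_⟩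
    rcases le_or_gt t T1 with h | h
    · exact (hT1 t h).le.trans (le_max_right _ _)
    rcases le_or_gt T2 t with h' | h'
    · exact (hT2 t h').le.trans (le_max_right _ _)
    · exact (hC ⟨t, ⟨h.le, h'.le⟩, rfl⟩).trans (le_max_left _ _)
  obtain ⟨C, hC⟩ := hb
  obtain ⟨s, _, hs⟩ := S.flow.traj hC
  exact S.nsc ⟨_, s1, s2, hs, hs1, hs2, hne, h1.comp s.tendsto_atBot, h2.comp s.tendsto_atTop⟩

theorem src_ball (S : Sys φ f F) {p : Euc 2} (hp : IsSourceAt f p) :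
    ∃ r > 0, ∀ x ∈ ball p r, BL F x p := by
  obtain ⟨_, κ, hκ, hco⟩ := source_coer S.pot hp
  obtain ⟨r1, hr1, hiso⟩ := S.isolated_ball hp.1
  obtain ⟨r2, hr2, hco⟩ := Metric.eventually_nhds_iff_ball.1 hco
  set r := min r1 r2 with hr
  have hr0 : 0 < r := lt_min hr1 hr2
  refine ⟨r, hr0, fun x hx => ?_⟩
  have hcont : Continuous (fun t => ‖F t x - p‖ ^ 2) := by
    have := S.flow.cont_t x
    fun_prop
  have hstay : ∀ t ≤ 0, ‖F t x - p‖ ^ 2 < r ^ 2 := by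
    intro t0 ht0
    by_contra hc
    push Not at hc
    obtain ⟨s, hs, h1, h2⟩ := exists_last hcont ht0 hc
    have hmono : MonotoneOn (fun t => ‖F t x - p‖ ^ 2) (Icc s 0) := by
      have hd : ∀ t, HasDerivAt (fun t => ‖F t x - p‖ ^ 2) (2 * ⟪F t x - p, nf f (F t x)⟫) t :=
        fun t => ((S.flow.deriv x t).sub_const p).norm_sq
      apply monotoneOn_of_deriv_nonneg (convex_Icc s 0) hcont.continuousOn
      · exact fun t _ => (hd t).differentiableAt.differentiableWithinAt
      · intro t ht
        rw [interior_Icc] at ht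
        rw [(hd t).deriv]
        have h3 := h2 t ⟨ht.1, ht.2.le⟩
        have h4 : F t x ∈ ball p r2 := by
          rw [mem_ball, dist_eq_norm]
          exact (lt_of_pow_lt_pow_left₀ 2 hr0.le h3).trans_le (min_le_right _ _)
        have h5 := hco _ h4
        rw [nf, inner_smul_right, real_inner_comm]
        have : 0 ≤ κ * ‖F t x - p‖ ^ 2 := by positivity
        have : 0 ≤ ⟪f (F t x), F t x - p⟫ := this.trans h5
        positivity
    have := hmono (left_mem_Icc.2 hs.2) (right_mem_Icc.2 hs.2) hs.2
    simp only [S.flow.zero] at this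
    rw [mem_ball, dist_eq_norm] at hx
    have : ‖x - p‖ ^ 2 < r ^ 2 := by gcongr
    linarith
  have hstay' : ∀ t ≤ 0, F t x ∈ closedBall p r := by
    intro t ht
    rw [mem_closedBall, dist_eq_norm]
    exact (lt_of_pow_lt_pow_left₀ 2 hr0.le (hstay t ht)).le
  obtain ⟨m, hm⟩ := (isCompact_closedBall p r).bddBelow_image S.pot.cont.continuousOn
  obtain ⟨b, hb, hbl⟩ := S.conv_of_bdd (x := x) (m := m) fun t ht => hm ⟨_, hstay' t ht, rfl⟩
  have hbm : b ∈ closedBall p r := isClosed_closedBall.mem_of_tendsto hbl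
    (by filter_upwards [eventually_le_atBot 0] with t ht using hstay' t ht)
  rwa [← hiso b (closedBall_subset_closedBall (min_le_left _ _) hbm) hb]

theorem e_open (S : Sys φ f F) {p : Euc 2} (hp : IsSourceAt f p) : IsOpen {x | BL F x p} := by
  rw [isOpen_iff_mem_nhds]
  intro x hx
  obtain ⟨r, hr, hb⟩ := S.src_ball hp
  obtain ⟨t, ht⟩ := (hx.eventually (ball_mem_nhds p hr)).exists
  filter_upwards [(S.flow.cont_x t).continuousAt.preimage_mem_nhds (isOpen_ball.mem_nhds ht)] with z hz
  exact S.bl_of_shift (hb _ hz)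

theorem exists_low (S : Sys φ f F) : ∃ m0, ∀ p, f p = 0 → m0 < φ p := by
  obtain ⟨m, hm⟩ := S.crit_compact.bddBelow_image S.pot.cont.continuousOn
  exact ⟨m - 1, fun p hp => by linarith [hm ⟨p, hp, rfl⟩]⟩

theorem low_open (S : Sys φ f F) : IsOpen {x | Low φ F x} := by
  rw [isOpen_iff_mem_nhds]
  intro x hx
  obtain ⟨m0, hm0⟩ := S.exists_low
  obtain ⟨t, ht, hlt⟩ := hx m0
  have hc : Continuous fun z => φ (F t z) := S.pot.cont.comp (S.flow.cont_x t)
  filter_upwards [hc.continuousAt.eventually_lt_const hlt] with z hz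
  rcases S.dichotomy z with h | ⟨b, hb, hbl⟩
  · exact h
  · have := S.bl_le hbl t
    linarith [hm0 b hb]

/-- regular points -/
def Reg (φ : Euc 2 → ℝ) (f : Euc 2 → Euc 2) (F : ℝ → Euc 2 → Euc 2) (x : Euc 2) : Prop :=
  Low φ F x ∨ ∃ p, IsSourceAt f p ∧ BL F x p

/-- BL to a sink only from itself -/
theorem bl_sink (S : Sys φ f F) {x p : Euc 2} (hp : IsSinkAt f p) (h : BL F x p) : x = p := by
  obtain ⟨r, hr, hb⟩ := S.neg.src_ball (source_neg.2 hp)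
  obtain ⟨t, ht⟩ := (h.eventually (ball_mem_nhds p hr)).exists
  have h1 := hb _ ht
  -- forward limit of x is p as well
  have h2 : BL (fun t x => F (-t) x) x p := S.neg.bl_of_shift (s := -t) (by simpa using h1)
  by_contra hne
  have hx : f x ≠ 0 := by
    intro h0
    exact hne (bl_unique (S.bl_fixed h0) h)
  have h3 := S.bl_lt h hx
  have h4 := S.neg.bl_lt h2 (by simpa using hx)
  linarith

theorem trichotomy (S : Sys φ f F) (x : Euc 2) :
    Reg φ f F x ∨ (∃ b, IsSaddleAt f b ∧ BL F x b) ∨ IsSinkAt f x := by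
  rcases S.dichotomy x with h | ⟨b, hb, hbl⟩
  · exact Or.inl (Or.inl h)
  by_cases h1 : IsSourceAt f b
  · exact Or.inl (Or.inr ⟨b, h1, hbl⟩)
  by_cases h2 : IsSinkAt f b
  · exact Or.inr (Or.inr ((S.bl_sink h2 hbl).symm ▸ h2))
  · exact Or.inr (Or.inl ⟨b, ⟨hb, h1, h2⟩, hbl⟩)

theorem not_reg_of_saddle (S : Sys φ f F) {x b : Euc 2} (hb : IsSaddleAt f b) (h : BL F x b) :
    ¬ Reg φ f F x := by
  rintro (h1 | ⟨p, hp, h1⟩)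
  · exact S.not_low_of_bl h h1
  · have := bl_unique h h1
    exact hb.2.1 (this ▸ hp)

theorem reg_open (S : Sys φ f F) : IsOpen {x | Reg φ f F x} := by
  have : {x | Reg φ f F x} = {x | Low φ F x} ∪ ⋃ p, ⋃ (_ : IsSourceAt f p), {x | BL F x p} := by
    ext x; simp [Reg]
  rw [this]
  exact S.low_open.union (isOpen_iUnion fun p => isOpen_iUnion fun hp => S.e_open hp)

/-- union of the other classes is open -/
theorem rest_open (S : Sys φ f F) (x0 : Euc 2) :
    IsOpen {x | Low φ F x ∨ ∃ p, p ≠ x0 ∧ IsSourceAt f p ∧ BL F x p} := by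
  have : {x | Low φ F x ∨ ∃ p, p ≠ x0 ∧ IsSourceAt f p ∧ BL F x p} =
    {x | Low φ F x} ∪ ⋃ p, ⋃ (_ : p ≠ x0), ⋃ (_ : IsSourceAt f p), {x | BL F x p} := by
    ext x; simp; grind
  rw [this]
  exact S.low_open.union (isOpen_iUnion fun p => isOpen_iUnion fun _ => isOpen_iUnion fun hp => S.e_open hp)

theorem reg_conn_e (S : Sys φ f F) {A : Set (Euc 2)} (hA : IsPreconnected A)
    (hreg : ∀ x ∈ A, Reg φ f F x) {p x : Euc 2} (hp : IsSourceAt f p) (hx : x ∈ A) (hxp : BL F x p) :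
    ∀ z ∈ A, BL F z p := by
  have hdis : Disjoint {x | BL F x p} {x | Low φ F x ∨ ∃ p', p' ≠ p ∧ IsSourceAt f p' ∧ BL F x p'} := by
    rw [Set.disjoint_left]
    rintro z hz (h | ⟨p', hne, _, h⟩)
    · exact S.not_low_of_bl hz h
    · exact hne (bl_unique h hz)
  refine hA.subset_left_of_subset_union (S.e_open hp) (S.rest_open p) hdis ?_ ⟨x, hx, hxp⟩
  intro z hz
  rcases hreg z hz with h | ⟨p', hp', h⟩
  · exact Or.inr (Or.inl h)
  · by_cases hpp : p' = p
    · exact Or.inl (hpp ▸ h)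
    · exact Or.inr (Or.inr ⟨p', hpp, hp', h⟩)

theorem reg_conn_low (S : Sys φ f F) {A : Set (Euc 2)} (hA : IsPreconnected A)
    (hreg : ∀ x ∈ A, Reg φ f F x) {x : Euc 2} (hx : x ∈ A) (hxp : Low φ F x) :
    ∀ z ∈ A, Low φ F z := by
  intro z hz
  rcases hreg z hz with h | ⟨p', hp', h⟩
  · exact h
  · exact absurd hxp (S.not_low_of_bl (S.reg_conn_e hA hreg hp' hz h x hx))

theorem reg_shift (S : Sys φ f F) {x : Euc 2} (h : Reg φ f F x) (s : ℝ) : Reg φ f F (F s x) := by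
  rcases h with h | ⟨p, hp, h⟩
  · exact Or.inl (S.low_shift h s)
  · exact Or.inr ⟨p, hp, S.bl_shift h s⟩

end Sys

end

section
open Set Metric Filter
set_option linter.unusedSimpArgs false
set_option linter.unusedVariables false
open scoped RealInnerProductSpace
open scoped Topology

namespace Sys
variable {φ : Euc 2 → ℝ} {f : Euc 2 → Euc 2} {F : ℝ → Euc 2 → Euc 2}

theorem leaves (S : Sys φ f F) {q z : Euc 2} {r : ℝ} (hiso : ∀ z ∈ closedBall q r, f z = 0 → z = q)
    (hz : ¬ BL F z q) : ∃ t ≤ 0, r ≤ dist (F t z) q := by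
  by_contra hc
  push Not at hc
  obtain ⟨m, hm⟩ := (isCompact_closedBall q r).bddBelow_image S.pot.cont.continuousOn
  obtain ⟨b, hb, hbl⟩ := S.conv_of_bdd (x := z) (m := m)
    fun t ht => hm ⟨_, mem_closedBall.2 (hc t ht).le, rfl⟩
  have hbm : b ∈ closedBall q r := isClosed_closedBall.mem_of_tendsto hbl
    (by filter_upwards [eventually_le_atBot 0] with t ht using mem_closedBall.2 (hc t ht).le)
  exact hz (hiso b hbm hb ▸ hbl)

theorem exit (S : Sys φ f F) {q : Euc 2} {r : ℝ} (hr : 0 < r) (hq : f q = 0)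
    (hiso : ∀ z ∈ closedBall q r, f z = 0 → z = q) {A : Set (Euc 2)}
    (hinv : ∀ z ∈ A, ∀ t, F t z ∈ A) (hcl : q ∈ closure A)
    (hleave : ∀ z ∈ A, ∃ t ≤ 0, r ≤ dist (F t z) q) :
    ∃ y ∈ closure A, dist y q = r ∧ BL (fun t x => F (-t) x) y q := by
  obtain ⟨w, hwA, hw⟩ := mem_closure_iff_seq_limit.1 hcl
  have hev : ∀ᶠ n in atTop, w n ∈ ball q r := hw.eventually (ball_mem_nhds q hr)
  obtain ⟨N, hN⟩ := eventually_atTop.1 hev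
  have H : ∀ n, ∃ s ≤ 0, dist (F s (w (n + N))) q = r ∧
      ∀ t ∈ Ioc s 0, dist (F t (w (n + N))) q < r := by
    intro n
    have hc : Continuous (fun t => dist (F t (w (n + N))) q) :=
      (S.flow.cont_t _).dist continuous_const
    obtain ⟨t0, ht0, h0⟩ := hleave _ (hwA (n + N))
    obtain ⟨s, hs, h1, h2⟩ := exists_last hc ht0 h0
    refine ⟨s, hs.2, le_antisymm ?_ h1, h2⟩
    have hs0 : s < 0 := by
      rcases hs.2.lt_or_eq with h | h
      · exact h
      · rw [h, S.flow.zero] at h1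
        exact absurd (hN (n + N) (by omega)) (by simpa using h1)
    have : closure (Ioc s 0) ⊆ {t | dist (F t (w (n + N))) q ≤ r} :=
      closure_minimal (fun t ht => (h2 t ht).le) (isClosed_le hc continuous_const)
    rw [closure_Ioc hs0.ne] at this
    exact this ⟨le_rfl, hs0.le⟩
  choose τ hτ0 hτr hτlt using H
  obtain ⟨y, hy, k, hk, hlim⟩ := (isCompact_sphere q r).tendsto_subseq
    (x := fun n => F (τ n) (w (n + N))) (fun n => mem_sphere.2 (hτr n))
  have hyA : y ∈ closure A := mem_closure_of_tendsto hlim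
    (Eventually.of_forall fun n => hinv _ (hwA _) _)
  have hτ : ∀ T : ℝ, 0 ≤ T → ∀ᶠ n in atTop, τ n < -T := by
    intro T hT
    have hO : IsOpen {p : ℝ × Euc 2 | dist (F p.1 p.2) q < r} :=
      isOpen_lt (S.flow.cont.dist continuous_const) continuous_const
    obtain ⟨u, v, _, hv, hu, hqv, huv⟩ := generalized_tube_lemma
      (isCompact_Icc (a := -T) (b := 0)) (isCompact_singleton (x := q)) hO (by
        rintro ⟨t, z⟩ ⟨_, hz⟩
        have hz' : z = q := mem_singleton_iff.1 hz
        rw [hz', mem_ofPred_eq]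
        simp only
        rw [S.flow.fixed hq, dist_self]
        exact hr)
    have : ∀ᶠ n in atTop, w (n + N) ∈ v :=
      (hw.comp (tendsto_add_atTop_nat N)).eventually (hv.mem_nhds (hqv rfl))
    filter_upwards [this] with n hn
    by_contra hc
    push Not at hc
    have hmem : (τ n, w (n + N)) ∈ u ×ˢ v := mk_mem_prod (hu ⟨hc, hτ0 n⟩) hn
    have h3 := huv hmem
    rw [mem_ofPred_eq] at h3
    simp only at h3
    rw [hτr] at h3
    exact lt_irrefl _ h3
  have hfwd : ∀ t, 0 ≤ t → F t y ∈ closedBall q r := by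
    intro t ht
    rcases ht.eq_or_lt with h | ht'
    · rw [← h, S.flow.zero]
      exact sphere_subset_closedBall hy
    have h1 : Tendsto (fun n => F t (F (τ (k n)) (w (k n + N)))) atTop (𝓝 (F t y)) :=
      ((S.flow.cont_x t).tendsto y).comp hlim
    refine isClosed_closedBall.mem_of_tendsto h1 ?_
    filter_upwards [hk.tendsto_atTop.eventually (hτ t ht)] with n hn
    rw [← S.flow.add]
    exact mem_closedBall.2 (hτlt (k n) _ ⟨by linarith, by linarith⟩).le
  refine ⟨y, hyA, hy, ?_⟩
  by_contra hnb
  obtain ⟨m, hm⟩ := (isCompact_closedBall q r).bddBelow_image S.neg.pot.cont.continuousOn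
  obtain ⟨b, hb, hbl⟩ := S.neg.conv_of_bdd (x := y) (m := m)
    fun t ht => hm ⟨_, hfwd (-t) (by linarith), rfl⟩
  have hbm : b ∈ closedBall q r := isClosed_closedBall.mem_of_tendsto hbl
    (by filter_upwards [eventually_le_atBot 0] with t ht using hfwd (-t) (by linarith))
  exact hnb (hiso b hbm (by simpa using hb) ▸ hbl)

theorem fwd_reg (S : Sys φ f F) {q y : Euc 2} {r : ℝ} (hr : 0 < r) (hq : IsSaddleAt f q)
    (hiso : ∀ z ∈ closedBall q r, f z = 0 → z = q) (hy : dist y q = r)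
    (hbl : BL (fun t x => F (-t) x) y q) : φ y < φ q ∧ Reg φ f F y := by
  have hyq : y ≠ q := by
    rintro rfl
    rw [dist_self] at hy
    linarith
  have hfy : f y ≠ 0 := fun h => hyq (hiso y (mem_closedBall.2 hy.le) h)
  have h1 := S.neg.bl_lt hbl (by simpa using hfy)
  have h2 : φ y < φ q := by linarith
  refine ⟨h2, ?_⟩
  rcases S.trichotomy y with h | ⟨b, hb, hb2⟩ | h
  · exact h
  · exfalso
    have h3 := S.bl_lt hb2 hfy
    refine S.nsc_orbit hb2 ?_ hb hq (by rintro rfl; linarith)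
    have := hbl.comp tendsto_neg_atTop_atBot
    simpa [Function.comp_def] using this
  · exact absurd h.1 hfy

theorem key (S : Sys φ f F) {q : Euc 2} (hq : IsSaddleAt f q) :
    ∃ δ > 0, ∀ w ∈ ball q δ, Reg φ f F w ∨ BL F w q := by
  by_contra hc
  obtain ⟨r, hr, hiso⟩ := S.isolated_ball hq.1
  set A := {w | ¬ Reg φ f F w ∧ ¬ BL F w q} with hA
  have hcl : q ∈ closure A := by
    rw [Metric.mem_closure_iff]
    intro ε hε
    by_contra hn
    push Not at hn
    refine hc ⟨ε, hε, fun w hw => ?_⟩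
    by_contra hw2
    push Not at hw2
    exact absurd (hn w hw2) (not_le.2 (by rw [dist_comm]; exact hw))
  obtain ⟨y, hyA, hy, hbl⟩ := S.exit hr hq.1 hiso (A := A) (by
    rintro z ⟨h1, h2⟩ t
    refine ⟨fun h => h1 ?_, fun h => h2 (S.bl_of_shift h)⟩
    have := S.reg_shift h (-t)
    rwa [S.flow.neg_cancel] at this) hcl (fun z hz => S.leaves hiso hz.2)
  have hreg := (S.fwd_reg hr hq hiso hy hbl).2
  obtain ⟨z, hz1, hz2⟩ := mem_closure_iff.1 hyA _ S.reg_open hreg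
  exact hz2.1 hz1

theorem e_of_closure (S : Sys φ f F) {p y : Euc 2} (hp : IsSourceAt f p)
    (hy : y ∈ closure {x | BL F x p}) (hreg : Reg φ f F y) : BL F y p := by
  by_contra hn
  have : y ∈ {x | Low φ F x ∨ ∃ p', p' ≠ p ∧ IsSourceAt f p' ∧ BL F x p'} := by
    rcases hreg with h | ⟨p', hp', h⟩
    · exact Or.inl h
    · exact Or.inr ⟨p', fun h' => hn (h' ▸ h), hp', h⟩
  obtain ⟨z, hz1, hz2⟩ := mem_closure_iff.1 hy _ (S.rest_open p) this
  rcases hz1 with h | ⟨p', hne, _, h⟩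
  · exact S.not_low_of_bl hz2 h
  · exact hne (bl_unique h hz2)

theorem e_exit (S : Sys φ f F) {p q : Euc 2} {r : ℝ} (hr : 0 < r) (hp : IsSourceAt f p)
    (hq : IsSaddleAt f q) (hiso : ∀ z ∈ closedBall q r, f z = 0 → z = q)
    (hcl : q ∈ closure {x | BL F x p}) : ∃ y, dist y q = r ∧ φ y < φ q ∧ BL F y p := by
  obtain ⟨y, hyA, hy, hbl⟩ := S.exit hr hq.1 hiso (A := {x | BL F x p})
    (fun z hz t => S.bl_shift hz t) hcl
    (fun z hz => S.leaves hiso (fun h => hq.2.1 (bl_unique h hz ▸ hp)))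
  have hreg := (S.fwd_reg hr hq hiso hy hbl)
  exact ⟨y, hy, hreg.1, S.e_of_closure hp hyA hreg.2⟩

theorem source_not_sink {p : Euc 2} (h1 : IsSourceAt f p) (h2 : IsSinkAt f p) : False := by
  obtain ⟨v, hv⟩ := exists_ne (0 : Euc 2)
  linarith [h1.2 v hv, h2.2 v hv]

theorem rank_euc : 1 < Module.rank ℝ (Euc 2) := by
  rw [← Module.finrank_eq_rank]
  simp

theorem exists_saddle_closure (S : Sys φ f F) {p s0 : Euc 2} (hp : IsSourceAt f p)
    (hs0 : IsSaddleAt f s0) : ∃ q, IsSaddleAt f q ∧ q ∈ closure {x | BL F x p} := by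
  by_contra hc
  push Not at hc
  have hfr : ∀ z ∈ closure {x | BL F x p}, BL F z p ∨ IsSinkAt f z := by
    intro z hz
    rcases S.trichotomy z with h | ⟨b, hb, hbl⟩ | h
    · exact Or.inl (S.e_of_closure hp hz h)
    · refine absurd ?_ (hc b hb)
      refine isClosed_closure.mem_of_tendsto hbl (Eventually.of_forall fun t => ?_)
      exact (map_mem_closure (S.flow.cont_x t) hz fun w hw => S.bl_shift hw t)
    · exact Or.inr h
  have hfin : {z | IsSinkAt f z}.Finite := S.crit_finite.subset fun z hz => hz.1
  have hconn := (hfin.countable.isPathConnected_compl_of_one_lt_rank rank_euc).isConnected.isPreconnected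
  have hsub : {z | IsSinkAt f z}ᶜ ⊆ {x | BL F x p} := by
    refine hconn.subset_left_of_subset_union (S.e_open hp) isClosed_closure.isOpen_compl
      (disjoint_compl_right.mono_left subset_closure) ?_ ⟨p, fun h => source_not_sink hp h,
        S.bl_fixed hp.1⟩
    intro z hz
    by_cases h : z ∈ closure {x | BL F x p}
    · exact Or.inl ((hfr z h).resolve_right hz)
    · exact Or.inr h
  have : BL F s0 p := hsub (fun h => hs0.2.2 h)
  have := bl_unique this (S.bl_fixed hs0.1)
  exact hs0.2.1 (this ▸ hp)

end Sys

end

section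
open Set Metric Filter
set_option linter.unusedSimpArgs false
set_option linter.unusedVariables false
open scoped RealInnerProductSpace
open scoped Topology
open unitInterval

theorem exp_one_const {h : ℝ → ℂ} (hc : Continuous h) (h1 : ∀ t, Complex.exp (h t) = 1) (a b : ℝ) :
    h a = h b := by
  have := Complex.isCoveringMap_exp.eq_of_comp_eq (A := ℝ) (g₁ := h) (g₂ := fun _ => h b) hc
    continuous_const (by ext t; simp [h1]) b rfl
  exact congrFun this a

theorem linking_complex {α β : ℝ → ℂ} (hα : Continuous α) (hβ : Continuous β)
    (α0 : α 0 = 1) (α1 : α 1 = -1) (β0 : β 0 = Complex.I) (β1 : β 1 = -Complex.I)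
    (hne : ∀ s t, α s ≠ β t)
    (hα' : ∀ s, (α s + Complex.I) / (α s - Complex.I) ∈ Complex.slitPlane)
    (hβ' : ∀ t, (β t + 1) / (β t - 1) ∈ Complex.slitPlane) : False := by
  obtain ⟨g, hg, -⟩ := Complex.isCoveringMapOn_exp.existsUnique_continuousMap_lifts
    (A := ℝ × ℝ) ⟨fun p => α p.1 - β p.2, by fun_prop⟩ (a₀ := (0, 0))
    (Complex.exp_log (x := α 0 - β 0) (sub_ne_zero.2 (hne 0 0)))
    (fun p => by simpa using sub_ne_zero.2 (hne p.1 p.2))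
  have hgx : ∀ s t, Complex.exp (g (s, t)) = α s - β t := fun s t => congrFun hg.2 (s, t)
  have hgc : Continuous g := g.continuous
  have e1 := exp_one_const (h := fun t => g (1, t) - g (0, t) - Complex.log ((β t + 1) / (β t - 1)))
    (by
      refine (by fun_prop : Continuous fun t => g (1, t) - g (0, t)).sub (continuous_iff_continuousAt.2 fun t => ?_)
      refine ContinuousAt.clog (ContinuousAt.div (by fun_prop) (by fun_prop) ?_) (hβ' t)
      have := hne 0 t
      rw [α0] at this
      exact sub_ne_zero.2 this.symm)
    (by
      intro t
      have h0 := hne 0 t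
      have h1 := hne 1 t
      rw [α0] at h0
      rw [α1] at h1
      have hz := Complex.slitPlane_ne_zero (hβ' t)
      rw [Complex.exp_sub, Complex.exp_sub, hgx, hgx, Complex.exp_log hz, α0, α1]
      have a : (1:ℂ) - β t ≠ 0 := sub_ne_zero.2 h0
      have b : β t - 1 ≠ 0 := sub_ne_zero.2 h0.symm
      have c : β t + 1 ≠ 0 := by
        intro hh
        exact h1 (by linear_combination -hh)
      field_simp
      ring) 0 1
  have e2 := exp_one_const (h := fun t => g (t, 1) - g (t, 0) - Complex.log ((α t + Complex.I) / (α t - Complex.I)))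
    (by
      refine (by fun_prop : Continuous fun t => g (t, 1) - g (t, 0)).sub (continuous_iff_continuousAt.2 fun t => ?_)
      refine ContinuousAt.clog (ContinuousAt.div (by fun_prop) (by fun_prop) ?_) (hα' t)
      have := hne t 0
      rw [β0] at this
      exact sub_ne_zero.2 this)
    (by
      intro t
      have h0 := hne t 0
      have h1 := hne t 1
      rw [β0] at h0
      rw [β1] at h1
      have hz := Complex.slitPlane_ne_zero (hα' t)
      rw [Complex.exp_sub, Complex.exp_sub, hgx, hgx, Complex.exp_log hz, β0, β1]
      have a : α t - Complex.I ≠ 0 := sub_ne_zero.2 h0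
      have c : α t + Complex.I ≠ 0 := by
        intro hh
        exact h1 (by linear_combination hh)
      field_simp
      ring) 0 1
  have v1 : (Complex.I + 1) / (Complex.I - 1) = -Complex.I := by
    have : Complex.I - 1 ≠ 0 := by
      intro h; have := congrArg Complex.re h; simp at this
    field_simp
    ring_nf
    simp
    ring
  have v2 : (-Complex.I + 1) / (-Complex.I - 1) = Complex.I := by
    have : -Complex.I - 1 ≠ 0 := by
      intro h; have := congrArg Complex.re h; simp at this
    field_simp
    ring_nf
    simp
    ring
  have v3 : (1 + Complex.I) / (1 - Complex.I) = Complex.I := by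
    have : 1 - Complex.I ≠ 0 := by
      intro h; have := congrArg Complex.re h; simp at this
    field_simp
    ring_nf
    simp
    ring
  have v4 : (-1 + Complex.I) / (-1 - Complex.I) = -Complex.I := by
    have : -1 - Complex.I ≠ 0 := by
      intro h; have := congrArg Complex.re h; simp at this
    field_simp
    ring_nf
    simp
    ring
  simp only [α0, α1, β0, β1, v1, v2, v3, v4, Complex.log_I, Complex.log_neg_I] at e1 e2
  have : (Real.pi : ℂ) * Complex.I = 0 := by linear_combination (e1 - e2) / 2
  simp [Real.pi_ne_zero] at this

theorem slit_of {a b : ℂ} (hb : b ≠ 0) (hab : ∀ t : ℝ, 0 ≤ t → t ≤ 1 → (1 - t : ℝ) * a + t * b ≠ 0) :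
    a / b ∈ Complex.slitPlane := by
  rw [Complex.mem_slitPlane_iff_not_le_zero]
  intro hle
  obtain ⟨w, hw⟩ : ∃ w : ℝ, a / b = w := ⟨(a / b).re, by
    have := Complex.le_def.1 hle
    apply Complex.ext <;> simp [this.2]⟩
  have hw0 : w ≤ 0 := by
    rw [hw] at hle
    exact_mod_cast hle
  have ha : a = w * b := by rw [← hw]; field_simp
  have h1 : 0 < 1 - w := by linarith
  apply hab (-w / (1 - w)) (div_nonneg (by linarith) h1.le) (by rw [div_le_one h1]; linarith)
  rw [ha]
  have : (1 - (w:ℂ)) ≠ 0 := by exact_mod_cast h1.ne'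
  push_cast
  field_simp
  ring

/-- linking in the plane -/
theorem linking {e n q : Euc 2} (h : ON e n) {s : ℝ} (hs : 0 < s) {α β : ℝ → Euc 2}
    (hα : Continuous α) (hβ : Continuous β)
    (α0 : α 0 = q + s • e) (α1 : α 1 = q - s • e) (β0 : β 0 = q + s • n) (β1 : β 1 = q - s • n)
    (hne : ∀ s t, α s ≠ β t)
    (hα' : ∀ t : ℝ, ∀ u : ℝ, |u| ≤ s → α t ≠ q + u • n)
    (hβ' : ∀ t : ℝ, ∀ u : ℝ, |u| ≤ s → β t ≠ q + u • e) : False := by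
  set C : Euc 2 → ℂ := fun z => ((⟪e, z - q⟫ / s : ℝ) : ℂ) + ((⟪n, z - q⟫ / s : ℝ) : ℂ) * Complex.I with hC
  have hCc : Continuous C := by
    refine (Complex.continuous_ofReal.comp (by fun_prop)).add
      ((Complex.continuous_ofReal.comp (by fun_prop)).mul continuous_const)
  have hCinj : ∀ z w, C z = C w → z = w := by
    intro z w hzw
    have h1 := congrArg Complex.re hzw
    have h2 := congrArg Complex.im hzw
    simp only [hC, Complex.add_re, Complex.ofReal_re, Complex.mul_re, Complex.I_re, Complex.I_im,
      Complex.ofReal_im, Complex.add_im, Complex.mul_im] at h1 h2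
    have h1' : ⟪e, z - q⟫ = ⟪e, w - q⟫ := by field_simp at h1; linarith
    have h2' : ⟪n, z - q⟫ = ⟪n, w - q⟫ := by field_simp at h2; linarith
    have := h.expand (z - q)
    rw [h1', h2', ← h.expand (w - q)] at this
    exact sub_left_injective this
  have hCe : ∀ u : ℝ, C (q + u • e) = (u / s : ℝ) := by
    intro u
    simp [hC, inner_smul_right, h.ee, h.he, h.ne]
  have hCn : ∀ u : ℝ, C (q + u • n) = (u / s : ℝ) * Complex.I := by
    intro u
    simp [hC, inner_smul_right, h.nn, h.hn, h.hen]
  have hs' := hs.ne'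
  have hsC : (s : ℂ) ≠ 0 := by exact_mod_cast hs'
  refine linking_complex (α := C ∘ α) (β := C ∘ β) (hCc.comp hα) (hCc.comp hβ) ?_ ?_ ?_ ?_ ?_ ?_ ?_
  · rw [Function.comp, α0, hCe]; simp [hs']
  · rw [Function.comp, α1, sub_eq_add_neg, ← neg_smul, hCe]; simp [hs', neg_div]
  · rw [Function.comp, β0, hCn]; simp [hs']
  · rw [Function.comp, β1, sub_eq_add_neg, ← neg_smul, hCn]; simp [hs', neg_div]
  · intro a b hab
    exact hne a b (hCinj _ _ hab)
  · intro t
    apply slit_of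
    · intro h0
      refine hα' t s (by rw [abs_of_pos hs]) (hCinj _ _ ?_)
      rw [hCn]
      simp only [Function.comp] at h0
      rw [div_self hs']; simp
      linear_combination h0
    · intro u hu0 hu1 h0
      refine hα' t (-((1 - u) * s - u * s)) (by rw [abs_le]; constructor <;> nlinarith) (hCinj _ _ ?_)
      rw [hCn]
      simp only [Function.comp] at h0
      push_cast at h0 ⊢
      field_simp
      linear_combination h0
  · intro t
    apply slit_of
    · intro h0
      refine hβ' t s (by rw [abs_of_pos hs]) (hCinj _ _ ?_)
      rw [hCe]
      simp only [Function.comp] at h0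
      rw [div_self hs']; simp
      linear_combination h0
    · intro u hu0 hu1 h0
      refine hβ' t (-((1 - u) * s - u * s)) (by rw [abs_le]; constructor <;> nlinarith) (hCinj _ _ ?_)
      rw [hCe]
      simp only [Function.comp] at h0
      push_cast at h0 ⊢
      field_simp
      linear_combination h0

end

section
open Set Metric Filter
set_option linter.unusedSimpArgs false
set_option linter.unusedVariables false
open scoped RealInnerProductSpace
open scoped Topology

theorem exists_eigen {φ : Euc 2 → ℝ} {f : Euc 2 → Euc 2} (hP : Pot φ f) {q : Euc 2}
    (hq : IsSaddleAt f q) (hinj : Function.Injective (fderiv ℝ f q)) :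
    ∃ e n : Euc 2, ON e n ∧ ∃ l m : ℝ, l < 0 ∧ 0 < m ∧ fderiv ℝ f q e = l • e ∧
      fderiv ℝ f q n = m • n := by
  have hA : (fderiv ℝ f q).toLinearMap.IsSymmetric := by
    intro v w
    have := hP.symm q v w
    rw [real_inner_comm] at this ⊢
    simp only [ContinuousLinearMap.coe_coe]
    rw [this, real_inner_comm]
  set b := hA.eigenvectorBasis (n := 2) (by simp) with hb
  set ev := hA.eigenvalues (n := 2) (by simp) with hev
  have hap : ∀ i, fderiv ℝ f q (b i) = ev i • b i := fun i => hA.apply_eigenvectorBasis (by simp) i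
  have hon := b.orthonormal
  have hne : ∀ i, ev i ≠ 0 := by
    intro i h0
    have h1 := hap i
    rw [h0, zero_smul] at h1
    have : b i = 0 := hinj (by rw [h1, map_zero])
    have h2 := hon.1 i
    rw [this] at h2
    simp at h2
  have h01 : ON (b 0) (b 1) := ⟨hon.1 0, hon.1 1, hon.2 (by decide)⟩
  have hform : ∀ v, ⟪fderiv ℝ f q v, v⟫ = ev 0 * ⟪b 0, v⟫ ^ 2 + ev 1 * ⟪b 1, v⟫ ^ 2 := by
    intro v
    have : fderiv ℝ f q v = ⟪b 0, v⟫ • (ev 0 • b 0) + ⟪b 1, v⟫ • (ev 1 • b 1) := by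
      conv_lhs => rw [h01.expand v]
      rw [map_add, map_smul, map_smul, hap, hap]
    rw [this]
    simp only [inner_add_left, inner_smul_left, conj_trivial]
    ring
  have hvne : ∀ v : Euc 2, v ≠ 0 → 0 < ⟪b 0, v⟫ ^ 2 ∨ 0 < ⟪b 1, v⟫ ^ 2 := by
    intro v hv
    by_contra hc
    push Not at hc
    refine hv (h01.eq_zero ?_ ?_)
    · nlinarith [hc.1, sq_nonneg ⟪b 0, v⟫]
    · nlinarith [hc.2, sq_nonneg ⟪b 1, v⟫]
  rcases (hne 0).lt_or_gt with h0 | h0 <;> rcases (hne 1).lt_or_gt with h1 | h1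
  · exfalso
    refine hq.2.2 ⟨hq.1, fun v hv => ?_⟩
    rw [hform]
    rcases hvne v hv with h | h <;> nlinarith [sq_nonneg ⟪b 0, v⟫, sq_nonneg ⟪b 1, v⟫]
  · exact ⟨b 0, b 1, h01, _, _, h0, h1, hap 0, hap 1⟩
  · exact ⟨b 1, b 0, h01.symm, _, _, h1, h0, hap 1, hap 0⟩
  · exfalso
    refine hq.2.1 ⟨hq.1, fun v hv => ?_⟩
    rw [hform]
    rcases hvne v hv with h | h <;> nlinarith [sq_nonneg ⟪b 0, v⟫, sq_nonneg ⟪b 1, v⟫]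

theorem sadCoer_of_eigen {φ : Euc 2 → ℝ} {f : Euc 2 → Euc 2} (hP : Pot φ f) {q e n : Euc 2}
    (hq : f q = 0) (h : ON e n) {l m : ℝ} (hl : l < 0) (hm : 0 < m) (he : fderiv ℝ f q e = l • e)
    (hn : fderiv ℝ f q n = m • n) : SadCoer f e n q := by
  refine ⟨hq, ?_⟩
  set k := min (-l) m with hk
  have hk0 : 0 < k := lt_min (by linarith) hm
  refine ⟨k / 2, by linarith, ?_⟩
  have hlo := (hP.difff q).isLittleO.def (show 0 < k / 4 by linarith)
  filter_upwards [hlo] with z hz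
  rw [hq, sub_zero] at hz
  set v := z - q with hv
  set R := f z - fderiv ℝ f q v with hR
  have hfz : f z = ⟪e, v⟫ • (l • e) + ⟪n, v⟫ • (m • n) + R := by
    have : fderiv ℝ f q v = ⟪e, v⟫ • (l • e) + ⟪n, v⟫ • (m • n) := by
      conv_lhs => rw [h.expand v]
      rw [map_add, map_smul, map_smul, he, hn]
    rw [← this, hR]; abel
  have h1 : ⟪f z, e⟫ = l * ⟪e, v⟫ + ⟪R, e⟫ := by
    rw [hfz]
    simp only [inner_add_left, inner_smul_left, conj_trivial, h.ee, h.ne]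
    ring
  have h2 : ⟪f z, n⟫ = m * ⟪n, v⟫ + ⟪R, n⟫ := by
    rw [hfz]
    simp only [inner_add_left, inner_smul_left, conj_trivial, h.nn, h.hen]
    ring
  have bnd : ∀ w : Euc 2, ‖w‖ = 1 → |⟪R, w⟫ * ⟪w, v⟫| ≤ k / 4 * ‖v‖ ^ 2 := by
    intro w hw
    rw [abs_mul]
    have a1 := abs_real_inner_le_norm R w
    have a2 := abs_real_inner_le_norm w v
    rw [hw] at a1 a2
    calc |⟪R, w⟫| * |⟪w, v⟫| ≤ (k / 4 * ‖v‖) * ‖v‖ := by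
          gcongr
          · linarith
          · linarith
      _ = _ := by ring
  have b1 := abs_le.1 (bnd e h.he)
  have b2 := abs_le.1 (bnd n h.hn)
  rw [h1, h2]
  have hs := h.norm_sq v
  have hk1 : k ≤ -l := min_le_left _ _
  have hk2 : k ≤ m := min_le_right _ _
  have c1 : k * ⟪e, v⟫ ^ 2 ≤ -l * ⟪e, v⟫ ^ 2 := by gcongr
  have c2 : k * ⟪n, v⟫ ^ 2 ≤ m * ⟪n, v⟫ ^ 2 := by gcongr
  have c3 : k * ‖v‖ ^ 2 = k * ⟪e, v⟫ ^ 2 + k * ⟪n, v⟫ ^ 2 := by rw [hs]; ring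
  nlinarith [b1.1, b1.2, b2.1, b2.2]

/-- local data at a saddle -/
structure LocSad (φ : Euc 2 → ℝ) (f : Euc 2 → Euc 2) (F : ℝ → Euc 2 → Euc 2) (q e n : Euc 2) (r : ℝ) :
    Prop where
  on : ON e n
  rpos : 0 < r
  coer : ∃ κ > 0, ∀ z ∈ ball q r, κ * ‖z - q‖ ^ 2 ≤ -(⟪f z, e⟫ * ⟪e, z - q⟫) + ⟪f z, n⟫ * ⟪n, z - q⟫
  vert : ∀ z ∈ ball q r, 0 ≤ ⟪fderiv ℝ f z n, n⟫
  key : ∀ w ∈ ball q r, Sys.Reg φ f F w ∨ BL F w q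
  iso : ∀ z ∈ closedBall q r, f z = 0 → z = q

namespace LocSad
variable {φ : Euc 2 → ℝ} {f : Euc 2 → Euc 2} {F : ℝ → Euc 2 → Euc 2} {q e n : Euc 2} {r : ℝ}

theorem mono (h : LocSad φ f F q e n r) {r' : ℝ} (h0 : 0 < r') (hr : r' ≤ r) :
    LocSad φ f F q e n r' where
  on := h.on
  rpos := h0
  coer := by
    obtain ⟨κ, hκ, hc⟩ := h.coer
    exact ⟨κ, hκ, fun z hz => hc z (ball_subset_ball hr hz)⟩
  vert := fun z hz => h.vert z (ball_subset_ball hr hz)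
  key := fun z hz => h.key z (ball_subset_ball hr hz)
  iso := fun z hz => h.iso z (closedBall_subset_closedBall hr hz)

theorem flip (h : LocSad φ f F q e n r) : LocSad φ f F q (-e) n r where
  on := h.on.neg
  rpos := h.rpos
  coer := by simpa only [inner_neg_left, inner_neg_right, neg_mul_neg] using h.coer
  vert := h.vert
  key := h.key
  iso := h.iso

theorem axis (h : LocSad φ f F q e n r) (hP : Pot φ f) {s : ℝ} (hs0 : s ≠ 0) (hs : |s| < r) :
    φ (q + s • e) < φ q := by
  obtain ⟨κ, hκ, hc⟩ := h.coer
  have hanti : StrictAntiOn (fun t : ℝ => φ (q + t • (s • e))) (Icc 0 1) := by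
    apply strictAntiOn_of_deriv_neg (convex_Icc 0 1)
    · exact (hP.cont.comp (by fun_prop)).continuousOn
    · intro t ht
      rw [interior_Icc] at ht
      rw [(hP.line_deriv q (s • e) t).deriv]
      have hz : q + t • (s • e) ∈ ball q r := by
        rw [mem_ball, dist_eq_norm, add_sub_cancel_left, norm_smul, norm_smul, h.on.he, mul_one,
          Real.norm_of_nonneg ht.1.le, Real.norm_eq_abs]
        nlinarith [ht.1, ht.2, abs_nonneg s]
      have := hc _ hz
      simp only [add_sub_cancel_left, inner_smul_right, h.on.ee, h.on.ne, norm_smul, h.on.he] at this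
      rw [inner_smul_right]
      simp only [mul_one, mul_zero, add_zero, Real.norm_eq_abs, mul_pow, sq_abs] at this
      have hs2 : 0 < s ^ 2 := by positivity
      have ht0 := ht.1
      have h3 : 0 < κ * (t ^ 2 * s ^ 2) := by positivity
      by_contra hcon
      push Not at hcon
      nlinarith [mul_nonneg ht0.le hcon]
  have := hanti (left_mem_Icc.2 zero_le_one) (right_mem_Icc.2 zero_le_one) zero_lt_one
  simpa using this

theorem axis_n (h : LocSad φ f F q e n r) (hP : Pot φ f) {s : ℝ} (hs : |s| < r) :
    φ q ≤ φ (q + s • n) := by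
  obtain ⟨κ, hκ, hc⟩ := h.coer
  have hmono : MonotoneOn (fun t : ℝ => φ (q + t • (s • n))) (Icc 0 1) := by
    apply monotoneOn_of_deriv_nonneg (convex_Icc 0 1)
    · exact (hP.cont.comp (by fun_prop)).continuousOn
    · exact fun t _ => (hP.line_deriv q (s • n) t).differentiableAt.differentiableWithinAt
    · intro t ht
      rw [interior_Icc] at ht
      rw [(hP.line_deriv q (s • n) t).deriv]
      have hz : q + t • (s • n) ∈ ball q r := by
        rw [mem_ball, dist_eq_norm, add_sub_cancel_left, norm_smul, norm_smul, h.on.hn, mul_one,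
          Real.norm_of_nonneg ht.1.le, Real.norm_eq_abs]
        nlinarith [ht.1, ht.2, abs_nonneg s]
      have := hc _ hz
      simp only [add_sub_cancel_left, inner_smul_right, h.on.nn, h.on.hen, norm_smul, h.on.hn] at this
      rw [inner_smul_right]
      simp only [mul_one, mul_zero, add_zero, Real.norm_eq_abs, mul_pow, sq_abs, neg_zero, zero_add] at this
      have ht0 := ht.1
      have h3 : 0 ≤ κ * (t ^ 2 * s ^ 2) := by positivity
      by_contra hcon
      push Not at hcon
      nlinarith [mul_pos_of_neg_of_neg hcon (neg_neg_of_pos ht0)]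
  have := hmono (left_mem_Icc.2 zero_le_one) (right_mem_Icc.2 zero_le_one) zero_le_one
  simpa using this

theorem low_reg (h : LocSad φ f F q e n r) (S : Sys φ f F) {w : Euc 2} (hw : w ∈ ball q r)
    (hlt : φ w < φ q) : Sys.Reg φ f F w := by
  rcases h.key w hw with h1 | h1
  · exact h1
  · have := S.bl_le h1 0
    rw [S.flow.zero] at this
    linarith

theorem mem_ball_axis (h : LocSad φ f F q e n r) {s : ℝ} (hs : |s| < r) : q + s • e ∈ ball q r := by
  rw [mem_ball, dist_eq_norm, add_sub_cancel_left, norm_smul, h.on.he, mul_one]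
  exact hs

/-- the half axis is in one class -/
theorem side_e (h : LocSad φ f F q e n r) (S : Sys φ f F) {p : Euc 2} (hp : IsSourceAt f p) {s0 : ℝ}
    (hs0 : s0 ∈ Ioo 0 r) (h0 : BL F (q + s0 • e) p) : ∀ s ∈ Ioo 0 r, BL F (q + s • e) p := by
  have hconn : IsPreconnected ((fun s : ℝ => q + s • e) '' Ioo 0 r) :=
    isPreconnected_Ioo.image _ (by fun_prop)
  have hr : ∀ z ∈ (fun s : ℝ => q + s • e) '' Ioo 0 r, Sys.Reg φ f F z := by
    rintro _ ⟨s, hs, rfl⟩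
    have habs : |s| < r := by rw [abs_of_pos hs.1]; exact hs.2
    exact h.low_reg S (h.mem_ball_axis habs) (h.axis S.pot hs.1.ne' habs)
  intro s hs
  exact S.reg_conn_e hconn hr hp ⟨s0, hs0, rfl⟩ h0 _ ⟨s, hs, rfl⟩

theorem side_low (h : LocSad φ f F q e n r) (S : Sys φ f F) {s0 : ℝ}
    (hs0 : s0 ∈ Ioo 0 r) (h0 : Sys.Low φ F (q + s0 • e)) : ∀ s ∈ Ioo 0 r, Sys.Low φ F (q + s • e) := by
  have hconn : IsPreconnected ((fun s : ℝ => q + s • e) '' Ioo 0 r) :=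
    isPreconnected_Ioo.image _ (by fun_prop)
  have hr : ∀ z ∈ (fun s : ℝ => q + s • e) '' Ioo 0 r, Sys.Reg φ f F z := by
    rintro _ ⟨s, hs, rfl⟩
    have habs : |s| < r := by rw [abs_of_pos hs.1]; exact hs.2
    exact h.low_reg S (h.mem_ball_axis habs) (h.axis S.pot hs.1.ne' habs)
  intro s hs
  exact S.reg_conn_low hconn hr ⟨s0, hs0, rfl⟩ h0 _ ⟨s, hs, rfl⟩

theorem side_class (h : LocSad φ f F q e n r) (S : Sys φ f F) :
    (∀ s ∈ Ioo 0 r, Sys.Low φ F (q + s • e)) ∨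
      ∃ p, IsSourceAt f p ∧ ∀ s ∈ Ioo 0 r, BL F (q + s • e) p := by
  have hr := h.rpos
  have hs0 : r / 2 ∈ Ioo 0 r := ⟨by linarith, by linarith⟩
  have habs : |r / 2| < r := by rw [abs_of_pos hs0.1]; exact hs0.2
  rcases h.low_reg S (h.mem_ball_axis habs) (h.axis S.pot hs0.1.ne' habs) with h1 | ⟨p, hp, h1⟩
  · exact Or.inl (h.side_low S hs0 h1)
  · exact Or.inr ⟨p, hp, h.side_e S hp hs0 h1⟩

theorem side (h : LocSad φ f F q e n r) (S : Sys φ f F) {p y : Euc 2} (hp : IsSourceAt f p)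
    (hy : y ∈ ball q r) (hlt : φ y < φ q) (hbl : BL F y p) :
    (∀ s ∈ Ioo 0 r, BL F (q + s • e) p) ∨ (∀ s ∈ Ioo 0 r, BL F (q + s • (-e)) p) := by
  set u := ⟪e, y - q⟫ with hu
  set v := ⟪n, y - q⟫ with hv
  have hyq : y = q + u • e + v • n := by
    have := h.on.expand (y - q)
    rw [add_assoc, ← this]; abel
  have hyn : ‖y - q‖ < r := by rw [← dist_eq_norm]; exact hy
  have hua : |u| < r := by
    refine lt_of_le_of_lt ?_ hyn
    have := abs_real_inner_le_norm e (y - q)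
    rwa [h.on.he, one_mul] at this
  have hva : |v| < r := by
    refine lt_of_le_of_lt ?_ hyn
    have := abs_real_inner_le_norm n (y - q)
    rwa [h.on.hn, one_mul] at this
  have hu0 : u ≠ 0 := by
    intro h0
    have := h.axis_n S.pot hva
    rw [hyq, h0, zero_smul, add_zero] at hlt
    linarith
  have hax := h.axis S.pot hu0 hua
  have hseg : ∀ t ∈ Icc (0:ℝ) 1, q + u • e + t • (v • n) ∈ ball q r := by
    intro t ht
    have hc := (convex_ball q r) (h.mem_ball_axis hua) hy (sub_nonneg.2 ht.2) ht.1 (by ring)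
    convert hc using 1
    conv_rhs => rw [hyq]
    module
  have hconv : ConvexOn ℝ (Icc 0 1) (fun t : ℝ => φ (q + u • e + t • (v • n))) := by
    apply convexOn_of_hasDerivWithinAt2_nonneg (convex_Icc 0 1)
      (f' := fun t => ⟪f (q + u • e + t • (v • n)), v • n⟫)
      (f'' := fun t => ⟪fderiv ℝ f (q + u • e + t • (v • n)) (v • n), v • n⟫)
    · exact (S.pot.cont.comp (by fun_prop)).continuousOn
    · intro t ht
      exact (S.pot.line_deriv _ _ t).hasDerivWithinAt
    · intro t ht
      have h1 : HasDerivAt (fun t : ℝ => q + u • e + t • (v • n)) (v • n) t := by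
        have := ((hasDerivAt_id t).smul_const (v • n)).const_add (q + u • e)
        simpa using this
      have h2 := (S.pot.difff (q + u • e + t • (v • n))).comp_hasDerivAt t h1
      have h3 := h2.inner ℝ (hasDerivAt_const t (v • n))
      simp only [inner_zero_right, zero_add] at h3
      exact h3.hasDerivWithinAt
    · intro t ht
      rw [interior_Icc] at ht
      rw [map_smul, inner_smul_left, inner_smul_right]
      have := h.vert _ (hseg t ⟨ht.1.le, ht.2.le⟩)
      simp only [conj_trivial]
      rw [← mul_assoc]
      exact mul_nonneg (mul_self_nonneg v) this
  have hle : ∀ t ∈ Icc (0:ℝ) 1, φ (q + u • e + t • (v • n)) < φ q := by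
    intro t ht
    have h1 := hconv.le_max_of_mem_Icc (left_mem_Icc.2 zero_le_one) (right_mem_Icc.2 zero_le_one) ht
    refine h1.trans_lt (max_lt ?_ ?_)
    · simpa using hax
    · simpa [← hyq] using hlt
  have hconn : IsPreconnected ((fun t : ℝ => q + u • e + t • (v • n)) '' Icc 0 1) :=
    isPreconnected_Icc.image _ (by fun_prop)
  have hfin : BL F (q + u • e) p := by
    refine S.reg_conn_e hconn ?_ hp (x := y) ⟨1, right_mem_Icc.2 zero_le_one, ?_⟩ hbl _
      ⟨0, left_mem_Icc.2 zero_le_one, ?_⟩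
    · rintro _ ⟨t, ht, rfl⟩
      exact h.low_reg S (hseg t ht) (hle t ht)
    · simp [← hyq]
    · simp
  rcases hu0.lt_or_gt with h1 | h1
  · right
    refine h.flip.side_e S hp (s0 := -u) ⟨by linarith, ?_⟩ (by simpa using hfin)
    rw [← abs_of_neg h1]; exact hua
  · left
    refine h.side_e S hp (s0 := u) ⟨h1, ?_⟩ hfin
    rw [← abs_of_pos h1]; exact hua

end LocSad

theorem exists_locSad {φ : Euc 2 → ℝ} {f : Euc 2 → Euc 2} {F : ℝ → Euc 2 → Euc 2} (S : Sys φ f F)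
    {q : Euc 2} (hq : IsSaddleAt f q) : ∃ e n r, LocSad φ f F q e n r ∧
      LocSad (fun x => - φ x) (fun x => - f x) (fun t x => F (-t) x) q n e r := by
  obtain ⟨e, n, hon, l, m, hl, hm, he, hn⟩ := exists_eigen S.pot hq (S.nondeg q hq.1).1
  obtain ⟨-, κ, hκ, hco⟩ := sadCoer_of_eigen S.pot hq.1 hon hl hm he hn
  obtain ⟨r1, hr1, hco⟩ := Metric.eventually_nhds_iff_ball.1 hco
  obtain ⟨r2, hr2, hiso⟩ := S.isolated_ball hq.1
  obtain ⟨r3, hr3, hk⟩ := S.key hq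
  obtain ⟨r4, hr4, hk'⟩ := S.neg.key (saddle_neg.2 hq)
  have hcn : Continuous fun z => ⟪fderiv ℝ f z n, n⟫ := by
    have := S.pot.cont_fderiv
    fun_prop
  have hce : Continuous fun z => ⟪fderiv ℝ f z e, e⟫ := by
    have := S.pot.cont_fderiv
    fun_prop
  have e1 : ∀ᶠ z in 𝓝 q, 0 < ⟪fderiv ℝ f z n, n⟫ := by
    refine hcn.continuousAt.eventually_const_lt ?_
    show 0 < ⟪fderiv ℝ f q n, n⟫
    rw [hn, inner_smul_left, hon.nn]; simpa using hm
  have e2 : ∀ᶠ z in 𝓝 q, ⟪fderiv ℝ f z e, e⟫ < 0 := by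
    refine hce.continuousAt.eventually_lt_const ?_
    show ⟪fderiv ℝ f q e, e⟫ < 0
    rw [he, inner_smul_left, hon.ee]; simpa using hl
  obtain ⟨r5, hr5, he5⟩ := Metric.eventually_nhds_iff_ball.1 (e1.and e2)
  refine ⟨e, n, min r1 (min r2 (min r3 (min r4 r5))), ?_, ?_⟩
  · refine ⟨hon, by positivity, ⟨κ, hκ, fun z hz => hco z ?_⟩, fun z hz => ((he5 z ?_).1).le,
      fun z hz => hk z ?_, fun z hz => hiso z ?_⟩
    · exact ball_subset_ball (min_le_left _ _) hz
    · exact ball_subset_ball (by simp) hz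
    · exact ball_subset_ball (by simp) hz
    · exact closedBall_subset_closedBall (by simp) hz
  · refine ⟨hon.symm, by positivity, ⟨κ, hκ, fun z hz => ?_⟩, fun z hz => ?_,
      fun z hz => hk' z ?_, fun z hz h0 => hiso z ?_ (by simpa using h0)⟩
    · have := hco z (ball_subset_ball (min_le_left _ _) hz)
      simp only [inner_neg_left]
      linarith
    · have := (he5 z (ball_subset_ball (by simp) hz)).2
      rw [fderiv_neg_fun]
      simp only [ContinuousLinearMap.neg_apply, inner_neg_left]
      linarith
    · exact ball_subset_ball (by simp) hz
    · exact closedBall_subset_closedBall (by simp) hz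

end

section
open Set Metric Filter
set_option linter.unusedSimpArgs false
set_option linter.unusedVariables false
open scoped RealInnerProductSpace
open scoped Topology

/-- the configuration in which a cancellation is possible -/
def HC (φ : Euc 2 → ℝ) (f : Euc 2 → Euc 2) (F : ℝ → Euc 2 → Euc 2) : Prop :=
  ∃ (q p e n : Euc 2) (r : ℝ), IsSaddleAt f q ∧ IsSourceAt f p ∧ LocSad φ f F q e n r ∧
    (∀ s ∈ Ioo 0 r, BL F (q + s • (-e)) p) ∧
    ((∀ s ∈ Ioo 0 r, Sys.Low φ F (q + s • e)) ∨
      ∃ p', IsSourceAt f p' ∧ φ p' < φ p ∧ ∀ s ∈ Ioo 0 r, BL F (q + s • e) p')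

theorem joined_seg {A : Set (Euc 2)} {a b : Euc 2} (h : ∀ t ∈ Icc (0:ℝ) 1, a + t • (b - a) ∈ A) :
    JoinedIn A a b := by
  refine JoinedIn.ofLine (f := fun t : ℝ => a + t • (b - a)) (by fun_prop) (by simp) (by simp) ?_
  rintro _ ⟨t, ht, rfl⟩
  exact h t ht

theorem joined_outside {ρ : ℝ} (hρ : 0 ≤ ρ) {a b : Euc 2} (ha : ρ < ‖a‖) (hb : ρ < ‖b‖) :
    JoinedIn (closedBall (0 : Euc 2) ρ)ᶜ a b := by
  set R := max ‖a‖ ‖b‖ with hR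
  have hRp : ρ < R := lt_of_lt_of_le ha (le_max_left _ _)
  have key : ∀ a : Euc 2, ρ < ‖a‖ → ‖a‖ ≤ R →
      JoinedIn (closedBall (0 : Euc 2) ρ)ᶜ a ((R / ‖a‖) • a) ∧ (R / ‖a‖) • a ∈ sphere (0 : Euc 2) R := by
    intro a ha haR
    have h0 : 0 < ‖a‖ := by linarith
    constructor
    · apply joined_seg
      intro t ht
      have : a + t • ((R / ‖a‖) • a - a) = (1 + t * (R / ‖a‖ - 1)) • a := by module
      rw [this]
      have h1 : 1 ≤ R / ‖a‖ := by rw [le_div_iff₀ h0]; linarith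
      have h2 : 0 ≤ t * (R / ‖a‖ - 1) := mul_nonneg ht.1 (by linarith)
      simp only [mem_compl_iff, mem_closedBall, dist_zero_right, norm_smul, not_le]
      rw [Real.norm_of_nonneg (by linarith)]
      nlinarith
    · rw [mem_sphere_zero_iff_norm, norm_smul, Real.norm_of_nonneg (by positivity)]
      field_simp
  obtain ⟨a1, a2⟩ := key a ha (le_max_left _ _)
  obtain ⟨b1, b2⟩ := key b hb (le_max_right _ _)
  have hs := (isPathConnected_sphere Sys.rank_euc (0 : Euc 2) (r := R) (by linarith)).joinedIn _ a2 _ b2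
  refine (a1.trans (hs.mono ?_)).trans b1.symm
  intro z hz
  rw [mem_sphere_zero_iff_norm] at hz
  simp [hz, hRp]

namespace Sys
variable {φ : Euc 2 → ℝ} {f : Euc 2 → Euc 2} {F : ℝ → Euc 2 → Euc 2}

theorem joined_orbit (S : Sys φ f F) {a : Euc 2} {c t : ℝ} (ha : φ a < c) (ht : t ≤ 0) :
    JoinedIn {z | φ z < c} a (F t a) := by
  refine JoinedIn.ofLine (f := fun s : ℝ => F (s * t) a) ?_ (by simp [S.flow.zero]) (by simp) ?_
  · exact ((S.flow.cont_t a).comp (by fun_prop)).continuousOn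
  · rintro _ ⟨s, hs, rfl⟩
    have := S.flow.phi_mono S.pot a (show s * t ≤ 0 from mul_nonpos_of_nonneg_of_nonpos hs.1 ht)
    simp only [S.flow.zero] at this
    exact lt_of_le_of_lt this ha

theorem joined_src (S : Sys φ f F) {a p : Euc 2} {c : ℝ} (ha : φ a < c) (hb : BL F a p) :
    JoinedIn {z | φ z < c} a p := by
  have hp : φ p < c := by
    have := S.bl_le hb 0
    rw [S.flow.zero] at this
    linarith
  obtain ⟨ε, hε, hball⟩ := Metric.eventually_nhds_iff_ball.1
    (S.pot.cont.continuousAt.eventually_lt_const hp)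
  obtain ⟨t, h1, h2⟩ := ((hb.eventually (ball_mem_nhds p hε)).and (eventually_le_atBot 0)).exists
  refine (S.joined_orbit ha h2).trans ?_
  refine JoinedIn.mono (((convex_ball p ε).isPathConnected ⟨p, mem_ball_self hε⟩).joinedIn _ h1 _
    (mem_ball_self hε)) ?_
  intro z hz
  exact hball z hz

theorem joined_low (S : Sys φ f F) {a b : Euc 2} {c ρ : ℝ} (hρ : 0 ≤ ρ) (ha : φ a < c) (hb : φ b < c)
    (hla : Low φ F a) (hlb : Low φ F b) : JoinedIn ({z | φ z < c} ∪ (closedBall 0 ρ)ᶜ) a b := by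
  obtain ⟨m, hm⟩ := (isCompact_closedBall (0 : Euc 2) ρ).bddBelow_image S.pot.cont.continuousOn
  have key : ∀ a, φ a < c → Low φ F a → ∃ a', JoinedIn ({z | φ z < c} ∪ (closedBall 0 ρ)ᶜ) a a' ∧
      ρ < ‖a'‖ := by
    intro a ha hl
    obtain ⟨t, ht, h1⟩ := hl m
    refine ⟨F t a, (S.joined_orbit ha ht).mono subset_union_left, ?_⟩
    by_contra hc
    push Not at hc
    have := hm ⟨F t a, by simpa using hc, rfl⟩
    linarith
  obtain ⟨a', a1, a2⟩ := key a ha hla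
  obtain ⟨b', b1, b2⟩ := key b hb hlb
  exact (a1.trans ((joined_outside hρ a2 b2).mono subset_union_right)).trans b1.symm

theorem hc_or_same (S : Sys φ f F) {q e n : Euc 2} {r : ℝ} (hq : IsSaddleAt f q)
    (h : LocSad φ f F q e n r) : HC φ f F ∨
      (Low φ F (q + (r / 2) • e) ∧ Low φ F (q + (r / 2) • (-e))) ∨
      ∃ p, BL F (q + (r / 2) • e) p ∧ BL F (q + (r / 2) • (-e)) p := by
  have hr := h.rpos
  have hs0 : r / 2 ∈ Ioo 0 r := ⟨by linarith, by linarith⟩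
  rcases h.side_class S with h1 | ⟨p1, hp1, h1⟩ <;> rcases h.flip.side_class S with h2 | ⟨p2, hp2, h2⟩
  · exact Or.inr (Or.inl ⟨h1 _ hs0, h2 _ hs0⟩)
  · exact Or.inl ⟨q, p2, e, n, r, hq, hp2, h, h2, Or.inl h1⟩
  · exact Or.inl ⟨q, p1, -e, n, r, hq, hp1, h.flip, by simpa using h1, Or.inl h2⟩
  · rcases lt_trichotomy (φ p1) (φ p2) with h3 | h3 | h3
    · exact Or.inl ⟨q, p2, e, n, r, hq, hp2, h, h2, Or.inr ⟨p1, hp1, h3, h1⟩⟩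
    · have := S.inj _ _ hp1.1 hp2.1 h3
      subst this
      exact Or.inr (Or.inr ⟨p1, h1 _ hs0, h2 _ hs0⟩)
    · exact Or.inl ⟨q, p1, -e, n, r, hq, hp1, h.flip, by simpa using h1, Or.inr ⟨p2, hp2, h3, h2⟩⟩

theorem hc (S : Sys φ f F) {p s0 : Euc 2} (hp : IsSourceAt f p) (hs0 : IsSaddleAt f s0) :
    HC φ f F ∨ HC (fun x => - φ x) (fun x => - f x) (fun t x => F (-t) x) := by
  obtain ⟨q, hq, hcl⟩ := S.exists_saddle_closure hp hs0
  obtain ⟨e, n, r, h, h'⟩ := exists_locSad S hq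
  have hr := h.rpos
  have hs0 : r / 2 ∈ Ioo 0 r := ⟨by linarith, by linarith⟩
  have habs : |r / 2| < r := by rw [abs_of_pos hs0.1]; exact hs0.2
  obtain ⟨y, hy1, hy2, hy3⟩ := S.e_exit hs0.1 hp hq
    (fun z hz => h.iso z (closedBall_subset_closedBall (by linarith) hz)) hcl
  have hside := h.side S hp (by rw [mem_ball, hy1]; linarith) hy2 hy3
  rcases S.hc_or_same hq h with h1 | h1
  · exact Or.inl h1
  right
  have h1 : ∃ p, BL F (q + (r / 2) • e) p ∧ BL F (q + (r / 2) • (-e)) p := by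
    rcases h1 with h1 | h1
    · exfalso
      rcases hside with h2 | h2
      · exact S.not_low_of_bl (h2 _ hs0) h1.1
      · exact S.not_low_of_bl (h2 _ hs0) h1.2
    · exact h1
  rcases S.neg.hc_or_same (saddle_neg.2 hq) h' with h2 | h2
  · exact h2
  exfalso
  obtain ⟨p1, h1a, h1b⟩ := h1
  have hα := (S.joined_src (h.axis S.pot hs0.1.ne' habs) h1a).trans
    (S.joined_src (h.flip.axis S.pot hs0.1.ne' habs) h1b).symm
  obtain ⟨α, hα⟩ := hα
  obtain ⟨ρ1, hρ1⟩ := (isCompact_range α.continuous).isBounded.subset_closedBall 0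
  set ρ := max 0 (max ρ1 (‖q‖ + r)) with hρ
  have hβ : JoinedIn ({z | - φ z < - φ q} ∪ (closedBall 0 ρ)ᶜ) (q + (r / 2) • n) (q + (r / 2) • (-n)) := by
    have a1 := h'.axis S.neg.pot hs0.1.ne' habs
    have a2 := h'.flip.axis S.neg.pot hs0.1.ne' habs
    rcases h2 with ⟨h2, h3⟩ | ⟨p2, h2, h3⟩
    · exact S.neg.joined_low (le_max_left _ _) a1 a2 h2 h3
    · exact ((S.neg.joined_src a1 h2).trans (S.neg.joined_src a2 h3).symm).mono subset_union_left
  obtain ⟨β, hβ⟩ := hβ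
  have hα1 : ∀ t, φ (α.extend t) < φ q ∧ ‖α.extend t‖ ≤ ρ := by
    intro t
    show φ (α (projIcc 0 1 zero_le_one t)) < φ q ∧ ‖α (projIcc 0 1 zero_le_one t)‖ ≤ ρ
    refine ⟨hα _, ?_⟩
    have := hρ1 (mem_range_self (projIcc 0 1 zero_le_one t))
    rw [mem_closedBall_zero_iff] at this
    exact this.trans ((le_max_left _ _).trans (le_max_right _ _))
  have hβ1 : ∀ t, φ q < φ (β.extend t) ∨ ρ < ‖β.extend t‖ := by
    intro t
    show φ q < φ (β (projIcc 0 1 zero_le_one t)) ∨ ρ < ‖β (projIcc 0 1 zero_le_one t)‖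
    rcases hβ (projIcc 0 1 zero_le_one t) with h3 | h3
    · left; rw [mem_ofPred_eq] at h3; linarith
    · right; simpa using h3
  refine linking (q := q) h.on hs0.1 α.continuous_extend β.continuous_extend (by simp) (by simp [sub_eq_add_neg])
    (by simp) (by simp [sub_eq_add_neg]) ?_ ?_ ?_
  · intro s t heq
    have h3 := hα1 s
    rw [heq] at h3
    rcases hβ1 t with h4 | h4
    · linarith [h3.1]
    · linarith [h3.2]
  · intro t u hu heq
    have h3 := (hα1 t).1
    rw [heq] at h3
    have := h.axis_n S.pot (s := u) (by linarith)
    linarith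
  · intro t u hu heq
    have h3 := hβ1 t
    rw [heq] at h3
    rcases h3 with h3 | h3
    · have := h'.axis_n S.neg.pot (s := u) (by linarith)
      linarith
    · have h4 : ‖q + u • e‖ ≤ ‖q‖ + r := by
        refine (norm_add_le _ _).trans ?_
        rw [norm_smul, h.on.he, mul_one, Real.norm_eq_abs]
        linarith
      have : ‖q‖ + r ≤ ρ := (le_max_right _ _).trans (le_max_right _ _)
      linarith

end Sys

end

section
open Set Metric Filter
set_option linter.unusedSimpArgs false
set_option linter.unusedVariables false
open scoped RealInnerProductSpace
open scoped Topology

theorem FlowOf.incr {f : Euc 2 → Euc 2} {F : ℝ → Euc 2 → Euc 2} (hF : FlowOf f F) {y v : Euc 2}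
    {a b : ℝ} (hab : a < b) (h : ∀ τ ∈ Icc a b, 0 < ⟪f (F τ y), v⟫) : 0 < ⟪F b y - F a y, v⟫ := by
  have hd : ∀ τ, HasDerivAt (fun t => ⟪F t y, v⟫) ⟪nf f (F τ y), v⟫ τ := by
    intro τ
    have := (hF.deriv y τ).inner ℝ (hasDerivAt_const τ v)
    simpa using this
  have hm : StrictMonoOn (fun t => ⟪F t y, v⟫) (Icc a b) := by
    apply strictMonoOn_of_deriv_pos (convex_Icc a b)
    · exact fun τ _ => (hd τ).continuousAt.continuousWithinAt
    · intro τ hτ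
      rw [interior_Icc] at hτ
      rw [(hd τ).deriv, nf, inner_smul_left]
      exact mul_pos (by simp; positivity) (h τ (Ioo_subset_Icc_self hτ))
  have := hm (left_mem_Icc.2 hab.le) (right_mem_Icc.2 hab.le) hab
  rw [inner_sub_left]
  simp only at this
  linarith

theorem polygon {f : Euc 2 → Euc 2} {F : ℝ → Euc 2 → Euc 2} (hF : FlowOf f F) {y : Euc 2}
    (hy : f y ≠ 0) {T : ℝ} (hT : 0 < T) {N : Set (Euc 2)} (hN : IsOpen N)
    (hNy : ∀ t ∈ Icc (-T) 0, F t y ∈ N) {ws we : Euc 2} (hws : 0 < ⟪f (F (-T) y), ws⟫)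
    (hwe : 0 < ⟪f y, we⟫) :
    ∃ n ≥ 1, ∃ x : ℕ → Euc 2, x 0 = F (-T) y ∧ x n = y ∧
      (∀ i < n, ∀ t ∈ Icc (0:ℝ) 1, x i + t • (x (i+1) - x i) ∈ N ∧
        0 < ⟪f (x i + t • (x (i+1) - x i)), x (i+1) - x i⟫) ∧
      (∀ i, i + 1 < n → 0 < ⟪x (i+1) - x i, x (i+2) - x (i+1)⟫) ∧
      0 < ⟪x 1 - x 0, ws⟫ ∧ 0 < ⟪x n - x (n-1), we⟫ := by
  have hfc : Continuous f := hF.cd.continuous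
  have hloc : ∀ t : Icc (-T) 0, ∃ ρ > 0, ball (F t y) ρ ⊆ N ∧
      ∀ z ∈ ball (F t y) ρ, ∀ z' ∈ ball (F t y) ρ, 0 < ⟪f z, f z'⟫ := by
    intro t
    have hne : f (F t y) ≠ 0 := hF.ne_zero hy t
    have h1 : ∀ᶠ w : Euc 2 × Euc 2 in 𝓝 (F t y, F t y), 0 < ⟪f w.1, f w.2⟫ := by
      have hc : Continuous fun w : Euc 2 × Euc 2 => ⟪f w.1, f w.2⟫ := by fun_prop
      refine hc.continuousAt.eventually_const_lt ?_
      simp only [real_inner_self_eq_norm_sq]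
      positivity
    obtain ⟨ρ1, hρ1, h1⟩ := Metric.eventually_nhds_iff_ball.1 h1
    obtain ⟨ρ2, hρ2, h2⟩ := Metric.isOpen_iff.1 hN _ (hNy t t.2)
    refine ⟨min ρ1 ρ2, lt_min hρ1 hρ2, (ball_subset_ball (min_le_right _ _)).trans h2, ?_⟩
    intro z hz z' hz'
    apply h1 (z, z')
    rw [← ball_prod_same]
    exact ⟨ball_subset_ball (min_le_left _ _) hz, ball_subset_ball (min_le_left _ _) hz'⟩
  choose ρ hρ hρN hρf using hloc
  obtain ⟨δ, hδ, hcov⟩ := lebesgue_number_lemma_of_metric (isCompact_Icc (a := -T) (b := 0))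
    (c := fun t : Icc (-T) 0 => (fun τ => F τ y) ⁻¹' ball (F t y) (ρ t))
    (fun t => isOpen_ball.preimage (hF.cont_t y))
    (fun t ht => mem_iUnion.2 ⟨⟨t, ht⟩, mem_ball_self (hρ _)⟩)
  have hs : ∀ᶠ τ in 𝓝 (-T), 0 < ⟪f (F τ y), ws⟫ := by
    have hc : Continuous fun τ => ⟪f (F τ y), ws⟫ := by
      exact (hfc.comp (hF.cont_t y)).inner continuous_const
    exact hc.continuousAt.eventually_const_lt hws
  have he : ∀ᶠ τ in 𝓝 (0:ℝ), 0 < ⟪f (F τ y), we⟫ := by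
    have hc : Continuous fun τ => ⟪f (F τ y), we⟫ := by
      exact (hfc.comp (hF.cont_t y)).inner continuous_const
    refine hc.continuousAt.eventually_const_lt ?_
    simpa [hF.zero] using hwe
  obtain ⟨δ1, hδ1, hs⟩ := Metric.eventually_nhds_iff_ball.1 hs
  obtain ⟨δ2, hδ2, he⟩ := Metric.eventually_nhds_iff_ball.1 he
  set μ := min (δ / 2) (min δ1 δ2) with hμ
  have hμ0 : 0 < μ := by positivity
  obtain ⟨n, hn⟩ := exists_nat_gt (T / μ)
  have hn0 : (0:ℝ) < n := lt_trans (by positivity) hn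
  have hn1 : 1 ≤ n := by exact_mod_cast hn0
  set h := T / n with hh
  have hh0 : 0 < h := by positivity
  have hhμ : h < μ := by rw [hh, div_lt_iff₀ hn0]; rw [div_lt_iff₀ hμ0] at hn; linarith
  have hnh : n * h = T := by rw [hh]; field_simp
  have hd1 : h < δ / 2 := lt_of_lt_of_le hhμ (min_le_left _ _)
  have hd2 : h < δ1 := lt_of_lt_of_le hhμ ((min_le_right _ _).trans (min_le_left _ _))
  have hd3 : h < δ2 := lt_of_lt_of_le hhμ ((min_le_right _ _).trans (min_le_right _ _))
  set τ : ℕ → ℝ := fun i => -T + i * h with hτ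
  have hτs : ∀ i, τ (i+1) = τ i + h := by intro i; simp only [hτ]; push_cast; ring
  have hτI : ∀ i ≤ n, τ i ∈ Icc (-T) 0 := by
    intro i hi
    have : (i:ℝ) * h ≤ n * h := by gcongr
    have h2 : 0 ≤ (i:ℝ) * h := by positivity
    simp only [hτ]
    constructor <;> linarith
  have hgood : ∀ i ≤ n, ∃ t : Icc (-T) 0, ∀ u, τ i ≤ u → u ≤ τ i + 2 * h → F u y ∈ ball (F t y) (ρ t) := by
    intro i hi
    obtain ⟨t, ht⟩ := hcov (τ i) (hτI i hi)
    refine ⟨t, fun u h1 h2 => ht ?_⟩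
    rw [mem_ball, Real.dist_eq, abs_of_nonneg (by linarith)]
    linarith
  refine ⟨n, hn1, fun i => F (τ i) y, by simp [hτ], ?_, ?_, ?_, ?_, ?_⟩
  · simp only [hτ, hnh]
    simp [hF.zero]
  · intro i hi t ht
    obtain ⟨c, hc⟩ := hgood i hi.le
    have hz : F (τ i) y + t • (F (τ (i+1)) y - F (τ i) y) ∈ ball (F c y) (ρ c) := by
      apply (convex_ball _ _).add_smul_sub_mem
      · exact hc _ le_rfl (by linarith)
      · exact hc _ (by rw [hτs]; linarith) (by rw [hτs]; linarith)
      · exact ht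
    refine ⟨hρN c hz, ?_⟩
    rw [real_inner_comm]
    apply hF.incr (by rw [hτs]; linarith)
    intro u hu
    rw [hτs] at hu
    exact hρf c _ (hc u hu.1 (by linarith [hu.2])) _ hz
  · intro i hi
    obtain ⟨c, hc⟩ := hgood i (by omega)
    have e1 := hτs i
    have e2 := hτs (i+1)
    apply hF.incr (by linarith)
    intro u hu
    rw [real_inner_comm]
    have e3 : i + 1 + 1 = i + 2 := rfl
    rw [e3] at e2
    apply hF.incr (by linarith)
    intro u' hu'
    rw [e2, e1] at hu'
    rw [e1] at hu
    exact hρf c _ (hc u' (by linarith [hu'.1]) (by linarith [hu'.2])) _ (hc u hu.1 (by linarith [hu.2]))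
  · have e1 := hτs 0
    have e0 : τ 0 = -T := by simp [hτ]
    apply hF.incr (by simp only [zero_add] at e1; linarith)
    intro u hu
    simp only [zero_add] at e1
    rw [e1, e0] at hu
    apply hs
    rw [mem_ball, Real.dist_eq, abs_of_nonneg (by linarith [hu.1])]
    linarith [hu.2]
  · obtain ⟨m, rfl⟩ : ∃ m, n = m + 1 := ⟨n - 1, by omega⟩
    have e1 := hτs m
    have e0 : τ (m+1) = 0 := by simp only [hτ]; rw [hnh]; ring
    simp only [Nat.add_sub_cancel]
    apply hF.incr (by linarith)
    intro u hu
    rw [e0] at hu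
    apply he
    rw [mem_ball, Real.dist_eq, sub_zero, abs_of_nonpos hu.2]
    linarith [hu.1]

end

section
open Set Metric Filter
set_option linter.unusedSimpArgs false
set_option linter.unusedVariables false
open scoped RealInnerProductSpace
open scoped Topology

theorem polygon2 {f : Euc 2 → Euc 2} {F : ℝ → Euc 2 → Euc 2} (hF : FlowOf f F) {y : Euc 2}
    (hy : f y ≠ 0) {T : ℝ} (hT : 0 < T) {N : Set (Euc 2)} (hN : IsOpen N)
    (hNy : ∀ t ∈ Icc (-T) 0, F t y ∈ N) {ws we : Euc 2} (hws : 0 < ⟪f (F (-T) y), ws⟫)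
    (hwe : 0 < ⟪f y, we⟫) :
    ∃ n ≥ 1, ∃ x : ℕ → Euc 2, x 0 = F (-T) y ∧ x n = y ∧ x (n+1) = y + we ∧
      (∀ i < n, ∀ t ∈ Icc (0:ℝ) 1, x i + t • (x (i+1) - x i) ∈ N ∧
        0 < ⟪f (x i + t • (x (i+1) - x i)), x (i+1) - x i⟫) ∧
      (∀ i < n, 0 < ⟪x (i+1) - x i, x (i+2) - x (i+1)⟫) ∧
      0 < ⟪ws, x 1 - x 0⟫ := by
  obtain ⟨n, hn, x, h0, h1, h2, h3, h4, h5⟩ := polygon hF hy hT hN hNy hws hwe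
  have key : ∀ i ≤ n, (if i ≤ n then x i else y + we) = x i := fun i hi => if_pos hi
  refine ⟨n, hn, fun i => if i ≤ n then x i else y + we, ?_, ?_, ?_, ?_, ?_, ?_⟩
  · simp [h0]
  · simp [h1]
  · simp
  · intro i hi
    simp only [key i hi.le, key (i+1) hi]
    exact h2 i hi
  · intro i hi
    simp only [key i hi.le, key (i+1) hi]
    by_cases h6 : i + 1 < n
    · rw [key (i+2) h6]; exact h3 i h6
    · have : n = i + 1 := by omega
      subst this
      rw [if_neg (by omega), h1]
      simpa [h1] using h5
  · simp only [key 0 (by omega), key 1 hn]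
    rw [real_inner_comm]; exact h4

theorem LocSad.axis_in {φ : Euc 2 → ℝ} {f : Euc 2 → Euc 2} {F : ℝ → Euc 2 → Euc 2} {q e n : Euc 2} {r : ℝ}
    (h : LocSad φ f F q e n r) {u : ℝ} (hu : 0 < u) (hur : u < r) : ⟪f (q + u • e), e⟫ < 0 := by
  obtain ⟨κ, hκ, hc⟩ := h.coer
  have := hc _ (h.mem_ball_axis (s := u) (by rw [abs_of_pos hu]; exact hur))
  simp only [add_sub_cancel_left, inner_smul_right, h.on.ee, h.on.ne, norm_smul, h.on.he] at this
  simp only [mul_one, mul_zero, add_zero, Real.norm_eq_abs, mul_pow, sq_abs] at this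
  have h3 : 0 < κ * u ^ 2 := by positivity
  by_contra hcon
  push Not at hcon
  nlinarith [mul_nonneg hu.le hcon]

theorem LocSad.axis_seg {φ : Euc 2 → ℝ} {f : Euc 2 → Euc 2} {F : ℝ → Euc 2 → Euc 2} {q e n : Euc 2} {r : ℝ}
    (h : LocSad φ f F q e n r) {s t : ℝ} (hs : 0 < s) (hsr : s < r) (ht : 0 ≤ t) (ht1 : t < 1) :
    0 < ⟪f (q + s • e + t • (-(s • e))), -(s • e)⟫ := by
  have e1 : q + s • e + t • (-(s • e)) = q + ((1 - t) * s) • e := by module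
  have h1 := h.axis_in (u := (1 - t) * s) (mul_pos (by linarith) hs) (by nlinarith)
  rw [e1, inner_neg_right, inner_smul_right]
  nlinarith

namespace Sys
variable {φ : Euc 2 → ℝ} {f : Euc 2 → Euc 2} {F : ℝ → Euc 2 → Euc 2}

theorem down (S : Sys φ f F) {b : Euc 2} {m : ℝ}
    (h : Low φ F b ∨ ∃ p', φ p' < m ∧ BL F b p') : ∃ T > 0, φ (F (-T) b) < m := by
  rcases h with h | ⟨p', hp, h⟩
  · obtain ⟨t, ht, h1⟩ := h m
    refine ⟨-t + 1, by linarith, lt_of_le_of_lt (S.flow.phi_mono S.pot b ?_) h1⟩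
    linarith
  · have h1 := (S.pot.cont.tendsto p').comp h
    obtain ⟨t, h2, h3⟩ := ((h1.eventually_lt_const hp).and (eventually_lt_atBot 0)).exists
    exact ⟨-t, by linarith, by simpa using h2⟩

theorem lchain (S : Sys φ f F) {q e n : Euc 2} {r s lev T : ℝ} (h : LocSad φ f F q e n r)
    (hs : 0 < s) (hsr : s < r) {N2 : Set (Euc 2)} (hN : IsOpen N2) (hz : ∀ z ∈ N2, f z ≠ 0)
    (hT : 0 < T) (horb : ∀ t ∈ Icc (-T) 0, F t (q + s • e) ∈ N2) (hlev : φ (F (-T) (q + s • e)) < lev) :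
    ∃ φ1 f1, Pot φ1 f1 ∧ (∀ z ∈ N2, f1 z ≠ 0) ∧ φ1 (q + s • e) < lev ∧ (∀ z ∉ N2, φ1 =ᶠ[𝓝 z] φ) ∧
      ∀ t ∈ Ico (0:ℝ) 1, 0 < ⟪f1 (q + s • e + t • (-(s • e))), -(s • e)⟫ := by
  set y := q + s • e with hy
  have hyN : y ∈ N2 := by simpa [S.flow.zero] using horb 0 ⟨by linarith, le_rfl⟩
  have hfy : f y ≠ 0 := hz y hyN
  have hws : 0 < ⟪f (F (-T) y), f (F (-T) y)⟫ := by
    rw [real_inner_self_eq_norm_sq]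
    have := S.flow.ne_zero hfy (-T)
    positivity
  have hax : ∀ t ∈ Ico (0:ℝ) 1, 0 < ⟪f (y + t • (-(s • e))), -(s • e)⟫ :=
    fun t ht => h.axis_seg hs hsr ht.1 ht.2
  have hwe : 0 < ⟪f y, -(s • e)⟫ := by simpa using hax 0 ⟨le_rfl, zero_lt_one⟩
  obtain ⟨m, hm, x, x0, xm, xm1, h1, h2, -⟩ := polygon2 S.flow hfy hT hN horb hws hwe
  obtain ⟨φ1, f1, hg, h3, h4⟩ := chain hN (Good := GoodL lev N2) (fun _ _ _ hg => hg.1) (stepL lev N2) m φ f x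
    ⟨S.pot, hz, by rw [x0]; exact hlev⟩ (fun i hi t ht => (h1 i hi t ht).1)
    (fun t ht _ => Or.inl (h1 0 (by omega) t ht).2)
    (by
      intro i hi him t ht ht'
      rcases him.lt_or_eq with h5 | rfl
      · exact (h1 i h5 t ht).2
      · rw [xm1, xm, add_sub_cancel_left]
        exact hax t ⟨ht.1, by simpa using ht'⟩) h2
  rw [xm] at hg
  refine ⟨φ1, f1, hg.1, hg.2.1, hg.2.2, h3, ?_⟩
  intro t ht
  have := h4 t ht
  rw [xm1, xm, add_sub_cancel_left] at this
  rcases this with h5 | ⟨_, h5⟩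
  · exact h5
  · exact absurd h5 (hg.2.1 y hyN)

theorem mchain (S : Sys φ f F) {q e n p : Euc 2} {r s lev T : ℝ} (h : LocSad φ f F q e n r)
    (hs : 0 < s) (hsr : s < r) {N1 : Set (Euc 2)} (hN : IsOpen N1) (hp : IsSourceAt f p)
    (hz : ∀ z ∈ N1, f z = 0 → z = p)
    (hT : 0 < T) (horb : ∀ t ∈ Icc (-T) 0, F t (q + s • e) ∈ N1) (hlev : lev < φ p)
    (hseg : ∀ t ∈ Icc (0:ℝ) 1, p + t • (F (-T) (q + s • e) - p) ∈ N1)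
    (hpos : ∀ t ∈ Ioc (0:ℝ) 1, 0 < ⟪f (p + t • (F (-T) (q + s • e) - p)), F (-T) (q + s • e) - p⟫)
    {φ1 : Euc 2 → ℝ} {f1 : Euc 2 → Euc 2} (hP1 : Pot φ1 f1) (heq : ∀ z ∈ N1, φ1 =ᶠ[𝓝 z] φ)
    (heq2 : ∀ t ∈ Ico (0:ℝ) 1, φ1 =ᶠ[𝓝 (q + s • e + t • (-(s • e)))] φ) :
    ∃ φ2 f2, Pot φ2 f2 ∧ (∀ z ∈ N1, f2 z = 0 → z = q + s • e) ∧ Coer f2 (q + s • e) ∧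
      lev < φ2 (q + s • e) ∧ (∀ z ∉ N1, φ2 =ᶠ[𝓝 z] φ1) ∧
      ∀ t ∈ Ico (0:ℝ) 1, Posi f2 (q + s • e) (-(s • e)) t := by
  set y := q + s • e with hy
  have hax : ∀ t ∈ Ico (0:ℝ) 1, 0 < ⟪f (y + t • (-(s • e))), -(s • e)⟫ :=
    fun t ht => h.axis_seg hs hsr ht.1 ht.2
  have hwe : 0 < ⟪f y, -(s • e)⟫ := by simpa using hax 0 ⟨le_rfl, zero_lt_one⟩
  have hfy : f y ≠ 0 := by intro h0; rw [h0, inner_zero_left] at hwe; exact lt_irrefl _ hwe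
  have hws : 0 < ⟪f (F (-T) y), F (-T) y - p⟫ := by
    simpa using hpos 1 ⟨zero_lt_one, le_rfl⟩
  have hpN : p ∈ N1 := by simpa using hseg 0 ⟨le_rfl, zero_le_one⟩
  have hff : ∀ z ∈ N1, f1 z = f z := fun z hz => S.pot.eq_of_eventuallyEq hP1 (heq z hz)
  obtain ⟨m, hm, x, x0, xm, xm1, h1, h2, h6⟩ := polygon2 S.flow hfy hT hN horb hws hwe
  set X : ℕ → Euc 2 := fun i => Nat.casesOn i p x with hX
  have X0 : X 0 = p := rfl
  have XS : ∀ i, X (i+1) = x i := fun i => rfl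
  obtain ⟨φ2, f2, hg, h3, h4⟩ := chain hN (Good := GoodM lev N1) (fun _ _ _ hg => hg.1) (stepM lev N1)
    (m + 1) φ1 f1 X
    (by
      rw [X0]
      refine ⟨hP1, fun z hz1 h0 => hz z hz1 (by rw [← hff z hz1]; exact h0), ?_, ?_⟩
      · obtain ⟨c1, κ, hκ, c2⟩ := source_coer S.pot hp
        refine ⟨by rw [hff p hpN]; exact c1, κ, hκ, ?_⟩
        filter_upwards [c2, S.pot.eventuallyEq hP1 (heq p hpN)] with z hz1 hz2
        rw [hz2]; exact hz1
      · rw [(heq p hpN).eq_of_nhds]; exact hlev)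
    (by
      intro i hi t ht
      rcases i with _ | i
      · rw [XS, X0, x0]; exact hseg t ht
      · rw [XS, XS]; exact (h1 i (by omega) t ht).1)
    (by
      intro t ht _
      rw [show X 1 = x 0 from rfl, X0, x0]
      rcases ht.1.lt_or_eq with h7 | h7
      · left
        rw [hff _ (hseg t ht)]
        exact hpos t ⟨h7, ht.2⟩
      · right
        exact ⟨h7.symm, by rw [hff p hpN]; exact hp.1⟩)
    (by
      intro i hi him t ht ht'
      obtain ⟨j, rfl⟩ : ∃ j, i = j + 1 := ⟨i - 1, by omega⟩
      rw [XS, XS]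
      rcases (show j ≤ m by omega).lt_or_eq with h5 | rfl
      · have := h1 j h5 t ht
        rw [hff _ this.1]
        exact this.2
      · rw [xm1, xm, add_sub_cancel_left]
        have ht1 : t ∈ Ico (0:ℝ) 1 := ⟨ht.1, by simpa using ht'⟩
        rw [S.pot.eq_of_eventuallyEq hP1 (heq2 t ht1)]
        exact hax t ht1)
    (by
      intro i hi
      rcases i with _ | i
      · rw [X0]
        show 0 < ⟪x 0 - p, x 1 - x 0⟫
        rw [x0] at h6 ⊢
        exact h6
      · exact h2 i (by omega))
  rw [XS, xm] at hg
  refine ⟨φ2, f2, hg.1, hg.2.1, hg.2.2.1, hg.2.2.2, h3, ?_⟩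
  intro t ht
  have := h4 t ht
  rwa [XS, XS, xm1, xm, add_sub_cancel_left] at this

end Sys

end

section
open Set Metric Filter
set_option linter.unusedSimpArgs false
set_option linter.unusedVariables false
open scoped RealInnerProductSpace
open scoped Topology

namespace Sys
variable {φ : Euc 2 → ℝ} {f : Euc 2 → Euc 2} {F : ℝ → Euc 2 → Euc 2}

theorem assemble (S : Sys φ f F) (hc : HC φ f F) :
    ∃ q p N φ' f', IsSaddleAt f q ∧ IsSourceAt f p ∧ IsOpen N ∧ Bornology.IsBounded N ∧
      (∀ z ∈ N, Reg φ f F z ∨ BL F z q) ∧ (∀ z ∈ N, f z = 0 → z = p ∨ z = q) ∧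
      Pot φ' f' ∧ (∀ z ∉ N, φ' =ᶠ[𝓝 z] φ) ∧ (∀ z, f' z = 0 → f z = 0 ∧ z ≠ p ∧ z ≠ q) := by
  obtain ⟨q, p, e, n, r, hq, hp, h, hleft, hright⟩ := hc
  have hr := h.rpos
  set s := r / 2 with hs
  have hs0 : 0 < s := by linarith
  have hsr : s < r := by linarith
  -- the right side
  have hright' : ∀ u ∈ Ioo 0 r, q + u • e ∈ {x | Low φ F x ∨ ∃ p', p' ≠ p ∧ IsSourceAt f p' ∧ BL F x p'} := by
    intro u hu
    rcases hright with h1 | ⟨p', h1, h2, h3⟩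
    · exact Or.inl (h1 u hu)
    · exact Or.inr ⟨p', by rintro rfl; exact lt_irrefl _ h2, h1, h3 u hu⟩
  obtain ⟨T2, hT2, hd2⟩ := S.down (b := q + s • e) (m := φ p) (by
    rcases hright with h1 | ⟨p', h1, h2, h3⟩
    · exact Or.inl (h1 s ⟨hs0, hsr⟩)
    · exact Or.inr ⟨p', h2, h3 s ⟨hs0, hsr⟩⟩)
  obtain ⟨lev, hl1, hl2⟩ := exists_between hd2
  -- near the source
  obtain ⟨r1, hr1, hball⟩ := S.src_ball hp
  obtain ⟨-, κ, hκ, hco⟩ := source_coer S.pot hp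
  obtain ⟨r2, hr2, hco⟩ := Metric.eventually_nhds_iff_ball.1 hco
  have ha := hleft s ⟨hs0, hsr⟩
  obtain ⟨t1, ht1, ht1'⟩ := ((ha.eventually (ball_mem_nhds p (lt_min hr1 hr2))).and
    (eventually_lt_atBot 0)).exists
  obtain ⟨T1, rfl⟩ : ∃ T1, t1 = - T1 := ⟨-t1, by ring⟩
  have hT1 : 0 < T1 := by linarith
  have hb0 : f (q + s • e) ≠ 0 := by
    intro h0
    have := h.axis_in hs0 hsr
    rw [h0, inner_zero_left] at this
    exact lt_irrefl _ this
  have ha0 : f (q + s • (-e)) ≠ 0 := by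
    intro h0
    have := h.flip.axis_in hs0 hsr
    rw [h0, inner_zero_left] at this
    exact lt_irrefl _ this
  set z1 := F (-T1) (q + s • (-e)) with hz1
  have hz1p : z1 ≠ p := by
    intro h0
    exact S.flow.ne_zero ha0 (-T1) (by rw [← hz1, h0]; exact hp.1)
  have hzseg : ∀ t ∈ Icc (0:ℝ) 1, p + t • (z1 - p) ∈ ball p (min r1 r2) := fun t ht =>
    (convex_ball _ _).add_smul_sub_mem (mem_ball_self (lt_min hr1 hr2)) ht1 ht
  -- the domains
  obtain ⟨R, hR⟩ : ∃ R, ((fun t : ℝ => F t (q + s • e)) '' Icc (-T2) 0 ∪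
      ((fun t : ℝ => F t (q + s • (-e))) '' Icc (-T1) 0 ∪ (fun t : ℝ => p + t • (z1 - p)) '' Icc 0 1)) ⊆
        ball (0 : Euc 2) R := by
    have : IsCompact ((fun t : ℝ => F t (q + s • e)) '' Icc (-T2) 0 ∪
      ((fun t : ℝ => F t (q + s • (-e))) '' Icc (-T1) 0 ∪ (fun t : ℝ => p + t • (z1 - p)) '' Icc 0 1)) := by
      refine (isCompact_Icc.image (S.flow.cont_t _)).union ((isCompact_Icc.image (S.flow.cont_t _)).union
        (isCompact_Icc.image (by fun_prop)))
    exact this.isBounded.subset_ball 0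
  set N1 : Set (Euc 2) := {x | BL F x p} ∩ ball 0 R with hN1
  set N2 : Set (Euc 2) := ({x | Low φ F x ∨ ∃ p', p' ≠ p ∧ IsSourceAt f p' ∧ BL F x p'} ∩ {x | f x ≠ 0}) ∩
    ball 0 R with hN2
  have oN1 : IsOpen N1 := (S.e_open hp).inter isOpen_ball
  have oN2 : IsOpen N2 := ((S.rest_open p).inter (isOpen_ne_fun S.pot.contf continuous_const)).inter isOpen_ball
  have hdisj : ∀ z ∈ N1, z ∉ {x | Low φ F x ∨ ∃ p', p' ≠ p ∧ IsSourceAt f p' ∧ BL F x p'} := by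
    rintro z ⟨hz, -⟩ (h1 | ⟨p', h1, h2, h3⟩)
    · exact S.not_low_of_bl hz h1
    · exact h1 (bl_unique h3 hz)
  have hN12 : ∀ z ∈ N1, z ∉ N2 := fun z hz hz2 => hdisj z hz hz2.1.1
  have hqbl : BL F q q := S.bl_fixed hq.1
  have hq1 : q ∉ N1 := by
    rintro ⟨h1, -⟩
    exact hq.2.1 (bl_unique h1 hqbl ▸ hp)
  have hq2 : q ∉ N2 := fun h1 => h1.1.2 hq.1
  have horb2 : ∀ t ∈ Icc (-T2) 0, F t (q + s • e) ∈ N2 := by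
    intro t ht
    refine ⟨⟨?_, S.flow.ne_zero hb0 t⟩, hR (Or.inl ⟨t, ht, rfl⟩)⟩
    rcases hright' s ⟨hs0, hsr⟩ with h1 | ⟨p', h1, h2, h3⟩
    · exact Or.inl (S.low_shift h1 t)
    · exact Or.inr ⟨p', h1, h2, S.bl_shift h3 t⟩
  obtain ⟨φ1, f1, hP1, hz2, hlev2, heq1, hax2⟩ := S.lchain h hs0 hsr oN2 (fun z hz => hz.1.2) hT2 horb2 hl1
  have horb1 : ∀ t ∈ Icc (-T1) 0, F t (q + s • (-e)) ∈ N1 := fun t ht =>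
    ⟨S.bl_shift ha t, hR (Or.inr (Or.inl ⟨t, ht, rfl⟩))⟩
  have hseg1 : ∀ t ∈ Icc (0:ℝ) 1, p + t • (z1 - p) ∈ N1 := fun t ht =>
    ⟨hball _ (ball_subset_ball (min_le_left _ _) (hzseg t ht)), hR (Or.inr (Or.inr ⟨t, ht, rfl⟩))⟩
  have hN1z : ∀ z ∈ N1, f z = 0 → z = p := fun z hz h0 => bl_unique (S.bl_fixed h0) hz.1
  have hpN1 : p ∈ N1 := by simpa using hseg1 0 ⟨le_rfl, zero_le_one⟩
  obtain ⟨φ2, f2, hP2, hz3, hco2, hlev3, heq2, hax3⟩ := S.mchain h.flip hs0 hsr oN1 hp hN1z hT1 horb1 hl2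
    hseg1 (by
      intro t ht
      have h1 := hco _ (ball_subset_ball (min_le_right _ _) (hzseg t ⟨ht.1.le, ht.2⟩))
      rw [add_sub_cancel_left, inner_smul_right] at h1
      have h2 : 0 < ‖t • (z1 - p)‖ := by
        rw [norm_pos_iff]
        exact smul_ne_zero ht.1.ne' (sub_ne_zero.2 hz1p)
      have h3 : 0 < t * ⟪f (p + t • (z1 - p)), z1 - p⟫ := lt_of_lt_of_le (by positivity) h1
      exact (mul_pos_iff_of_pos_left ht.1).1 h3) hP1
    (fun z hz => heq1 z (hN12 z hz))
    (by
      intro t ht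
      apply heq1
      have e1 : q + s • (-e) + t • (-(s • (-e))) = q + ((1 - t) * s) • (-e) := by module
      rw [e1]
      intro h1
      have h2 := hleft ((1 - t) * s) ⟨mul_pos (by linarith [ht.2]) hs0, by nlinarith [ht.1]⟩
      rcases h1.1.1 with h1 | ⟨p', h1, h3, h4⟩
      · exact S.not_low_of_bl h2 h1
      · exact h1 (bl_unique h4 h2))
  have hN1e : ∀ u ∈ Ioo 0 r, q + u • e ∉ N1 := fun u hu hu' => hdisj _ hu' (hright' u hu)
  have eq1 : q + s • (-e) + s • e = q := by module
  have hf21 : ∀ z ∉ N1, f2 z = f1 z := fun z hz => hP1.eq_of_eventuallyEq hP2 (heq2 z hz)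
  obtain ⟨φ3, f3, hP3, heq3, hz4⟩ := stepC hP2 h.on (x := q + s • (-e)) (l := s) (b := 2 * s) hs0 (by linarith)
    hco2
    (by
      rw [eq1]
      obtain ⟨κ', hκ', hc⟩ := h.coer
      have e2 : φ2 =ᶠ[𝓝 q] φ := (heq2 q hq1).trans (heq1 q hq2)
      have e3 := S.pot.eventuallyEq hP2 e2
      refine ⟨by rw [e3.eq_of_nhds]; exact hq.1, κ', hκ', ?_⟩
      filter_upwards [e3, ball_mem_nhds q hr] with z h1 h2
      rw [h1]; exact hc z h2)
    (by
      intro u hu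
      have hus : u / s ∈ Ico (0:ℝ) 1 := ⟨by have := hu.1; positivity, (div_lt_one hs0).2 hu.2⟩
      rcases hax3 (u / s) hus with h1 | h1
      · have e1 : -(s • (-e)) = s • e := by simp
        rw [e1, smul_smul, div_mul_cancel₀ _ hs0.ne', inner_smul_right] at h1
        exact (mul_pos_iff_of_pos_left hs0).1 h1
      · exfalso
        have := h1.1
        rw [div_eq_zero_iff] at this
        rcases this with h2 | h2
        · linarith [hu.1]
        · linarith)
    (by
      intro u hu
      have e1 : q + s • (-e) + u • e = q + (u - s) • e := by module
      rw [e1, hf21 _ (hN1e _ ⟨by linarith [hu.1], by linarith [hu.2]⟩)]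
      set t := 1 - (u - s) / s with ht
      have hd : (u - s) / s ∈ Ioc (0:ℝ) 1 := by
        refine ⟨div_pos (by linarith [hu.1]) hs0, (div_le_one hs0).2 (by linarith [hu.2])⟩
      have h1 := hax2 t ⟨by linarith [hd.2], by linarith [hd.1]⟩
      have e2 : q + s • e + t • (-(s • e)) = q + (u - s) • e := by
        have : (u - s) = (1 - t) * s := by rw [ht]; field_simp; ring
        rw [this]; module
      rw [e2, inner_neg_right, inner_smul_right] at h1
      nlinarith)
    (by
      have e1 : q + s • (-e) + (2 * s) • e = q + s • e := by module
      rw [e1, (heq2 _ (hN1e s ⟨hs0, hsr⟩)).eq_of_nhds]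
      linarith) (N := ball q r) isOpen_ball
    (by
      intro u hu
      have e1 : q + s • (-e) + u • e = q + (u - s) • e := by module
      rw [e1]
      apply h.mem_ball_axis
      rw [abs_lt]
      constructor <;> linarith [hu.1, hu.2])
  refine ⟨q, p, N1 ∪ N2 ∪ ball q r, φ3, f3, hq, hp, (oN1.union oN2).union isOpen_ball, ?_, ?_, ?_, hP3, ?_, ?_⟩
  · exact ((isBounded_ball.subset inter_subset_right).union (isBounded_ball.subset inter_subset_right)).union
      isBounded_ball
  · rintro z ((hz | hz) | hz)
    · exact Or.inl (Or.inr ⟨p, hp, hz.1⟩)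
    · left
      rcases hz.1.1 with h1 | ⟨p', h1, h2, h3⟩
      · exact Or.inl h1
      · exact Or.inr ⟨p', h2, h3⟩
    · exact h.key z hz
  · rintro z ((hz | hz) | hz) h0
    · exact Or.inl (hN1z z hz h0)
    · exact absurd h0 hz.1.2
    · exact Or.inr (h.iso z (ball_subset_closedBall hz) h0)
  · intro z hz
    simp only [mem_union, not_or] at hz
    exact ((heq3 z hz.2).trans (heq2 z hz.1.1)).trans (heq1 z hz.1.2)
  · intro z h0
    obtain ⟨h1, h2, h3⟩ := hz4 z h0
    rw [eq1] at h3
    have h4 : z ∉ N1 := fun h4 => h2 (hz3 z h4 h1)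
    rw [hf21 z h4] at h1
    have h5 : z ∉ N2 := fun h5 => hz2 z h5 h1
    rw [S.pot.eq_of_eventuallyEq hP1 (heq1 z h5)] at h1
    exact ⟨h1, fun h6 => h4 (h6 ▸ hpN1), h3⟩

end Sys

end

section
open Set Metric Filter
set_option linter.unusedSimpArgs false
set_option linter.unusedVariables false
open scoped RealInnerProductSpace
open scoped Topology

/-- the conclusion of the main theorem -/
def Concl (f : Euc 2 → Euc 2) : Prop :=
  ∃ f' : Euc 2 → Euc 2, IsGenericGradient f' ∧ IsProper f' ∧
      ProperGradientHomotopic f f' ∧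
      (sourceSinkSet f').ncard < (sourceSinkSet f).ncard ∧
      (saddleSet f').ncard < (saddleSet f).ncard

theorem gen_neg {f : Euc 2 → Euc 2} (h : IsGenericGradient f) :
    IsGenericGradient (fun x => - f x) := by
  obtain ⟨φ, h1, h2, h3, h4, h5⟩ := h
  have hp : Pot φ f := Pot.mk' h1 h2
  refine ⟨fun x => - φ x, hp.neg.smooth, hp.neg.gradient_eq, ?_, ?_, nsc_neg h5⟩
  · intro p hp
    rw [fderiv_neg_fun]
    have h2 : ⇑(-fderiv ℝ f p) = (fun x => -x) ∘ (fderiv ℝ f p) := by ext; simp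
    rw [h2]
    exact (Equiv.neg (Euc 2)).bijective.comp (h3 p (neg_eq_zero.1 hp))
  · intro p q hp hq e
    exact h4 p q (neg_eq_zero.1 hp) (neg_eq_zero.1 hq) (neg_inj.1 e)

theorem proper_neg {f : Euc 2 → Euc 2} (h : IsProper f) : IsProper (fun x => - f x) := by
  intro K hK
  have := h (-K) hK.neg
  exact this

theorem sourceSink_neg (f : Euc 2 → Euc 2) :
    sourceSinkSet (fun x => - f x) = sourceSinkSet f := by
  ext p
  show (IsSourceAt _ p ∨ IsSinkAt _ p) ↔ (IsSourceAt _ p ∨ IsSinkAt _ p)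
  rw [source_neg, sink_neg, or_comm]

theorem saddleSet_neg (f : Euc 2 → Euc 2) :
    saddleSet (fun x => - f x) = saddleSet f := by
  ext p
  exact saddle_neg

theorem grad_neg {f : Euc 2 → Euc 2} (h : IsGradient f) : IsGradient (fun x => - f x) := by
  obtain ⟨φ, h1, h2⟩ := h
  refine ⟨fun x => - φ x, h1.neg, fun x => ?_⟩
  show gradient (fun x => - φ x) x = - f x
  rw [← h2 x]
  simp only [gradient]
  rw [fderiv_fun_neg, map_neg]

theorem homot_neg {f g : Euc 2 → Euc 2} (h : ProperGradientHomotopic f g) :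
    ProperGradientHomotopic (fun x => - f x) (fun x => - g x) := by
  obtain ⟨h, ⟨h1, h2, h3⟩, h4, h5⟩ := h
  refine ⟨fun t x => - h t x, ⟨h1.neg, fun t ht => grad_neg (h2 t ht), ?_⟩, by simp only [h4],
    by simp only [h5]⟩
  intro K hK
  exact h3 (-K) hK.neg

theorem Concl.neg {f : Euc 2 → Euc 2} (h : Concl (fun x => - f x)) : Concl f := by
  obtain ⟨g, h1, h2, h3, h4, h5⟩ := h
  refine ⟨fun x => - g x, gen_neg h1, proper_neg h2, ?_, ?_, ?_⟩
  · have := homot_neg h3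
    simpa using this
  · rwa [sourceSink_neg, ← sourceSink_neg f]
  · rwa [saddleSet_neg, ← saddleSet_neg f]

theorem homot_line {φ ψ : Euc 2 → ℝ} {f g : Euc 2 → Euc 2} (hf : Pot φ f) (hg : Pot ψ g)
    (hp : IsProper f) {N : Set (Euc 2)} (hN : Bornology.IsBounded N)
    (heq : ∀ z ∉ N, g z = f z) : IsProper g ∧ ProperGradientHomotopic f g := by
  have hcf := hf.contf
  have hcg := hg.contf
  have hNc : IsCompact (closure N) := hN.isCompact_closure
  constructor
  · intro K hK
    refine ((hp K hK).union hNc).of_isClosed_subset (hK.isClosed.preimage hcg) ?_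
    intro z hz
    by_cases h : z ∈ N
    · exact Or.inr (subset_closure h)
    · left
      show f z ∈ K
      rw [← heq z h]; exact hz
  · have hc : Continuous (fun p : ℝ × Euc 2 => (1 - p.1) • f p.2 + p.1 • g p.2) := by fun_prop
    refine ⟨fun t x => (1 - t) • f x + t • g x, ⟨hc.continuousOn, ?_, ?_⟩, ?_, ?_⟩
    · intro t _
      refine ⟨fun x => (1 - t) * φ x + t * ψ x, ?_, ?_⟩
      · have h1 := hf.smooth.of_le (m := 1) (by norm_num)
        have h2 := hg.smooth.of_le (m := 1) (by norm_num)
        fun_prop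
      · intro x
        have h1 : HasFDerivAt (fun x => (1 - t) * φ x + t * ψ x)
            ((1 - t) • innerSL ℝ (f x) + t • innerSL ℝ (g x)) x :=
          ((hf.hasFDerivAt x).const_mul (1 - t)).add ((hg.hasFDerivAt x).const_mul t)
        apply HasGradientAt.gradient
        rw [hasGradientAt_iff_hasFDerivAt]
        have e : (1 - t) • innerSL ℝ (f x) + t • innerSL ℝ (g x) =
            InnerProductSpace.toDual ℝ (Euc 2) ((1 - t) • f x + t • g x) := by
          ext v
          simp [InnerProductSpace.toDual_apply_apply, inner_add_left, inner_smul_left]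
        rw [e] at h1
        exact h1
    · intro K hK
      have hcl : IsClosed {p : ℝ × Euc 2 | p.1 ∈ Icc (0:ℝ) 1 ∧
          (1 - p.1) • f p.2 + p.1 • g p.2 ∈ K} :=
        (isClosed_Icc.preimage continuous_fst).inter (hK.isClosed.preimage hc)
      refine ((isCompact_Icc (a := (0:ℝ)) (b := 1)).prod ((hp K hK).union hNc)).of_isClosed_subset
        hcl ?_
      rintro ⟨t, z⟩ ⟨ht, hz⟩
      refine ⟨ht, ?_⟩
      by_cases h : z ∈ N
      · exact Or.inr (subset_closure h)
      · left
        show f z ∈ K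
        simp only [heq z h] at hz
        rw [← add_smul] at hz
        simpa using hz
    · funext x; simp
    · funext x; simp

namespace Sys
variable {φ : Euc 2 → ℝ} {f : Euc 2 → Euc 2} {F : ℝ → Euc 2 → Euc 2}

theorem conclude (S : Sys φ f F) (hc : HC φ f F) : Concl f := by
  obtain ⟨q, p, N, φ', f', hq, hp, hNo, hNb, hN1, hN2, hP, hout, hz⟩ := S.assemble hc
  have heq : ∀ z ∉ N, f' z = f z := fun z h => S.pot.eq_of_eventuallyEq hP (hout z h)
  have hev : ∀ z ∉ N, f' =ᶠ[𝓝 z] f := fun z h => S.pot.eventuallyEq hP (hout z h)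
  have hfd : ∀ z ∉ N, fderiv ℝ f' z = fderiv ℝ f z := fun z h =>
    S.pot.fderiv_eq_of_eventuallyEq hP (hout z h)
  have hzN : ∀ z, f' z = 0 → z ∉ N := by
    intro z h hzN
    obtain ⟨h1, h2, h3⟩ := hz z h
    rcases hN2 z hzN h1 with h | h
    · exact h2 h
    · exact h3 h
  have hsrc : ∀ z, f' z = 0 → (IsSourceAt f' z ↔ IsSourceAt f z) := by
    intro z h
    simp only [IsSourceAt, heq z (hzN z h), hfd z (hzN z h)]
  have hsnk : ∀ z, f' z = 0 → (IsSinkAt f' z ↔ IsSinkAt f z) := by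
    intro z h
    simp only [IsSinkAt, heq z (hzN z h), hfd z (hzN z h)]
  have hsad : ∀ z, IsSaddleAt f' z → IsSaddleAt f z := by
    rintro z ⟨h, h1, h2⟩
    exact ⟨(hz z h).1, fun h' => h1 ((hsrc z h).2 h'), fun h' => h2 ((hsnk z h).2 h')⟩
  obtain ⟨hpr, hho⟩ := homot_line S.pot hP S.proper hNb heq
  refine ⟨f', ⟨φ', hP.smooth, hP.gradient_eq, ?_, ?_, ?_⟩, hpr, hho, ?_, ?_⟩
  · intro z h
    rw [hfd z (hzN z h)]
    exact S.nondeg z (hz z h).1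
  · intro a b ha hb e
    rw [(hout a (hzN a ha)).eq_of_nhds, (hout b (hzN b hb)).eq_of_nhds] at e
    exact S.inj a b (hz a ha).1 (hz b hb).1 e
  · rintro ⟨γ, s1, s2, hγ, hs1, hs2, hne, hl1, hl2⟩
    have hγc : Continuous γ := continuous_iff_continuousAt.2 fun t => (hγ t).continuousAt
    have hSN : ∀ z, z ∈ closure {x | f' x ≠ f x} → z ∈ N := by
      intro z h
      by_contra hn
      rw [mem_closure_iff_frequently] at h
      exact h ((hev z hn).mono fun x hx h' => h' hx)
    have hSe : ∀ z, z ∉ closure {x | f' x ≠ f x} → f' z = f z := by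
      intro z h
      by_contra hn
      exact h (subset_closure hn)
    set T : Set ℝ := {t | γ t ∈ closure {x | f' x ≠ f x}} with hT
    have hTc : IsClosed T := isClosed_closure.preimage hγc
    by_cases hTe : T.Nonempty
    · have hTb : BddBelow T := by
        have h1 : ∀ᶠ t in atBot, γ t ∈ (closure {x | f' x ≠ f x})ᶜ :=
          hl1.eventually (isClosed_closure.isOpen_compl.mem_nhds
            fun h => hzN s1 hs1.1 (hSN _ h))
        obtain ⟨a, ha⟩ := eventually_atBot.1 h1
        refine ⟨a, fun t ht => ?_⟩
        by_contra hlt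
        exact ha t (not_le.1 hlt).le ht
      have ht0 := hTc.csInf_mem hTe hTb
      set t0 := sInf T
      have hlt : ∀ t : ℝ, t < t0 → f' (γ t) = f (γ t) := fun t ht =>
        hSe _ fun h => (csInf_le hTb h).not_gt ht
      have hle : ∀ t : ℝ, t ≤ t0 → f' (γ t) = f (γ t) := by
        have hcl : IsClosed {t : ℝ | f' (γ t) = f (γ t)} :=
          isClosed_eq (hP.contf.comp hγc) (S.pot.contf.comp hγc)
        have := closure_minimal (s := Iio t0) (fun t ht => hlt t ht) hcl
        rw [closure_Iio] at this
        exact fun t ht => this ht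
      have hB : InBackwardBasin f s1 (γ t0) := by
        refine ⟨fun t => γ (t + t0), by simp, ?_, ?_⟩
        · intro t ht
          have h1 := (hγ (t + t0)).comp_add_const t t0
          rw [hle _ (by simpa using ht)] at h1
          exact h1
        · exact hl1.comp (tendsto_atBot_add_const_right _ _ tendsto_id)
      have hBL := S.flow.bl_of_basin hB
      rcases hN1 _ (hSN _ ht0) with h | h
      · exact S.not_reg_of_saddle (hsad _ hs1) hBL h
      · exact (hz s1 hs1.1).2.2 (bl_unique hBL h)
    · refine S.nsc ⟨γ, s1, s2, fun t => ?_, hsad _ hs1, hsad _ hs2, hne, hl1, hl2⟩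
      have h1 := hγ t
      rw [hSe _ fun h => hTe ⟨t, h⟩] at h1
      exact h1
  · apply ncard_lt_ncard
    · rw [ssubset_iff_of_subset]
      · exact ⟨p, Or.inl hp, fun h => by
          have h0 : f' p = 0 := by rcases h with h | h <;> exact h.1
          exact (hz p h0).2.1 rfl⟩
      · rintro z (h | h)
        · exact Or.inl ((hsrc z h.1).1 h)
        · exact Or.inr ((hsnk z h.1).1 h)
    · refine S.crit_finite.subset ?_
      rintro z (h | h) <;> exact h.1
  · apply ncard_lt_ncard
    · rw [ssubset_iff_of_subset]
      · exact ⟨q, hq, fun h => (hz q h.1).2.2 rfl⟩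
      · exact fun z h => hsad z h
    · exact S.crit_finite.subset fun z h => h.1

theorem concl_source (S : Sys φ f F) {p s0 : Euc 2} (hp : IsSourceAt f p)
    (hs0 : IsSaddleAt f s0) : Concl f := by
  rcases S.hc hp hs0 with h | h
  · exact S.conclude h
  · exact (S.neg.conclude h).neg

end Sys

theorem main_aux (f : Euc 2 → Euc 2)
    (hgen : IsGenericGradient f) (hprop : IsProper f)
    (hA : (sourceSinkSet f).Nonempty) (hB : (saddleSet f).Nonempty) : Concl f := by
  obtain ⟨φ, h1, h2, h3, h4, h5⟩ := hgen
  have hP : Pot φ f := Pot.mk' h1 h2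
  obtain ⟨F, hF⟩ := exists_flow hP.contDiff
  have S : Sys φ f F := ⟨hP, hF, hprop, h3, h4, h5⟩
  obtain ⟨s0, hs0⟩ := hB
  obtain ⟨p, hp | hp⟩ := hA
  · exact S.concl_source hp hs0
  · exact (S.neg.concl_source (source_neg.2 hp) (saddle_neg.2 hs0)).neg

end

/-- if `f` is a generic proper gradient map on `ℝ²` whose set `A_f` of sources
and sinks and set `B_f` of saddles are both nonempty, then there is a generic proper
gradient map `f'` proper gradient homotopic to `f` with `|A_{f'}| < |A_f|` and
`|B_{f'}| < |B_f|`. -/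
theorem cancel_critical_points (f : Euc 2 → Euc 2)
    (hgen : IsGenericGradient f) (hprop : IsProper f)
    (hA : (sourceSinkSet f).Nonempty) (hB : (saddleSet f).Nonempty) :
    ∃ f' : Euc 2 → Euc 2, IsGenericGradient f' ∧ IsProper f' ∧
      ProperGradientHomotopic f f' ∧
      (sourceSinkSet f').ncard < (sourceSinkSet f).ncard ∧
      (saddleSet f').ncard < (saddleSet f).ncard := by
  exact main_aux f hgen hprop hA hB
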